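/- Let r>0, d>1, 1≤k≤d, and N ≥ (1 + √(2d/(d+1)))^d. Suppose Q = {q_1,…,q_N} ⊆ ℝ^d is a uniform contraction of P = {p_1,…,p_N} ⊆ ℝ^d, i.e., there exists λ>0 with |q_i − q_j| ≤ λ ≤ |p_i − p_j| for all 1≤i<j≤N. Then V_k(P^r) ≤ V_k(Q^r), where X^r := ⋂_{x∈X} B[x,r]. -/

import Mathlib

open MeasureTheory Metric Pointwise

/-- Volume of the unit ball in `ℝ^m`. -/
noncomputable def ballVolume (m : ℕ) : ℝ :=
  (volume (closedBall (0 : EuclideanSpace ℝ (Fin m)) 1)).toReal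

/-- The `k`-th intrinsic volume of a set in `ℝ^d`, defined via the Steiner formula:
`vol(A + εB) = Σ_i ω_{d-i} V_i(A) ε^{d-i}`; the Steiner polynomial is recovered by
Lagrange interpolation of `ε ↦ vol(A + εB)` at `ε = 0, 1, …, d`. -/
noncomputable def intrinsicVolume (d k : ℕ) (A : Set (EuclideanSpace ℝ (Fin d))) : ℝ :=
  ((Lagrange.interpolate (Finset.range (d + 1)) (fun j => (j : ℝ)))
      (fun j =>
        (volume (A + closedBall (0 : EuclideanSpace ℝ (Fin d)) (j : ℝ))).toReal)).coeff
      (d - k) / ballVolume (d - k)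

/-- The circumradius of a set. -/
noncomputable def circumradius {d : ℕ} (A : Set (EuclideanSpace ℝ (Fin d))) : ℝ :=
  sInf {r : ℝ | 0 < r ∧ ∃ p, A ⊆ closedBall p r}

/-- The `r`-dual (`r`-ball body generated by `A`): `A^r = ⋂_{p ∈ A} B[p,r]`. -/
def rDual {d : ℕ} (r : ℝ) (A : Set (EuclideanSpace ℝ (Fin d))) : Set (EuclideanSpace ℝ (Fin d)) :=
  ⋂ p ∈ A, closedBall p r

/-- The `r`-ball convex hull: intersection of all closed balls of radius `r` containing `A`. -/
def rHull {d : ℕ} (r : ℝ) (A : Set (EuclideanSpace ℝ (Fin d))) : Set (EuclideanSpace ℝ (Fin d)) :=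
  ⋂ p ∈ {p : EuclideanSpace ℝ (Fin d) | A ⊆ closedBall p r}, closedBall p r

/-- The Euclidean space. -/
abbrev Eu (d : ℕ) := EuclideanSpace ℝ (Fin d)

open Polynomial in
theorem newton_aux {ι : Type*} [DecidableEq ι] (s : Finset ι) (a : ι → ℝ) (ha : ∀ i ∈ s, 0 ≤ a i)
    (i : ℕ) :
    ((s.card : ℝ) * ((s.card : ℝ) - i)) * (∏ j ∈ s, (X + C (a j))).coeff i
      ≤ (i + 1) * (∏ j ∈ s, (X + C (a j))).coeff (i + 1) * ∑ j ∈ s, a j := by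
  set p : ℝ[X] := ∏ j ∈ s, (X + C (a j)) with hp
  have hder : derivative p = ∑ j ∈ s, ∏ l ∈ s.erase j, (X + C (a l)) := by
    rw [hp, derivative_prod_finset]
    simp
  set q : ι → ℝ[X] := fun j => ∏ l ∈ s.erase j, (X + C (a l)) with hq
  have hqp : ∀ j ∈ s, (X + C (a j)) * q j = p := fun j hj => Finset.mul_prod_erase s _ hj
  have h1 : (i + 1 : ℝ) * p.coeff (i + 1) = ∑ j ∈ s, (q j).coeff i := by
    have := congrArg (fun P => P.coeff i) hder
    simp only [coeff_derivative, finsetSum_coeff] at this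
    rw [← this]; ring
  have h2 : ((s.card : ℝ) - i) * p.coeff i = ∑ j ∈ s, a j * (q j).coeff i := by
    have e : ∑ j ∈ s, C (a j) * q j = (s.card : ℝ[X]) * p - X * derivative p := by
      have : ∑ j ∈ s, (X + C (a j)) * q j = ∑ j ∈ s, p := Finset.sum_congr rfl hqp
      simp only [add_mul, Finset.sum_add_distrib, ← Finset.mul_sum] at this
      rw [hder, Finset.sum_const, nsmul_eq_mul] at *
      linear_combination this
    have := congrArg (fun P => P.coeff i) e
    simp only [finsetSum_coeff, coeff_C_mul, coeff_sub] at this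
    rw [this]
    have h3 : ((s.card : ℝ[X]) * p).coeff i = s.card * p.coeff i := by
      rw [← C_eq_natCast, coeff_C_mul]
    have h4 : (X * derivative p).coeff i = i * p.coeff i := by
      cases i with
      | zero => simp
      | succ i => rw [coeff_X_mul, coeff_derivative]; push_cast; ring
    rw [h3, h4]; ring
  have hnn : ∀ (t : Finset ι), t ⊆ s → ∀ i, 0 ≤ (∏ l ∈ t, (X + C (a l))).coeff i := by
    intro t
    induction t using Finset.induction_on with
    | empty => intro _ i; simp only [Finset.prod_empty, coeff_one]; split_ifs <;> norm_num
    | insert x t hx ih =>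
      intro ht i
      have ih' := ih (fun y hy => ht (Finset.mem_insert_of_mem hy))
      rw [Finset.prod_insert hx, add_mul, coeff_add, coeff_C_mul]
      have hax := ha x (ht (Finset.mem_insert_self _ _))
      refine add_nonneg ?_ (mul_nonneg hax (ih' _))
      cases i with
      | zero => simp
      | succ i => rw [coeff_X_mul]; exact ih' _
  have hanti : AntivaryOn a (fun j => (q j).coeff i) (s : Set ι) := by
    intro j hj l hl hlt
    by_contra hcon
    push Not at hcon
    have hjl : j ≠ l := by rintro rfl; exact lt_irrefl _ hlt
    have hj' : j ∈ s.erase l := Finset.mem_erase.2 ⟨hjl, hj⟩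
    have hl' : l ∈ s.erase j := Finset.mem_erase.2 ⟨hjl.symm, hl⟩
    have e1 : q j = (X + C (a l)) * ∏ m ∈ (s.erase j).erase l, (X + C (a m)) :=
      (Finset.mul_prod_erase _ _ hl').symm
    have e2 : q l = (X + C (a j)) * ∏ m ∈ (s.erase j).erase l, (X + C (a m)) := by
      rw [Finset.erase_right_comm]; exact (Finset.mul_prod_erase _ _ hj').symm
    have e3 : q l - q j = C (a j - a l) * ∏ m ∈ (s.erase j).erase l, (X + C (a m)) := by
      rw [e1, e2, C_sub]; ring
    have e4 := congrArg (fun P => P.coeff i) e3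
    simp only [coeff_sub, coeff_C_mul] at e4
    have := hnn ((s.erase j).erase l)
      ((Finset.erase_subset _ _).trans (Finset.erase_subset _ _)) i
    nlinarith
  have hch := hanti.card_mul_sum_le_sum_mul_sum
  rw [h1]
  calc _ = (s.card : ℝ) * (((s.card : ℝ) - i) * p.coeff i) := by ring
    _ = (s.card : ℝ) * ∑ j ∈ s, a j * (q j).coeff i := by rw [h2]
    _ ≤ (∑ j ∈ s, a j) * ∑ j ∈ s, (q j).coeff i := hch
    _ = _ := by ring

/-- Polynomial `det (A + X)`. -/
noncomputable def cpoly {d : ℕ} (A : Eu d →L[ℝ] Eu d) : Polynomial ℝ :=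
  LinearMap.charpoly (-(A : Eu d →ₗ[ℝ] Eu d))

/-- `det (A + X) / X` -/
noncomputable def ppoly {d : ℕ} (A : Eu d →L[ℝ] Eu d) : Polynomial ℝ := (cpoly A).divX

/-- coefficients of `ppoly` -/
noncomputable def cc {d : ℕ} (A : Eu d →L[ℝ] Eu d) (i : ℕ) : ℝ := (ppoly A).coeff i

/-- rank one projection -/
noncomputable def ru {d : ℕ} (u : Eu d) : Eu d →L[ℝ] Eu d := (innerSL ℝ u).smulRight u

theorem ru_apply {d : ℕ} (u x : Eu d) : ru u x = (inner ℝ u x : ℝ) • u := by simp [ru]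

theorem cpoly_eval {d : ℕ} (A : Eu d →L[ℝ] Eu d) (t : ℝ) :
    (cpoly A).eval t = (A + t • (1 : Eu d →L[ℝ] Eu d)).det := by
  rw [cpoly, LinearMap.eval_charpoly, ContinuousLinearMap.det]
  congr 1
  ext x : 1
  simp [Algebra.algebraMap_eq_smul_one, add_comm]

theorem cpoly_monic {d : ℕ} (A : Eu d →L[ℝ] Eu d) : (cpoly A).Monic := LinearMap.charpoly_monic _

theorem cpoly_natDegree {d : ℕ} (A : Eu d →L[ℝ] Eu d) : (cpoly A).natDegree = d := by
  rw [cpoly, LinearMap.charpoly_natDegree]; simp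

theorem det_zero_of_ker {d : ℕ} (A : Eu d →L[ℝ] Eu d) (u : Eu d) (hu : u ≠ 0) (h : A u = 0) :
    A.det = 0 := by
  by_contra hne
  have : IsUnit (LinearMap.det (A : Eu d →ₗ[ℝ] Eu d)) := isUnit_iff_ne_zero.2 hne
  have hk := LinearMap.ker_eq_bot.1 ((LinearMap.isUnit_iff_ker_eq_bot _).1
    ((LinearMap.isUnit_iff_isUnit_det _).2 this))
  exact hu (hk (by simpa using h))

theorem cpoly_eq {d : ℕ} (A : Eu d →L[ℝ] Eu d) (u : Eu d) (hu : u ≠ 0) (h : A u = 0) :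
    cpoly A = ppoly A * Polynomial.X := by
  have h0 : (cpoly A).coeff 0 = 0 := by
    rw [Polynomial.coeff_zero_eq_eval_zero, cpoly_eval]
    have e : A + (0 : ℝ) • (1 : Eu d →L[ℝ] Eu d) = A := by ext; simp
    rw [e]; exact det_zero_of_ker A u hu h
  have := Polynomial.divX_mul_X_add (cpoly A)
  rw [h0] at this
  simpa [ppoly] using this.symm

theorem det_eq_ppoly {d : ℕ} (A : Eu d →L[ℝ] Eu d) (u : Eu d) (hu : u ≠ 0) (h : A u = 0) (t : ℝ) :
    (A + t • (1 : Eu d →L[ℝ] Eu d)).det = (ppoly A).eval t * t := by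
  rw [← cpoly_eval, cpoly_eq A u hu h]; simp

theorem ppoly_natDegree {d : ℕ} (A : Eu d →L[ℝ] Eu d) : (ppoly A).natDegree = d - 1 := by
  rw [ppoly, Polynomial.natDegree_divX_eq_natDegree_tsub_one, cpoly_natDegree]

theorem ppoly_eval {d : ℕ} (hd : 1 < d) (A : Eu d →L[ℝ] Eu d) (t : ℝ) :
    (ppoly A).eval t = ∑ i ∈ Finset.range d, cc A i * t ^ i := by
  rw [Polynomial.eval_eq_sum_range, ppoly_natDegree]
  rw [Nat.sub_add_cancel (by omega)]; rfl

theorem ppoly_eval_zero {d : ℕ} (A : Eu d →L[ℝ] Eu d) : (ppoly A).eval 0 = cc A 0 := by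
  rw [cc, Polynomial.coeff_zero_eq_eval_zero]

theorem cc_top {d : ℕ} (hd : 1 < d) (A : Eu d →L[ℝ] Eu d) : cc A (d - 1) = 1 := by
  rw [cc, ppoly, Polynomial.coeff_divX, Nat.sub_add_cancel (by omega)]
  have := (cpoly_monic A).coeff_natDegree
  rwa [cpoly_natDegree] at this

theorem cc_continuous {d : ℕ} (i : ℕ) : Continuous (fun A : Eu d →L[ℝ] Eu d => cc A i) := by
  let b := (EuclideanSpace.basisFun (Fin d) ℝ).toBasis
  have : (fun A : Eu d →L[ℝ] Eu d => cc A i) = fun A : Eu d →L[ℝ] Eu d =>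
      MvPolynomial.eval (fun ij : Fin d × Fin d => -((b.repr (A (b ij.2))) ij.1))
        ((Matrix.charpoly.univ ℝ (Fin d)).coeff (i + 1)) := by
    funext A
    rw [cc, ppoly, Polynomial.coeff_divX, cpoly, ← LinearMap.charpoly_toMatrix _ b]
    have := Matrix.charpoly.univ_coeff_eval₂Hom (Fin d) (RingHom.id ℝ)
      (fun ij : Fin d × Fin d => -((b.repr (A (b ij.2))) ij.1)) (i + 1)
    rw [MvPolynomial.coe_eval₂Hom] at this
    rw [MvPolynomial.eval, MvPolynomial.coe_eval₂Hom, this]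
    congr 2
    ext x y
    simp [LinearMap.toMatrix_apply]
  rw [this]
  have hc : Continuous (fun A : Eu d →L[ℝ] Eu d =>
      (fun ij : Fin d × Fin d => -((b.repr (A (b ij.2))) ij.1))) := by
    refine continuous_pi fun ij => Continuous.neg ?_
    have : Continuous fun x : Eu d => b.repr x ij.1 := by
      simp only [b, OrthonormalBasis.coe_toBasis_repr_apply, EuclideanSpace.basisFun_repr]
      fun_prop
    exact this.comp (by fun_prop)
  exact (MvPolynomial.continuous_eval _).comp hc

theorem clm_mul_det {d : ℕ} (A B : Eu d →L[ℝ] Eu d) : (A.comp B).det = A.det * B.det := by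
  simp only [ContinuousLinearMap.det]
  rw [← LinearMap.det_comp]; rfl

theorem det_one_add_ru {d : ℕ} (u : Eu d) (hu : ‖u‖ = 1) (c : ℝ) :
    ((1 : Eu d →L[ℝ] Eu d) + c • ru u).det = 1 + c := by
  have e : (((1 : Eu d →L[ℝ] Eu d) + c • ru u : Eu d →L[ℝ] Eu d) : Eu d →ₗ[ℝ] Eu d) =
      LinearMap.transvection (c • (innerₛₗ ℝ u)) u := by
    ext x : 1
    simp [ru_apply, LinearMap.transvection.apply, smul_smul]
  rw [ContinuousLinearMap.det, e, LinearMap.transvection.det]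
  simp [hu]

theorem det_add_ru {d : ℕ} (A : Eu d →L[ℝ] Eu d) (u : Eu d) (hu : ‖u‖ = 1) (h : A u = 0)
    (s t : ℝ) (ht : t ≠ 0) :
    (A + s • ru u + t • (1 : Eu d →L[ℝ] Eu d)).det = (ppoly A).eval t * (t + s) := by
  have hu0 : u ≠ 0 := by rintro rfl; simp at hu
  have e : (A + s • ru u + t • (1 : Eu d →L[ℝ] Eu d)) =
      (A + t • (1 : Eu d →L[ℝ] Eu d)).comp (1 + (s / t) • ru u) := by
    ext x : 1
    simp only [add_apply, smul_apply, ru_apply,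
      one_apply_eq_self, ContinuousLinearMap.comp_apply, map_add, map_smul, h,
      smul_add, smul_smul]
    have : s / t * inner ℝ u x * t = s * inner ℝ u x := by field_simp
    have h2 : t * (s / t * inner ℝ u x) = s * inner ℝ u x := by field_simp
    simp only [smul_zero, zero_add, this]
    abel
  rw [e, clm_mul_det, det_eq_ppoly A u hu0 h, det_one_add_ru u hu]
  field_simp

theorem ppoly_shift {d : ℕ} (A : Eu d →L[ℝ] Eu d) (u : Eu d) (hu : ‖u‖ = 1) (h : A u = 0)
    (s : ℝ) :
    ppoly (A + s • (1 - ru u)) = (ppoly A).comp (Polynomial.X + Polynomial.C s) := by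
  have hu0 : u ≠ 0 := by rintro rfl; simp at hu
  have huu : (inner ℝ u u : ℝ) = 1 := by simp [hu]
  refine Polynomial.eq_of_infinite_eval_eq _ _ (Set.Infinite.mono (s := Set.Ioi (|s|)) ?_
    (Set.Ioi_infinite _))
  intro t ht
  have ht : |s| < t := ht
  have h1 : t ≠ 0 := by have := abs_nonneg s; linarith
  have h2 : t + s ≠ 0 := by have := neg_abs_le s; intro; linarith
  have hk : (A + s • (1 - ru u)) u = 0 := by simp [ru_apply, h, huu, hu]
  have e1 := det_eq_ppoly (A + s • (1 - ru u)) u hu0 hk t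
  have e2 := det_add_ru A u hu h (-s) (t + s) h2
  have e3 : A + s • (1 - ru u) + t • (1 : Eu d →L[ℝ] Eu d) =
      A + (-s) • ru u + (t + s) • (1 : Eu d →L[ℝ] Eu d) := by
    ext x : 1
    simp only [add_apply, smul_apply, ru_apply,
      one_apply_eq_self, sub_apply]
    module
  rw [e3, e2] at e1
  simp only [Set.mem_ofPred_eq, Polynomial.eval_comp, Polynomial.eval_add, Polynomial.eval_X,
    Polynomial.eval_C]
  have : (t + s + -s) = t := by ring
  rw [this] at e1
  exact (mul_right_cancel₀ h1 e1).symm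

theorem cc_shift {d : ℕ} (hd : 1 < d) (A : Eu d →L[ℝ] Eu d) (u : Eu d) (hu : ‖u‖ = 1)
    (h : A u = 0) (s : ℝ) :
    cc (A + s • (1 - ru u)) 0 = ∑ i ∈ Finset.range d, cc A i * s ^ i := by
  rw [← ppoly_eval hd, ← ppoly_eval_zero, ppoly_shift A u hu h]
  simp

theorem ppoly_smul {d : ℕ} (A : Eu d →L[ℝ] Eu d) (i : ℕ) (hi : i < d) (c : ℝ) :
    cc (c • A) i = c ^ (d - 1 - i) * cc A i := by
  by_cases hc : c = 0
  · subst hc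
    have e : cpoly ((0 : ℝ) • A) = Polynomial.X ^ d := by
      have e0 : ((0 : ℝ) • A) = 0 := by ext; simp
      rw [e0, cpoly]
      have : -((0 : Eu d →L[ℝ] Eu d) : Eu d →ₗ[ℝ] Eu d) = 0 := by ext; simp
      rw [this, LinearMap.charpoly_zero]; simp
    rw [cc, ppoly, Polynomial.coeff_divX, e, Polynomial.coeff_X_pow]
    split_ifs with h
    · have h1 : d - 1 - i = 0 := by omega
      have h2 : i = d - 1 := by omega
      have h3 := (cpoly_monic A).coeff_natDegree
      rw [cpoly_natDegree] at h3
      rw [h1, h2, cc, ppoly, Polynomial.coeff_divX, Nat.sub_add_cancel (by omega), h3]; simp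
    · rw [zero_pow (by omega), zero_mul]
  · have e : cpoly (c • A) = Polynomial.scaleRoots (cpoly A) c := by
      refine Polynomial.funext fun t => ?_
      have h1 := Polynomial.scaleRoots_eval₂_mul (p := cpoly A) (RingHom.id ℝ) (t / c) c
      simp only [RingHom.id_apply] at h1
      rw [mul_div_cancel₀ _ hc] at h1
      change _ = Polynomial.eval₂ (RingHom.id ℝ) t ((cpoly A).scaleRoots c)
      rw [h1, cpoly_natDegree]
      change _ = c ^ d * Polynomial.eval (t / c) (cpoly A)
      rw [cpoly_eval, cpoly_eval]
      have e2 : c • A + t • (1 : Eu d →L[ℝ] Eu d) = c • (A + (t / c) • (1 : Eu d →L[ℝ] Eu d)) := by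
        ext x : 1
        simp only [add_apply, smul_apply,
          one_apply_eq_self, smul_add, smul_smul]
        rw [mul_div_cancel₀ _ hc]
      rw [e2, ContinuousLinearMap.det]
      rw [ContinuousLinearMap.coe_smul, LinearMap.det_smul]
      simp [ContinuousLinearMap.det]
    rw [cc, ppoly, Polynomial.coeff_divX, e, Polynomial.coeff_scaleRoots, cpoly_natDegree, cc,
      ppoly, Polynomial.coeff_divX, mul_comm]
    congr 2
    omega

theorem ppoly_factor {d : ℕ} (hd : 1 < d) (A : Eu d →L[ℝ] Eu d) (u : Eu d) (hu : ‖u‖ = 1)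
    (h : A u = 0) (hsym : ∀ x y, inner ℝ (A x) y = inner ℝ x (A y)) (τ : ℝ)
    (hpos : ∀ x, τ * (‖x‖ ^ 2 - (inner ℝ u x) ^ 2) ≤ inner ℝ (A x) x) :
    ∃ (s : Finset (Fin d)) (b : Fin d → ℝ), s.card = d - 1 ∧ (∀ i, τ ≤ b i) ∧
      ppoly A = ∏ i ∈ s, (Polynomial.X + Polynomial.C (b i)) := by
  classical
  have hu0 : u ≠ 0 := by rintro rfl; simp at hu
  set B := A + τ • ru u with hB
  set T : Eu d →ₗ[ℝ] Eu d := (B : Eu d →ₗ[ℝ] Eu d) with hT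
  have hBs : T.IsSymmetric := by
    intro x y
    simp only [hT, hB, ContinuousLinearMap.coe_coe, add_apply,
      smul_apply, ru_apply, inner_add_left, inner_add_right, hsym x y,
      inner_smul_left, inner_smul_right, RCLike.conj_to_real]
    rw [real_inner_comm u x]
    ring
  have hfr : Module.finrank ℝ (Eu d) = d := by simp
  let b := hBs.eigenvalues hfr
  have hb : ∀ i, τ ≤ b i := by
    intro i
    have h1 := hBs.apply_eigenvectorBasis hfr i
    set v := hBs.eigenvectorBasis hfr i with hv
    have hvn : ‖v‖ = 1 := (hBs.eigenvectorBasis hfr).orthonormal.1 i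
    have h2 := hpos v
    have h3 : inner ℝ (T v) v = b i := by
      rw [h1, inner_smul_left]; simp [hvn, b]
    have h4 : inner ℝ (T v) v = inner ℝ (A v) v + τ * (inner ℝ u v) ^ 2 := by
      simp [hT, hB, inner_add_left, inner_smul_left, ru_apply]; left; ring
    rw [hvn] at h2
    linarith
  have hcp : cpoly B = ∏ i, (Polynomial.X + Polynomial.C (b i)) := by
    refine Polynomial.funext fun t => ?_
    have h1 := hBs.charpoly_eq hfr
    have h2 := congrArg (Polynomial.eval (-t)) h1
    rw [LinearMap.eval_charpoly] at h2
    rw [cpoly_eval, Polynomial.eval_prod]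
    have e : ((B + t • (1 : Eu d →L[ℝ] Eu d) : Eu d →L[ℝ] Eu d) : Eu d →ₗ[ℝ] Eu d) =
        (-1 : ℝ) • ((algebraMap ℝ (Module.End ℝ (Eu d))) (-t) - T) := by
      ext x : 1
      simp [Algebra.algebraMap_eq_smul_one, hT, add_comm]
    rw [ContinuousLinearMap.det, e, LinearMap.det_smul, h2, hfr, Polynomial.eval_prod]
    have : ((-1 : ℝ)) ^ d = ∏ i : Fin d, (-1 : ℝ) := by simp
    rw [this, ← Finset.prod_mul_distrib]
    refine Finset.prod_congr rfl fun i _ => ?_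
    simp [b]; ring
  have hfac : cpoly B = (Polynomial.X + Polynomial.C τ) * ppoly A := by
    refine Polynomial.eq_of_infinite_eval_eq _ _ (Set.Infinite.mono (s := Set.Ioi (0 : ℝ)) ?_
      (Set.Ioi_infinite _))
    intro t ht
    have ht : 0 < t := ht
    simp only [Set.mem_ofPred_eq]
    rw [cpoly_eval, det_add_ru A u hu h τ t ht.ne']
    simp; ring
  have hev : Polynomial.eval (-τ) (∏ i, (Polynomial.X + Polynomial.C (b i))) = 0 := by
    rw [← hcp, hfac]; simp
  rw [Polynomial.eval_prod, Finset.prod_eq_zero_iff] at hev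
  obtain ⟨i0, -, hi0⟩ := hev
  have hbi : b i0 = τ := by simp at hi0; linarith
  refine ⟨Finset.univ.erase i0, b, by simp, hb, ?_⟩
  have hX : (Polynomial.X + Polynomial.C τ) ≠ 0 := (Polynomial.monic_X_add_C τ).ne_zero
  apply mul_left_cancel₀ hX
  rw [← hfac, hcp, ← hbi]
  exact (Finset.mul_prod_erase Finset.univ (fun i => Polynomial.X + Polynomial.C (b i))
    (Finset.mem_univ i0)).symm

theorem coeff_prod_X_add_C_sub_one {ι : Type*} [DecidableEq ι] (s : Finset ι) (b : ι → ℝ)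
    (hs : s.Nonempty) :
    (∏ i ∈ s, (Polynomial.X + Polynomial.C (b i))).coeff (s.card - 1) = ∑ i ∈ s, b i := by
  have h : 0 < s.card := Finset.card_pos.2 hs
  have := Polynomial.prod_X_sub_C_coeff_card_pred s (fun i => - b i) h
  simpa using this

/-- Newton inequality for `cc`. -/
theorem cc_newton {d : ℕ} (hd : 1 < d) (A : Eu d →L[ℝ] Eu d) (u : Eu d) (hu : ‖u‖ = 1)
    (h : A u = 0) (hsym : ∀ x y, inner ℝ (A x) y = inner ℝ x (A y))
    (hpos : ∀ x, 0 ≤ inner ℝ (A x) x) (i : ℕ) :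
    (((d : ℝ) - 1) * ((d : ℝ) - 1 - i)) * cc A i ≤ (i + 1) * cc A (i + 1) * cc A (d - 2) := by
  obtain ⟨s, b, hs, hb, hf⟩ := ppoly_factor hd A u hu h hsym 0 (fun x => by simpa using hpos x)
  have h1 := newton_aux s b (fun i _ => hb i) i
  have hne : s.Nonempty := Finset.card_pos.1 (by omega)
  rw [← coeff_prod_X_add_C_sub_one s b hne, ← hf, hs] at h1
  rw [Nat.cast_sub (by omega), Nat.cast_one] at h1
  have e : d - 1 - 1 = d - 2 := by omega
  rw [e] at h1
  exact h1

theorem cc_nonneg {d : ℕ} (hd : 1 < d) (A : Eu d →L[ℝ] Eu d) (u : Eu d) (hu : ‖u‖ = 1)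
    (h : A u = 0) (hsym : ∀ x y, inner ℝ (A x) y = inner ℝ x (A y))
    (hpos : ∀ x, 0 ≤ inner ℝ (A x) x) (i : ℕ) : 0 ≤ cc A i := by
  classical
  obtain ⟨s, b, hs, hb, hf⟩ := ppoly_factor hd A u hu h hsym 0 (fun x => by simpa using hpos x)
  rw [cc, hf]
  clear hf hs
  induction s using Finset.induction_on generalizing i with
  | empty => simp only [Finset.prod_empty, Polynomial.coeff_one]; split_ifs <;> norm_num
  | insert x t hx ih =>
    rw [Finset.prod_insert hx, add_mul, Polynomial.coeff_add, Polynomial.coeff_C_mul]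
    refine add_nonneg ?_ (mul_nonneg (hb x) (ih _))
    cases i with
    | zero => simp
    | succ i => rw [Polynomial.coeff_X_mul]; exact ih _

theorem cc_trace {d : ℕ} (hd : 1 < d) (A : Eu d →L[ℝ] Eu d) :
    cc A (d - 2) = ∑ i, inner ℝ (A (EuclideanSpace.single i (1 : ℝ))) (EuclideanSpace.single i (1 : ℝ)) := by
  haveI : Nonempty (Fin d) := ⟨⟨0, by omega⟩⟩
  rw [cc, ppoly, Polynomial.coeff_divX, cpoly]
  let b := (EuclideanSpace.basisFun (Fin d) ℝ).toBasis
  rw [← LinearMap.charpoly_toMatrix _ b]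
  have h1 := Matrix.trace_eq_neg_charpoly_coeff (LinearMap.toMatrix b b (-(A : Eu d →ₗ[ℝ] Eu d)))
  have e : Fintype.card (Fin d) - 1 = d - 2 + 1 := by simp; omega
  rw [e] at h1
  have h2 := congrArg (fun z => -z) h1
  simp only [neg_neg] at h2
  rw [← h2, Matrix.trace]
  rw [← Finset.sum_neg_distrib]
  refine Finset.sum_congr rfl fun i _ => ?_
  simp [LinearMap.toMatrix_apply, b, EuclideanSpace.inner_single_right]

/-- surface measure -/
noncomputable abbrev sg (d : ℕ) : Measure (sphere (0 : Eu d) 1) :=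
  Measure.toSphere (volume : Measure (Eu d))

theorem polar_lintegral {d : ℕ} (hd : 1 < d) (φ : Eu d → ENNReal) (hφ : Measurable φ) :
    ∫⁻ x, φ x = ∫⁻ u, (∫⁻ t in Set.Ioi (0 : ℝ), ENNReal.ofReal (t ^ (d - 1)) * φ (t • (u : Eu d)))
      ∂(sg d) := by
  haveI : Nonempty (Fin d) := ⟨⟨0, by omega⟩⟩
  have hmp := Measure.measurePreserving_homeomorphUnitSphereProd (volume : Measure (Eu d))
  have h1 : ∫⁻ x, φ x = ∫⁻ x in ({0}ᶜ : Set (Eu d)), φ x := by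
    rw [restrict_compl_singleton]
  rw [h1, ← lintegral_subtype_comap (measurableSet_singleton _).compl]
  have h2 : ∀ x : ({0}ᶜ : Set (Eu d)), φ x =
      (fun z : sphere (0 : Eu d) 1 × Set.Ioi (0 : ℝ) => φ ((z.2 : ℝ) • (z.1 : Eu d)))
        (homeomorphUnitSphereProd (Eu d) x) := by
    intro x
    have : (x : Eu d) ≠ 0 := x.2
    simp [smul_smul, this]
  have hm : Measurable (fun z : sphere (0 : Eu d) 1 × Set.Ioi (0 : ℝ) =>
      φ ((z.2 : ℝ) • (z.1 : Eu d))) := by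
    apply hφ.comp
    fun_prop
  simp_rw [h2]
  rw [hmp.lintegral_comp hm, lintegral_prod _ hm.aemeasurable]
  refine lintegral_congr fun u => ?_
  rw [Measure.volumeIoiPow, lintegral_withDensity_eq_lintegral_mul _ (by fun_prop)
    (by exact hm.comp (by fun_prop))]
  rw [← lintegral_subtype_comap measurableSet_Ioi]
  simp

/-- Support functions that are twice continuously differentiable away from the origin. -/
structure Sm (d : ℕ) where
  f : Eu d → ℝ
  G : Eu d → Eu d
  H : Eu d → (Eu d →L[ℝ] Eu d)
  hom : ∀ (t : ℝ) (x : Eu d), 0 ≤ t → f (t • x) = t * f x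
  sub : ∀ x y, f (x + y) ≤ f x + f y
  hG : ∀ x, x ≠ 0 → HasFDerivAt f (innerSL ℝ (G x)) x
  hH : ∀ x, x ≠ 0 → HasFDerivAt G (H x) x
  cH : ContinuousOn H {0}ᶜ

namespace Sm

variable {d : ℕ} (F : Sm d)

theorem f_zero : F.f 0 = 0 := by simpa using F.hom 0 0 le_rfl

/-- The convex body of a support function. -/
def K : Set (Eu d) := {p | ∀ x, inner ℝ p x ≤ F.f x}

theorem line_deriv {y : Eu d} (hy : y ≠ 0) (v : Eu d) :
    HasDerivAt (fun s : ℝ => F.f (y + s • v)) (inner ℝ (F.G y) v) 0 := by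
  have h1 : HasDerivAt (fun s : ℝ => y + s • v) v 0 := by
    simpa using ((hasDerivAt_id (0 : ℝ)).smul_const v).const_add y
  have h2 : HasFDerivAt F.f (innerSL ℝ (F.G y)) (y + (0 : ℝ) • v) := by
    simpa using F.hG y hy
  have h3 := h2.comp_hasDerivAt (0 : ℝ) h1
  simp only [innerSL_apply_apply] at h3
  exact h3

theorem line_deriv_G {y : Eu d} (hy : y ≠ 0) (v : Eu d) :
    HasDerivAt (fun s : ℝ => F.G (y + s • v)) (F.H y v) 0 := by
  have h1 : HasDerivAt (fun s : ℝ => y + s • v) v 0 := by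
    simpa using ((hasDerivAt_id (0 : ℝ)).smul_const v).const_add y
  have h2 : HasFDerivAt F.G (F.H y) (y + (0 : ℝ) • v) := by
    simpa using F.hH y hy
  exact h2.comp_hasDerivAt (0 : ℝ) h1

theorem G_mem {y : Eu d} (hy : y ≠ 0) : F.G y ∈ F.K := by
  intro x
  have h1 := F.line_deriv hy x
  have h2 : HasDerivAt (fun s : ℝ => F.f y + s * F.f x) (F.f x) 0 := by
    simpa using ((hasDerivAt_id (0 : ℝ)).mul_const (F.f x)).const_add (F.f y)
  have h3 := (h2.sub h1).hasDerivWithinAt (s := Set.Ioi 0)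
  have h4 : 0 ≤ F.f x - inner ℝ (F.G y) x := by
    have h5 := (hasDerivWithinAt_iff_tendsto_slope' (by simp)).1 h3
    refine ge_of_tendsto h5 ?_
    filter_upwards [self_mem_nhdsWithin] with s hs
    have hs0 : 0 < s := hs
    rw [slope_def_field]
    apply div_nonneg _ (by linarith)
    have := F.sub y (s • x)
    rw [F.hom s x hs0.le] at this
    simp
    linarith
  linarith

theorem inner_G_self {y : Eu d} (hy : y ≠ 0) : inner ℝ (F.G y) y = F.f y := by
  have h1 := F.line_deriv hy y
  have h2 : HasDerivAt (fun s : ℝ => (1 + s) * F.f y) (F.f y) 0 := by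
    simpa using ((hasDerivAt_id (0 : ℝ)).const_add 1).mul_const (F.f y)
  refine h1.unique (h2.congr_of_eventuallyEq ?_)
  filter_upwards [Ioi_mem_nhds (show (-1 : ℝ) < 0 by norm_num)] with s hs
  have hs : -1 < s := hs
  rw [← F.hom (1 + s) y (by linarith), add_smul, one_smul]

theorem G_smul {y : Eu d} (hy : y ≠ 0) {t : ℝ} (ht : 0 < t) : F.G (t • y) = F.G y := by
  have hty : t • y ≠ 0 := smul_ne_zero ht.ne' hy
  refine ext_inner_right ℝ fun v => ?_
  have h1 := F.line_deriv hty (t • v)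
  have h2 := (F.line_deriv hy v).const_mul t
  have h3 : (fun s : ℝ => F.f (t • y + s • t • v)) = fun s => t * F.f (y + s • v) := by
    funext s
    rw [← F.hom t _ ht.le, smul_add, smul_comm]
  rw [h3] at h1
  have := h1.unique h2
  rw [inner_smul_right] at this
  exact mul_left_cancel₀ ht.ne' this

theorem H_smul {y : Eu d} (hy : y ≠ 0) {t : ℝ} (ht : 0 < t) : F.H (t • y) = t⁻¹ • F.H y := by
  have hty : t • y ≠ 0 := smul_ne_zero ht.ne' hy
  ext1 v
  have h1 := F.line_deriv_G hty (t • v)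
  have h2 := (F.line_deriv_G hy v)
  have h3 : (fun s : ℝ => F.G (t • y + s • t • v)) =ᶠ[nhds 0] fun s => F.G (y + s • v) := by
    have hc : ContinuousAt (fun s : ℝ => y + s • v) 0 := by fun_prop
    have : ∀ᶠ s in nhds (0 : ℝ), y + s • v ≠ 0 := by
      apply hc.eventually_ne; simpa using hy
    filter_upwards [this] with s hs
    rw [← F.G_smul hs ht, smul_add, smul_comm]
  have := (h1.congr_of_eventuallyEq h3.symm).unique h2
  rw [map_smul] at this
  rw [smul_apply, ← this, smul_smul, inv_mul_cancel₀ ht.ne', one_smul]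

theorem H_self {y : Eu d} (hy : y ≠ 0) : F.H y y = 0 := by
  have h1 := F.line_deriv_G hy y
  refine h1.unique ((hasDerivAt_const (0 : ℝ) (F.G y)).congr_of_eventuallyEq ?_)
  filter_upwards [Ioi_mem_nhds (show (-1 : ℝ) < 0 by norm_num)] with s hs
  have hs : -1 < s := hs
  rw [← F.G_smul hy (show 0 < 1 + s by linarith), add_smul, one_smul]

theorem H_symm {y : Eu d} (hy : y ≠ 0) (v w : Eu d) :
    inner ℝ (F.H y v) w = inner ℝ v (F.H y w) := by
  have h1 : ∀ᶠ z in nhds y, HasFDerivAt F.f (innerSL ℝ (F.G z)) z := by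
    filter_upwards [isOpen_compl_singleton.mem_nhds (show y ∈ ({0}ᶜ : Set (Eu d)) from hy)]
      with z hz using F.hG z hz
  have h2 : HasFDerivAt (fun z => innerSL ℝ (F.G z)) ((innerSL ℝ).comp (F.H y)) y :=
    (innerSL ℝ).hasFDerivAt.comp y (F.hH y hy)
  have := second_derivative_symmetric_of_eventually h1 h2 v w
  simp at this
  rw [this, real_inner_comm]

theorem G_mono {x y : Eu d} (hx : x ≠ 0) (hy : y ≠ 0) : 0 ≤ inner ℝ (F.G x - F.G y) (x - y) := by
  have h1 := F.G_mem hx y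
  have h2 := F.G_mem hy x
  have h3 := F.inner_G_self hx
  have h4 := F.inner_G_self hy
  simp only [inner_sub_left, inner_sub_right]
  linarith

theorem H_psd {y : Eu d} (hy : y ≠ 0) (v : Eu d) : 0 ≤ inner ℝ (F.H y v) v := by
  have h1 := F.line_deriv_G hy v
  have h2 : HasDerivAt (fun s : ℝ => inner ℝ (F.G (y + s • v)) v) (inner ℝ (F.H y v) v) 0 := by
    simpa using h1.inner ℝ (hasDerivAt_const (0 : ℝ) v)
  have h3 := h2.tendsto_slope
  have hc : ContinuousAt (fun s : ℝ => y + s • v) 0 := by fun_prop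
  have he : ∀ᶠ s in nhds (0 : ℝ), y + s • v ≠ 0 := by
    apply hc.eventually_ne; simpa using hy
  refine ge_of_tendsto h3 ?_
  filter_upwards [self_mem_nhdsWithin, nhdsWithin_le_nhds he] with s hs hs2
  have hs : s ≠ 0 := hs
  have := F.G_mono hs2 hy
  rw [slope_def_field]
  simp only [zero_smul, add_zero, sub_zero, add_sub_cancel_left, inner_smul_right] at this ⊢
  rw [← inner_sub_left, div_eq_mul_inv]
  have h5 : inner ℝ (F.G (y + s • v) - F.G y) v * s⁻¹ =
    (s * inner ℝ (F.G (y + s • v) - F.G y) v) * (s⁻¹) ^ 2 := by field_simp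
  rw [h5]; positivity

theorem convexOn : ConvexOn ℝ Set.univ F.f := by
  refine ⟨convex_univ, fun x _ y _ a b ha hb _ => ?_⟩
  have := F.sub (a • x) (b • y)
  rwa [F.hom a x ha, F.hom b y hb] at this

theorem continuous : Continuous F.f := by
  have := F.convexOn.continuousOn isOpen_univ
  exact continuousOn_univ.1 this

theorem contG : ContinuousOn F.G {0}ᶜ := fun x hx => (F.hH x hx).continuousAt.continuousWithinAt

theorem K_convex : Convex ℝ F.K := by
  intro p hp q hq a b ha hb hab x
  rw [inner_add_left, real_inner_smul_left, real_inner_smul_left]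
  have h1 := mul_le_mul_of_nonneg_left (hp x) ha
  have h2 := mul_le_mul_of_nonneg_left (hq x) hb
  have : F.f x = a * F.f x + b * F.f x := by rw [← add_mul, hab, one_mul]
  linarith

theorem K_closed : IsClosed F.K := by
  have : F.K = ⋂ x, {p | inner ℝ p x ≤ F.f x} := by ext; simp [K]
  rw [this]
  exact isClosed_iInter fun x => isClosed_le (by fun_prop) continuous_const

theorem K_bdd : ∃ C : ℝ, 0 ≤ C ∧ (∀ x, |F.f x| ≤ C * ‖x‖) := by
  obtain ⟨C, hC⟩ := (isCompact_sphere (0 : Eu d) 1).exists_bound_of_continuousOn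
    F.continuous.continuousOn
  refine ⟨max C 0, le_max_right _ _, fun x => ?_⟩
  by_cases hx : x = 0
  · simp [hx, F.f_zero]
  have hn : 0 < ‖x‖ := norm_pos_iff.2 hx
  have h1 := hC (‖x‖⁻¹ • x) (by simp [norm_smul, hn.ne'])
  have h2 : x = ‖x‖ • (‖x‖⁻¹ • x) := by rw [smul_smul, mul_inv_cancel₀ hn.ne', one_smul]
  have h3 : F.f x = ‖x‖ * F.f (‖x‖⁻¹ • x) := by
    rw [← F.hom _ _ hn.le, ← h2]
  rw [h3, abs_mul, abs_norm, mul_comm]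
  gcongr
  exact h1.trans (le_max_left _ _)

theorem K_compact : IsCompact F.K := by
  obtain ⟨C, hC0, hC⟩ := F.K_bdd
  refine (isCompact_closedBall (0 : Eu d) C).of_isClosed_subset F.K_closed fun p hp => ?_
  rw [mem_closedBall_zero_iff]
  have h1 := (hp p).trans ((le_abs_self _).trans (hC p))
  rw [real_inner_self_eq_norm_sq] at h1
  by_cases hn : ‖p‖ = 0
  · rw [hn]; exact hC0
  · have : 0 < ‖p‖ := lt_of_le_of_ne (norm_nonneg _) (Ne.symm hn)
    nlinarith

/-- The outward parametrization. -/
def Psi (y : Eu d) : Eu d := F.G y + y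

theorem Psi_injOn : Set.InjOn F.Psi {0}ᶜ := by
  intro x hx y hy h
  have h1 := F.G_mono hx hy
  have h2 : F.G x - F.G y = -(x - y) := by
    simp only [Psi] at h
    have : F.G x = F.G y + y - x := by rw [← h]; abel
    rw [this]; abel
  rw [h2, inner_neg_left, real_inner_self_eq_norm_sq] at h1
  have : ‖x - y‖ = 0 := by nlinarith [norm_nonneg (x - y)]
  exact sub_eq_zero.1 (norm_eq_zero.1 this)

theorem G_unique {y p : Eu d} (hy : y ≠ 0) (hp : p ∈ F.K) (h : inner ℝ p y = F.f y) :
    F.G y = p := by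
  refine ext_inner_right ℝ fun v => ?_
  have h1 := F.line_deriv hy v
  have h2 : HasDerivAt (fun s : ℝ => inner ℝ p y + s * inner ℝ p v) (inner ℝ p v) 0 := by
    simpa using ((hasDerivAt_id (0 : ℝ)).mul_const (inner ℝ p v)).const_add (inner ℝ p y)
  have h3 := h1.sub h2
  have hmin : IsLocalMin ((fun s : ℝ => F.f (y + s • v)) - fun s => inner ℝ p y + s * inner ℝ p v) 0 := by
    refine Filter.Eventually.of_forall fun s => ?_
    have := hp (y + s • v)
    rw [inner_add_right, inner_smul_right] at this
    simp [h]
    linarith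
  have := hmin.hasDerivAt_eq_zero h3
  linarith

theorem exists_Psi (hK : F.K.Nonempty) {z : Eu d} (hz : z ∉ F.K) : ∃ y, y ≠ 0 ∧ F.Psi y = z := by
  obtain ⟨p, hp, hmin⟩ := exists_norm_eq_iInf_of_complete_convex hK F.K_closed.isComplete
    F.K_convex z
  rw [norm_eq_iInf_iff_real_inner_le_zero F.K_convex hp] at hmin
  have hy : z - p ≠ 0 := fun h => hz (by rw [sub_eq_zero.1 h]; exact hp)
  refine ⟨z - p, hy, ?_⟩
  have h1 := hmin _ (F.G_mem hy)
  rw [inner_sub_right, real_inner_comm _ (z - p), F.inner_G_self hy, real_inner_comm] at h1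
  have h2 : F.G (z - p) = p := F.G_unique hy hp (le_antisymm (hp _) (by linarith))
  rw [Psi, h2]; abel

theorem inner_Psi {y : Eu d} (hy : y ≠ 0) : inner ℝ (F.Psi y) y = F.f y + ‖y‖ ^ 2 := by
  rw [Psi, inner_add_left, F.inner_G_self hy, real_inner_self_eq_norm_sq]

theorem K_nonempty (hd : 1 < d) : F.K.Nonempty := by
  refine ⟨F.G (EuclideanSpace.single ⟨0, by omega⟩ 1), F.G_mem ?_⟩
  intro h
  have := congrArg norm h
  simp at this

theorem cover (hd : 1 < d) (F' : Sm d) :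
    F'.K ⊆ F.K ∪ F.Psi '' {y | y ≠ 0 ∧ ‖y‖ ^ 2 ≤ F'.f y - F.f y} := by
  intro z hz
  by_cases h : z ∈ F.K
  · exact Or.inl h
  obtain ⟨y, hy, rfl⟩ := F.exists_Psi (F.K_nonempty hd) h
  refine Or.inr ⟨y, ⟨hy, ?_⟩, rfl⟩
  have := hz y
  rw [F.inner_Psi hy] at this
  linarith

theorem Psi_fderiv {y : Eu d} (hy : y ≠ 0) : HasFDerivAt F.Psi (F.H y + 1) y :=
  (F.hH y hy).add (hasFDerivAt_id y)

end Sm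

theorem sph_ne {d : ℕ} (u : sphere (0 : Eu d) 1) : (u : Eu d) ≠ 0 := by
  intro h
  have := u.2
  rw [h] at this
  simp at this

theorem sph_norm {d : ℕ} (u : sphere (0 : Eu d) 1) : ‖(u : Eu d)‖ = 1 := by
  simp

instance sg_finite {d : ℕ} : IsFiniteMeasure (sg d) := by
  unfold sg; infer_instance

namespace Sm
variable {d : ℕ} (F : Sm d)

/-- curvature functions on the sphere -/
noncomputable def c (i : ℕ) (u : sphere (0 : Eu d) 1) : ℝ := cc (F.H u) i

theorem H_cont_sph : Continuous (fun u : sphere (0 : Eu d) 1 => F.H u) :=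
  F.cH.comp_continuous continuous_subtype_val fun u => sph_ne u

theorem c_cont (i : ℕ) : Continuous (F.c i) := (cc_continuous i).comp F.H_cont_sph

theorem f_cont_sph : Continuous (fun u : sphere (0 : Eu d) 1 => F.f u) :=
  F.continuous.comp continuous_subtype_val

theorem c_nonneg (hd : 1 < d) (i : ℕ) (u : sphere (0 : Eu d) 1) : 0 ≤ F.c i u := by
  refine cc_nonneg hd _ (u : Eu d) (sph_norm u) (F.H_self (sph_ne u)) (F.H_symm (sph_ne u)) ?_ i
  intro x
  exact F.H_psd (sph_ne u) x

end Sm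

theorem sint {d : ℕ} {φ : sphere (0 : Eu d) 1 → ℝ} (h : Continuous φ) : Integrable φ (sg d) :=
  h.integrable_of_hasCompactSupport (HasCompactSupport.of_compactSpace _)

namespace Sm
variable {d : ℕ} (F : Sm d)

theorem det_ray (hd : 1 < d) (u : sphere (0 : Eu d) 1) {t : ℝ} (ht : 0 < t) :
    t ^ (d - 1) * |(F.H (t • (u : Eu d)) + 1).det| = ∑ i ∈ Finset.range d, F.c i u * t ^ i := by
  have h1 : F.H (t • (u : Eu d)) + 1 = t⁻¹ • (F.H u + t • 1) := by
    rw [F.H_smul (sph_ne u) ht]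
    ext x : 1
    simp only [add_apply, smul_apply, one_apply_eq_self, smul_add, smul_smul]
    rw [inv_mul_cancel₀ ht.ne', one_smul]
  have h2 : (t⁻¹ • (F.H u + t • (1 : Eu d →L[ℝ] Eu d))).det = (t⁻¹) ^ d * (F.H u + t • 1).det := by
    have := LinearMap.det_smul t⁻¹ ((F.H u + t • (1 : Eu d →L[ℝ] Eu d)) : Eu d →ₗ[ℝ] Eu d)
    rw [finrank_euclideanSpace_fin] at this
    exact this
  rw [h1, h2, det_eq_ppoly _ (u : Eu d) (sph_ne u) (F.H_self (sph_ne u)), ppoly_eval hd]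
  have h3 : 0 ≤ ∑ i ∈ Finset.range d, cc (F.H u) i * t ^ i :=
    Finset.sum_nonneg fun i _ => mul_nonneg (F.c_nonneg hd i u) (by positivity)
  rw [abs_of_nonneg (by positivity)]
  obtain ⟨n, rfl⟩ : ∃ n, d = n + 1 := ⟨d - 1, by omega⟩
  simp only [add_tsub_cancel_right, c, inv_pow]
  field_simp
  ring

theorem collar (hd : 1 < d) (w : Eu d → ℝ) (hwc : Continuous w)
    (hwh : ∀ (t : ℝ) x, 0 ≤ t → w (t • x) = t * w x) (hw0 : ∀ x, 0 ≤ w x) :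
    volume (F.Psi '' {y | y ≠ 0 ∧ ‖y‖ ^ 2 ≤ w y}) =
      ENNReal.ofReal (∫ u, ∑ i ∈ Finset.range d, F.c i u * w u ^ (i + 1) / (i + 1) ∂(sg d)) := by
  set D := {y : Eu d | y ≠ 0 ∧ ‖y‖ ^ 2 ≤ w y} with hD
  have hDm : MeasurableSet D := by
    have : D = {0}ᶜ ∩ {y : Eu d | ‖y‖ ^ 2 ≤ w y} := by ext; simp [hD]
    rw [this]
    exact (measurableSet_singleton _).compl.inter
      (isClosed_le (by fun_prop) hwc).measurableSet
  rw [← lintegral_abs_det_fderiv_eq_addHaar_image volume hDm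
    (fun x hx => (F.Psi_fderiv hx.1).hasFDerivWithinAt) (F.Psi_injOn.mono fun x hx => hx.1)]
  rw [← lintegral_indicator hDm, polar_lintegral hd]
  · rw [ofReal_integral_eq_lintegral_ofReal]
    · refine lintegral_congr fun u => ?_
      have h1 : ∀ t ∈ Set.Ioi (0 : ℝ), ENNReal.ofReal (t ^ (d - 1)) *
          D.indicator (fun x => ENNReal.ofReal |(F.H x + 1).det|) (t • (u : Eu d)) =
          (Set.Ioc 0 (w u)).indicator
            (fun t => ENNReal.ofReal (∑ i ∈ Finset.range d, F.c i u * t ^ i)) t := by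
        intro t ht
        have ht : 0 < t := ht
        have hiff : t • (u : Eu d) ∈ D ↔ t ∈ Set.Ioc 0 (w u) := by
          simp only [hD, Set.mem_ofPred_eq, Set.mem_Ioc, hwh _ _ ht.le, norm_smul, sph_norm,
            mul_one, Real.norm_eq_abs, abs_of_pos ht, ht, true_and]
          constructor
          · rintro ⟨_, h⟩
            nlinarith
          · intro h
            exact ⟨smul_ne_zero ht.ne' (sph_ne u), by nlinarith⟩
        by_cases hm : t ∈ Set.Ioc 0 (w u)
        · rw [Set.indicator_of_mem hm, Set.indicator_of_mem (hiff.2 hm),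
            ← ENNReal.ofReal_mul (by positivity), F.det_ray hd u ht]
        · rw [Set.indicator_of_notMem hm, Set.indicator_of_notMem (fun h => hm (hiff.1 h)),
            mul_zero]
      rw [setLIntegral_congr_fun measurableSet_Ioi h1, lintegral_indicator measurableSet_Ioc,
        Measure.restrict_restrict measurableSet_Ioc,
        Set.inter_eq_left.2 Set.Ioc_subset_Ioi_self]
      rw [← ofReal_integral_eq_lintegral_ofReal]
      · congr 1
        rw [← intervalIntegral.integral_of_le (hw0 _), intervalIntegral.integral_finset_sum]
        · refine Finset.sum_congr rfl fun i _ => ?_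
          rw [intervalIntegral.integral_const_mul, integral_pow]
          simp
          ring
        · intro i _
          apply Continuous.intervalIntegrable
          fun_prop
      · apply Continuous.integrableOn_Ioc
        fun_prop
      · filter_upwards [ae_restrict_mem measurableSet_Ioc] with t ht
        exact Finset.sum_nonneg fun i _ => mul_nonneg (F.c_nonneg hd i u) (pow_nonneg ht.1.le _)
    · apply sint
      have := fun i => F.c_cont i
      fun_prop
    · refine Filter.Eventually.of_forall fun u => ?_
      exact Finset.sum_nonneg fun i _ => div_nonneg
        (mul_nonneg (F.c_nonneg hd i u) (pow_nonneg (hw0 _) _)) (by positivity)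
  · have hm : Measurable (fun x => ({0}ᶜ : Set (Eu d)).indicator F.H x) := by
      classical
      have := F.cH.measurable_piecewise (continuousOn_const (c := 0))
        (measurableSet_singleton (0 : Eu d)).compl
      have h3 : (fun x => ({0}ᶜ : Set (Eu d)).indicator F.H x) =
          ({0}ᶜ : Set (Eu d)).piecewise F.H (fun _ => 0) :=
        Set.piecewise_eq_indicator.symm
      rw [h3]; exact this
    have h2 : D.indicator (fun x => ENNReal.ofReal |(F.H x + 1).det|) =
      D.indicator (fun x => ENNReal.ofReal |((({0}ᶜ : Set (Eu d)).indicator F.H x) + 1).det|) := by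
      ext x
      by_cases hx : x ∈ D
      · simp only [Set.indicator_of_mem hx]
        rw [Set.indicator_of_mem]
        exact hx.1
      · simp only [Set.indicator_of_notMem hx]
    rw [h2]
    refine Measurable.indicator ?_ hDm
    have : Continuous fun A : Eu d →L[ℝ] Eu d => (A + 1).det :=
      ContinuousLinearMap.continuous_det.comp (by fun_prop)
    exact (this.measurable.comp hm).abs.ennreal_ofReal

end Sm

namespace Sm
variable {d : ℕ}

theorem ext_inner_aux (a b : Eu d) : innerSL ℝ (a + b) = innerSL ℝ a + innerSL ℝ b := map_add _ _ _

/-- sum -/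
def add (F F' : Sm d) : Sm d where
  f x := F.f x + F'.f x
  G x := F.G x + F'.G x
  H x := F.H x + F'.H x
  hom t x ht := by rw [F.hom t x ht, F'.hom t x ht]; ring
  sub x y := by have := F.sub x y; have := F'.sub x y; linarith
  hG x hx := by rw [map_add]; exact (F.hG x hx).add (F'.hG x hx)
  hH x hx := (F.hH x hx).add (F'.hH x hx)
  cH := F.cH.add F'.cH

/-- scaling by a nonnegative number -/
def scale (F : Sm d) (a : ℝ) (ha : 0 ≤ a) : Sm d where
  f x := a * F.f x
  G x := a • F.G x
  H x := a • F.H x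
  hom t x ht := by rw [F.hom t x ht]; ring
  sub x y := by have := mul_le_mul_of_nonneg_left (F.sub x y) ha; linarith
  hG x hx := by rw [map_smul]; exact (F.hG x hx).const_mul a
  hH x hx := (F.hH x hx).const_smul a
  cH := F.cH.const_smul a

/-- linear function -/
noncomputable def lin (a : Eu d) : Sm d where
  f x := inner ℝ a x
  G _ := a
  H _ := 0
  hom t x _ := by rw [inner_smul_right]
  sub x y := by rw [inner_add_right]
  hG x _ := (innerSL ℝ a).hasFDerivAt
  hH x _ := hasFDerivAt_const _ _
  cH := continuousOn_const

theorem nrm_deriv (x : Eu d) (hx : x ≠ 0) : HasFDerivAt (fun x : Eu d => ‖x‖) (innerSL ℝ (‖x‖⁻¹ • x)) x := by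
  have h1 : HasFDerivAt (fun x : Eu d => ‖x‖ ^ 2) (2 • innerSL ℝ x) x := by
    exact (hasStrictFDerivAt_norm_sq x).hasFDerivAt
  have h2 := h1.sqrt (by simpa using hx)
  have h3 : (fun x : Eu d => √(‖x‖ ^ 2)) = fun x => ‖x‖ := by
    funext y; exact Real.sqrt_sq (norm_nonneg _)
  rw [h3, Real.sqrt_sq (norm_nonneg _)] at h2
  have hn : ‖x‖ ≠ 0 := by simpa using hx
  refine h2.congr_fderiv ?_
  rw [map_smul, two_smul, ← two_smul ℝ, smul_smul]
  congr 1
  field_simp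

/-- the Euclidean norm -/
noncomputable def nrm : Sm d where
  f x := ‖x‖
  G x := ‖x‖⁻¹ • x
  H x := ‖x‖⁻¹ • (1 - ru (‖x‖⁻¹ • x))
  hom t x ht := by rw [norm_smul, Real.norm_of_nonneg ht]
  sub x y := norm_add_le x y
  hG := nrm_deriv
  hH x hx := by
    have hn : ‖x‖ ≠ 0 := by simpa using hx
    have h1 : HasFDerivAt (fun x : Eu d => ‖x‖⁻¹) _ x :=
      (hasDerivAt_inv hn).comp_hasFDerivAt x (nrm_deriv x hx)
    have h2 := h1.smul (hasFDerivAt_id x)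
    refine h2.congr_fderiv ?_
    ext v : 1
    simp only [map_smul, add_apply, smul_apply, sub_apply, one_apply_eq_self, ru_apply,
      ContinuousLinearMap.smulRight_apply, innerSL_apply_apply, smul_eq_mul, id,
      ContinuousLinearMap.id_apply, inner_smul_left, smul_smul, conj_trivial]
    rw [smul_sub, sub_eq_add_neg, smul_smul, ← neg_smul]
    congr 2
    field_simp
  cH := by
    have h1 : ContinuousOn (fun x : Eu d => ‖x‖⁻¹) {0}ᶜ :=
      continuous_norm.continuousOn.inv₀ fun x hx => by simpa using hx
    have h2 : Continuous (fun x : Eu d => ru x) := by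
      unfold ru; fun_prop
    refine h1.smul (continuousOn_const.sub (h2.comp_continuousOn (h1.smul continuousOn_id)))

/-- volume of the body -/
noncomputable def V (F : Sm d) : ℝ := (volume F.K).toReal

theorem K_fin (F : Sm d) : volume F.K ≠ ⊤ := F.K_compact.measure_lt_top.ne

/-- parallel body -/
noncomputable def par (F : Sm d) (s : ℝ) (hs : 0 ≤ s) : Sm d := F.add (nrm.scale s hs)

@[simp] theorem par_f (F : Sm d) (s : ℝ) (hs : 0 ≤ s) (x : Eu d) :
    (F.par s hs).f x = F.f x + s * ‖x‖ := rfl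

theorem par_H (F : Sm d) (s : ℝ) (hs : 0 ≤ s) (u : sphere (0 : Eu d) 1) :
    (F.par s hs).H u = F.H u + s • (1 - ru (u : Eu d)) := by
  change F.H u + s • (‖(u : Eu d)‖⁻¹ • (1 - ru (‖(u : Eu d)‖⁻¹ • (u : Eu d)))) = _
  rw [sph_norm]; simp only [inv_one, one_smul]

theorem par_c0 (hd : 1 < d) (F : Sm d) (s : ℝ) (hs : 0 ≤ s) (u : sphere (0 : Eu d) 1) :
    (F.par s hs).c 0 u = ∑ i ∈ Finset.range d, F.c i u * s ^ i := by
  unfold c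
  rw [par_H]
  exact cc_shift hd _ _ (sph_norm u) (F.H_self (sph_ne u)) s

theorem K_par (hd : 1 < d) (F : Sm d) (s : ℝ) (hs : 0 ≤ s) :
    (F.par s hs).K = F.K + closedBall (0 : Eu d) s := by
  apply Set.Subset.antisymm
  · intro z hz
    rcases F.cover hd _ hz with h | ⟨y, ⟨hy, h2⟩, rfl⟩
    · exact ⟨z, h, 0, by simpa using hs, by simp⟩
    · refine ⟨F.G y, F.G_mem hy, y, ?_, rfl⟩
      rw [mem_closedBall_zero_iff]
      rw [par_f] at h2
      have : 0 < ‖y‖ := norm_pos_iff.2 hy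
      nlinarith
  · rintro _ ⟨a, ha, b, hb, rfl⟩ x
    rw [mem_closedBall_zero_iff] at hb
    change inner ℝ (a + b) x ≤ _
    rw [inner_add_left, par_f]
    have h1 := ha x
    have h2 := real_inner_le_norm b x
    have h3 := mul_le_mul_of_nonneg_right hb (norm_nonneg x)
    linarith

theorem V_diff_le (hd : 1 < d) (F F' : Sm d) (h : ∀ x, F.f x ≤ F'.f x) :
    F'.V - F.V ≤ ∫ u, ∑ i ∈ Finset.range d,
      F.c i u * (F'.f u - F.f u) ^ (i + 1) / (i + 1) ∂(sg d) := by
  have h1 := (measure_mono (F.cover hd F')).trans (measure_union_le (μ := volume) _ _)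
  have h2 := F.collar hd (fun x => F'.f x - F.f x) (F'.continuous.sub F.continuous)
    (fun t x ht => by rw [F.hom t x ht, F'.hom t x ht]; ring) (fun x => sub_nonneg.2 (h x))
  rw [h2] at h1
  have h3 : 0 ≤ ∫ u, ∑ i ∈ Finset.range d,
      F.c i u * (F'.f u - F.f u) ^ (i + 1) / (i + 1) ∂(sg d) :=
    integral_nonneg fun u => Finset.sum_nonneg fun i _ => div_nonneg
        (mul_nonneg (F.c_nonneg hd i u) (pow_nonneg (sub_nonneg.2 (h _)) _)) (by positivity)
  have h4 := ENNReal.toReal_mono (ENNReal.add_ne_top.2 ⟨F.K_fin, ENNReal.ofReal_ne_top⟩) h1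
  rw [ENNReal.toReal_add F.K_fin ENNReal.ofReal_ne_top, ENNReal.toReal_ofReal h3] at h4
  unfold V
  linarith

theorem steiner (hd : 1 < d) (F : Sm d) (s : ℝ) (hs : 0 ≤ s) :
    (F.par s hs).V = F.V + ∑ i ∈ Finset.range d, (∫ u, F.c i u ∂(sg d)) * s ^ (i + 1) / (i + 1) := by
  have hset : (F.par s hs).K = F.K ∪ F.Psi '' {y | y ≠ 0 ∧ ‖y‖ ^ 2 ≤ s * ‖y‖} := by
    apply Set.Subset.antisymm
    · convert F.cover hd (F.par s hs) using 5
      simp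
    · rintro z (hz | ⟨y, ⟨hy, h2⟩, rfl⟩)
      · intro x
        have := hz x
        rw [par_f]
        nlinarith [norm_nonneg x]
      · rw [K_par hd]
        refine ⟨F.G y, F.G_mem hy, y, ?_, rfl⟩
        rw [mem_closedBall_zero_iff]
        have : 0 < ‖y‖ := norm_pos_iff.2 hy
        nlinarith
  have hdis : Disjoint F.K (F.Psi '' {y | y ≠ 0 ∧ ‖y‖ ^ 2 ≤ s * ‖y‖}) := by
    rw [Set.disjoint_right]
    rintro _ ⟨y, ⟨hy, h2⟩, rfl⟩ h
    have := h y
    rw [F.inner_Psi hy] at this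
    have : 0 < ‖y‖ := norm_pos_iff.2 hy
    nlinarith
  have h2 := F.collar hd (fun x => s * ‖x‖) (by fun_prop)
    (fun t x ht => by rw [norm_smul, Real.norm_of_nonneg ht]; ring) (fun x => by positivity)
  have h3 : ∫ u : sphere (0 : Eu d) 1, ∑ i ∈ Finset.range d,
      F.c i u * (s * ‖(u : Eu d)‖) ^ (i + 1) / (i + 1) ∂(sg d) =
      ∑ i ∈ Finset.range d, (∫ u, F.c i u ∂(sg d)) * s ^ (i + 1) / (i + 1) := by
    rw [integral_finsetSum]
    · refine Finset.sum_congr rfl fun i _ => ?_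
      simp only [sph_norm, mul_one]
      rw [integral_div, integral_mul_const]
    · intro i _
      apply sint
      have := F.c_cont i
      fun_prop
  have h4 : 0 ≤ ∑ i ∈ Finset.range d, (∫ u, F.c i u ∂(sg d)) * s ^ (i + 1) / (i + 1) :=
    Finset.sum_nonneg fun i _ => div_nonneg (mul_nonneg
      (integral_nonneg fun u => F.c_nonneg hd i u) (by positivity)) (by positivity)
  unfold V
  rw [hset, measure_union' hdis F.K_closed.measurableSet, h2, h3,
    ENNReal.toReal_add F.K_fin ENNReal.ofReal_ne_top, ENNReal.toReal_ofReal h4]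

end Sm

/-- Coefficient of the interpolation polynomial. -/
noncomputable def cfn (d i : ℕ) (v : ℕ → ℝ) : ℝ :=
  ((Lagrange.interpolate (Finset.range (d + 1)) (fun j => (j : ℝ))) v).coeff i

theorem cfn_eq (d i : ℕ) (v : ℕ → ℝ) : cfn d i v = ∑ j ∈ Finset.range (d + 1),
    v j * (Lagrange.basis (Finset.range (d + 1)) (fun j => (j : ℝ)) j).coeff i := by
  unfold cfn
  rw [Lagrange.interpolate_apply, Polynomial.finsetSum_coeff]
  simp

theorem cfn_poly (d i : ℕ) (v : ℕ → ℝ) (p : Polynomial ℝ) (hp : p.natDegree ≤ d)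
    (h : ∀ j ∈ Finset.range (d + 1), v j = p.eval (j : ℝ)) : cfn d i v = p.coeff i := by
  unfold cfn
  rw [← Lagrange.eq_interpolate_of_eval_eq v (f := p) (s := Finset.range (d + 1)) (v := fun j : ℕ => (j : ℝ))]
  · intro a _ b _ hab
    exact Nat.cast_injective (R := ℝ) hab
  · refine lt_of_le_of_lt Polynomial.degree_le_natDegree ?_
    rw [Finset.card_range]
    exact_mod_cast Nat.lt_succ_of_le hp
  · intro j hj
    exact (h j hj).symm

theorem cfn_sum (d i : ℕ) (v : ℕ → ℝ) (a : ℕ → ℝ) (hi : i < d + 1)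
    (h : ∀ j ∈ Finset.range (d + 1), v j = ∑ m ∈ Finset.range (d + 1), a m * (j : ℝ) ^ m) :
    cfn d i v = a i := by
  rw [cfn_poly d i v (∑ m ∈ Finset.range (d + 1), Polynomial.C (a m) * Polynomial.X ^ m)]
  · rw [Polynomial.finsetSum_coeff]
    simp [Polynomial.coeff_X_pow]
    intro h; omega
  · refine Polynomial.natDegree_sum_le_of_forall_le _ _ fun m hm => ?_
    refine (Polynomial.natDegree_C_mul_X_pow_le _ _).trans ?_
    simp at hm; omega
  · intro j hj
    rw [h j hj, Polynomial.eval_finset_sum]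
    simp

namespace Sm
variable {d : ℕ}

theorem K_congr {F F' : Sm d} (h : ∀ x, F.f x = F'.f x) : F.K = F'.K := by
  have : F.f = F'.f := funext h
  unfold K; rw [this]

theorem V_congr {F F' : Sm d} (h : ∀ x, F.f x = F'.f x) : F.V = F'.V := by
  unfold V; rw [K_congr h]

/-- normalized intrinsic volume -/
noncomputable def I (i : ℕ) (F : Sm d) : ℝ := cfn d i (fun j => (F.par j (Nat.cast_nonneg j)).V)

theorem I_congr {F F' : Sm d} (i : ℕ) (h : ∀ x, F.f x = F'.f x) : F.I i = F'.I i := by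
  unfold I
  congr 1; funext j
  apply V_congr
  intro x; simp [h]

theorem I_eq_intrinsic (hd : 1 < d) (F : Sm d) (k : ℕ) :
    intrinsicVolume d k F.K = F.I (d - k) / ballVolume (d - k) := by
  unfold intrinsicVolume I cfn V
  simp only [K_par hd]

theorem I_aux (hd : 1 < d) (F : Sm d) (i : ℕ) (hi : i < d + 1) :
    F.I i = if i = 0 then F.V else (∫ u, F.c (i - 1) u ∂(sg d)) / i := by
  unfold I
  rw [cfn_sum d i _ (fun i => if i = 0 then F.V else (∫ u, F.c (i - 1) u ∂(sg d)) / i) hi]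
  intro j _
  rw [steiner hd, Finset.sum_range_succ']
  rw [add_comm]
  congr 1
  · refine Finset.sum_congr rfl fun i _ => ?_
    simp
    ring
  · simp

theorem I_zero (hd : 1 < d) (F : Sm d) : F.I 0 = F.V := by
  rw [I_aux hd F 0 (by omega), if_pos rfl]

theorem I_succ (hd : 1 < d) (F : Sm d) (i : ℕ) (hi : i < d) :
    F.I (i + 1) = (∫ u, F.c i u ∂(sg d)) / (i + 1) := by
  rw [I_aux hd F (i + 1) (by omega), if_neg (by omega)]
  simp

/-- `f + ε g` -/
noncomputable def mix (F g : Sm d) (ε : ℝ) : Sm d := F.add (g.scale |ε| (abs_nonneg ε))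

@[simp] theorem mix_f (F g : Sm d) (ε : ℝ) (x : Eu d) : (F.mix g ε).f x = F.f x + |ε| * g.f x := rfl

theorem mix_c (F g : Sm d) (ε : ℝ) (i : ℕ) (u : sphere (0 : Eu d) 1) :
    (F.mix g ε).c i u = cc (F.H u + |ε| • g.H u) i := rfl

theorem cont_param (F g : Sm d) (i : ℕ) (φ : sphere (0 : Eu d) 1 → ℝ) (hφ : Continuous φ) :
    Continuous (fun ε : ℝ => ∫ u, (F.mix g ε).c i u * φ u ∂(sg d)) := by
  have h := continuous_parametric_integral_of_continuous (μ := sg d)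
    (f := fun ε u => (F.mix g ε).c i u * φ u) ?_ (isCompact_univ (X := sphere (0 : Eu d) 1))
  · simpa using h
  · simp only [mix_c, Function.uncurry_def]
    have h1 := F.H_cont_sph
    have h2 := g.H_cont_sph
    refine ((cc_continuous i).comp ?_).mul (by fun_prop)
    exact (h1.comp continuous_snd).add
      (((continuous_abs).comp continuous_fst).smul (h2.comp continuous_snd))

theorem mix_zero_c (F g : Sm d) (i : ℕ) (u : sphere (0 : Eu d) 1) :
    (F.mix g 0).c i u = F.c i u := by
  rw [mix_c]; unfold c
  congr 1
  ext x : 1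
  simp only [add_apply, smul_apply, abs_zero]
  module

open Filter Topology in
theorem dV (hd : 1 < d) (F g : Sm d) (hg : ∀ x, 0 ≤ g.f x) :
    Tendsto (fun ε => ((F.mix g ε).V - F.V) / ε) (𝓝[>] 0) (𝓝 (∫ u, F.c 0 u * g.f u ∂(sg d))) := by
  obtain ⟨C, hC0, hC⟩ := g.K_bdd
  have hg1 := g.f_cont_sph
  have hcc := fun i => F.c_cont i
  -- upper function
  let U : ℝ → ℝ := fun ε => ∑ i ∈ Finset.range d,
    ε ^ i * ∫ u, F.c i u * (g.f u ^ (i + 1) / (i + 1)) ∂(sg d)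
  let W : ℝ → ℝ := fun ε => ∑ i ∈ Finset.range d,
    ε ^ i * ∫ u, (F.mix g ε).c i u * ((C - g.f u) ^ (i + 1) / (i + 1)) ∂(sg d)
  let S : ℝ → ℝ := fun ε => ∑ i ∈ Finset.range d,
    ε ^ i * ((∫ u, F.c i u ∂(sg d)) * C ^ (i + 1) / (i + 1))
  have hUc : Continuous U := by fun_prop
  have hSc : Continuous S := by fun_prop
  have hWc : Continuous W := by
    refine continuous_finset_sum _ fun i _ => Continuous.mul (by fun_prop) ?_
    apply cont_param
    fun_prop
  have hz : ∀ a : ℕ → ℝ, ∑ i ∈ Finset.range d, (0 : ℝ) ^ i * a i = a 0 := by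
    intro a
    rw [Finset.sum_eq_single_of_mem 0 (by simp; omega)]
    · simp
    · intro i _ hi; simp [hi]
  have hU0 : U 0 = ∫ u, F.c 0 u * g.f u ∂(sg d) := by
    simp only [U]; rw [hz]; simp
  have hSW0 : S 0 - W 0 = ∫ u, F.c 0 u * g.f u ∂(sg d) := by
    simp only [S, W]; rw [hz, hz]
    simp only [mix_zero_c]
    simp only [zero_add, pow_one, Nat.cast_zero, div_one]
    rw [← integral_mul_const, ← integral_sub (sint (by fun_prop)) (sint (by fun_prop))]
    congr 1; funext u; ring
  have hup : ∀ ε > 0, (F.mix g ε).V - F.V ≤ ε * U ε := by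
    intro ε hε
    refine (V_diff_le hd F (F.mix g ε) fun x => ?_).trans (le_of_eq ?_)
    · simp; exact mul_nonneg (abs_nonneg _) (hg x)
    · simp only [mix_f, add_sub_cancel_left, U, Finset.mul_sum]
      rw [integral_finsetSum]
      · refine Finset.sum_congr rfl fun i _ => ?_
        rw [← mul_assoc, ← integral_const_mul]
        congr 1; funext u
        rw [abs_of_pos hε]; ring
      · intro i _
        apply sint; fun_prop
  have hlo : ∀ ε > 0, ε * (S ε - W ε) ≤ (F.mix g ε).V - F.V := by
    intro ε hε
    have h1 := steiner hd F (ε * C) (by positivity)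
    have h2 := V_diff_le hd (F.mix g ε) (F.par (ε * C) (by positivity)) fun x => by
      simp only [mix_f, par_f, abs_of_pos hε]
      have := (le_abs_self _).trans (hC x)
      nlinarith
    have h3 : ∫ u, ∑ i ∈ Finset.range d, (F.mix g ε).c i u *
        ((F.par (ε * C) (by positivity)).f u - (F.mix g ε).f u) ^ (i + 1) / (i + 1) ∂(sg d)
        = ε * W ε := by
      simp only [W, Finset.mul_sum]
      have hcm := fun i => (F.mix g ε).c_cont i
      rw [integral_finsetSum]
      · refine Finset.sum_congr rfl fun i _ => ?_
        rw [← mul_assoc, ← integral_const_mul]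
        congr 1; funext u
        simp only [mix_f, par_f, abs_of_pos hε, sph_norm]
        rw [show F.f u + ε * C * 1 - (F.f u + ε * g.f u) = ε * (C - g.f u) by ring, mul_pow]
        ring
      · intro i _
        apply sint
        have h5 := (F.mix g ε).f_cont_sph
        have h6 := (F.par (ε * C) (by positivity)).f_cont_sph
        fun_prop
    have h4 : ∑ i ∈ Finset.range d, (∫ u, F.c i u ∂(sg d)) * (ε * C) ^ (i + 1) / (i + 1)
        = ε * S ε := by
      simp only [S, Finset.mul_sum]
      refine Finset.sum_congr rfl fun i _ => ?_
      rw [mul_pow]; ring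
    rw [h3] at h2
    rw [h4] at h1
    linarith
  refine tendsto_of_tendsto_of_tendsto_of_le_of_le' (g := fun ε => S ε - W ε) (h := U) ?_ ?_ ?_ ?_
  · rw [← hSW0]; exact ((hSc.sub hWc).tendsto 0).mono_left nhdsWithin_le_nhds
  · rw [← hU0]; exact (hUc.tendsto 0).mono_left nhdsWithin_le_nhds
  · filter_upwards [self_mem_nhdsWithin] with ε hε
    have hε : 0 < ε := hε
    rw [le_div_iff₀ hε, mul_comm]; exact hlo ε hε
  · filter_upwards [self_mem_nhdsWithin] with ε hε
    have hε : 0 < ε := hε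
    rw [div_le_iff₀ hε, mul_comm]; exact hup ε hε

open Filter Topology in
theorem dI (hd : 1 < d) (F g : Sm d) (hg : ∀ x, 0 ≤ g.f x) (i : ℕ) (hi : i < d) :
    Tendsto (fun ε => ((F.mix g ε).I i - F.I i) / ε) (𝓝[>] 0)
      (𝓝 (∫ u, F.c i u * g.f u ∂(sg d))) := by
  have h1 : ∀ ε, ((F.mix g ε).I i - F.I i) / ε = cfn d i (fun j =>
      (((F.par j (Nat.cast_nonneg j)).mix g ε).V - (F.par j (Nat.cast_nonneg j)).V) / ε) := by
    intro ε
    unfold I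
    rw [cfn_eq, cfn_eq, cfn_eq, ← Finset.sum_sub_distrib, Finset.sum_div]
    refine Finset.sum_congr rfl fun j _ => ?_
    rw [V_congr (F := (F.mix g ε).par j _) (F' := (F.par j (Nat.cast_nonneg j)).mix g ε)
      (fun x => by simp; ring)]
    ring
  have h2 : cfn d i (fun j => ∫ u, (F.par j (Nat.cast_nonneg j)).c 0 u * g.f u ∂(sg d)) =
      ∫ u, F.c i u * g.f u ∂(sg d) := by
    rw [cfn_sum d i _ (fun i => if i < d then ∫ u, F.c i u * g.f u ∂(sg d) else 0) (by omega)]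
    · simp [hi]
    · intro j _
      rw [Finset.sum_range_succ]
      simp only [lt_irrefl, if_false, zero_mul, add_zero]
      simp only [par_c0 hd, Finset.sum_mul]
      rw [integral_finsetSum]
      · refine Finset.sum_congr rfl fun m hm => ?_
        rw [if_pos (Finset.mem_range.1 hm), ← integral_mul_const]
        congr 1; funext u; ring
      · intro m _
        apply sint
        have h5 := F.c_cont m
        have h6 := g.f_cont_sph
        fun_prop
  simp only [h1]
  rw [← h2]
  simp only [cfn_eq]
  refine tendsto_finset_sum _ fun j _ => ?_
  exact (dV hd _ g hg).mul_const _

theorem V_scale (F : Sm d) (a : ℝ) (ha : 0 < a) : (F.scale a ha.le).V = a ^ d * F.V := by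
  have : (F.scale a ha.le).K = a • F.K := by
    ext p
    rw [Set.mem_smul_set_iff_inv_smul_mem₀ ha.ne']
    simp only [K, Set.mem_ofPred_eq, scale, inner_smul_left, conj_trivial]
    refine forall_congr' fun x => ?_
    rw [inv_mul_le_iff₀ ha]
  unfold V
  rw [this, Measure.addHaar_smul, finrank_euclideanSpace_fin, ENNReal.toReal_mul,
    ENNReal.toReal_ofReal (abs_nonneg _), abs_of_pos (by positivity)]

theorem I_scale (hd : 1 < d) (F : Sm d) (a : ℝ) (ha : 0 < a) (i : ℕ) (hi : i ≤ d) :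
    (F.scale a ha.le).I i = a ^ (d - i) * F.I i := by
  rcases i with _ | i
  · rw [I_zero hd, I_zero hd, V_scale F a ha, Nat.sub_zero]
  · rw [I_succ hd _ i (by omega), I_succ hd _ i (by omega)]
    have : ∀ u, (F.scale a ha.le).c i u = a ^ (d - 1 - i) * F.c i u := fun u =>
      ppoly_smul (F.H u) i (by omega) a
    simp only [this]
    rw [integral_const_mul, show d - (i + 1) = d - 1 - i by omega]
    ring

open Filter Topology in
theorem int_c_f (hd : 1 < d) (F : Sm d) (hF : ∀ x, 0 ≤ F.f x) (i : ℕ) (hi : i < d) :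
    ∫ u, F.c i u * F.f u ∂(sg d) = (d - i : ℕ) * F.I i := by
  have h1 := dI hd F F hF i hi
  refine tendsto_nhds_unique h1 ?_
  have h2 : HasDerivAt (fun ε : ℝ => (1 + ε) ^ (d - i) * F.I i) ((d - i : ℕ) * F.I i) 0 := by
    have := (((hasDerivAt_id (0 : ℝ)).const_add 1).pow (d - i)).mul_const (F.I i)
    simpa using this
  have h3 := (hasDerivWithinAt_iff_tendsto_slope' (by simp)).1 (h2.hasDerivWithinAt (s := Set.Ioi 0))
  refine h3.congr' ?_
  filter_upwards [self_mem_nhdsWithin] with ε hε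
  have hε : 0 < ε := hε
  rw [slope_def_field]
  have h4 : (F.mix F ε).I i = (1 + ε) ^ (d - i) * F.I i := by
    rw [← I_scale hd F (1 + ε) (by linarith) i hi.le]
    apply I_congr
    intro x
    simp only [mix_f, scale, abs_of_pos hε]; ring
  rw [h4]; simp

end Sm

namespace Sm
variable {d : ℕ}

theorem I_nonneg (hd : 1 < d) (F : Sm d) (i : ℕ) (hi : i ≤ d) : 0 ≤ F.I i := by
  rcases i with _ | i
  · rw [I_zero hd]; exact ENNReal.toReal_nonneg
  · rw [I_succ hd _ i (by omega)]
    exact div_nonneg (integral_nonneg fun u => F.c_nonneg hd i u) (by positivity)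

theorem I_top (hd : 1 < d) (F F' : Sm d) : F.I d = F'.I d := by
  obtain ⟨n, rfl⟩ : ∃ n, d = n + 1 := ⟨d - 1, by omega⟩
  rw [I_succ hd _ n (by omega), I_succ hd _ n (by omega)]
  have : ∀ F : Sm (n + 1), ∀ u, F.c n u = 1 := fun F u => cc_top hd (F.H u)
  simp only [this]

/-- the ball of radius `ρ` -/
noncomputable def bl (d : ℕ) (ρ : ℝ) (hρ : 0 ≤ ρ) : Sm d := nrm.scale ρ hρ

@[simp] theorem bl_f (ρ : ℝ) (hρ : 0 ≤ ρ) (x : Eu d) : (bl d ρ hρ).f x = ρ * ‖x‖ := rfl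

theorem I_lower (hd : 1 < d) (F : Sm d) (ρ : ℝ) (hρ : 0 ≤ ρ) (h : ∀ x, ρ * ‖x‖ ≤ F.f x)
    (i : ℕ) (hi : i ≤ d) : (bl d ρ hρ).I i ≤ F.I i := by
  induction hi using Nat.decreasingInduction with
  | self => exact (I_top hd _ _).le
  | of_succ i hi ih =>
    have hF0 : ∀ x, 0 ≤ F.f x := fun x => le_trans (by positivity) (h x)
    have h1 := int_c_f hd F hF0 i hi
    have h2 := int_c_f hd (bl d ρ hρ) (fun x => mul_nonneg hρ (norm_nonneg x)) i hi
    have h3 : ∫ u, (bl d ρ hρ).c i u * (bl d ρ hρ).f u ∂(sg d) =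
        ρ * ((i + 1) * (bl d ρ hρ).I (i + 1)) := by
      rw [I_succ hd _ i hi, mul_div_cancel₀ _ (by positivity), ← integral_const_mul]
      congr 1; funext u
      rw [bl_f, sph_norm]; ring
    have h4 : ρ * ((i + 1) * F.I (i + 1)) ≤ ∫ u, F.c i u * F.f u ∂(sg d) := by
      rw [I_succ hd _ i hi, mul_div_cancel₀ _ (by positivity), ← integral_const_mul]
      have h5 := F.c_cont i
      have h6 := F.f_cont_sph
      refine integral_mono (sint (by fun_prop)) (sint (by fun_prop)) fun u => ?_
      have := h u
      rw [sph_norm, mul_one] at this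
      have h7 := F.c_nonneg hd i u
      dsimp only
      nlinarith
    have h5 : ρ * ((i + 1) * (bl d ρ hρ).I (i + 1)) ≤ ρ * ((i + 1) * F.I (i + 1)) := by
      gcongr
    have h6 : (0 : ℝ) < (d - i : ℕ) := by
      have : 0 < d - i := by omega
      exact_mod_cast this
    rw [h3] at h2
    rw [h1] at h4
    rw [h2] at h5
    exact le_of_mul_le_mul_left (h5.trans h4) h6

theorem touch_G {F F' : Sm d} (h : ∀ x, F'.f x ≤ F.f x) {y : Eu d} (hy : y ≠ 0)
    (he : F'.f y = F.f y) : F.G y = F'.G y :=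
  F.G_unique hy (fun x => (F'.G_mem hy x).trans (h x)) (by rw [F'.inner_G_self hy, he])

theorem line_deriv_at (F : Sm d) {y v : Eu d} {s : ℝ} (hy : y + s • v ≠ 0) :
    HasDerivAt (fun s : ℝ => F.f (y + s • v)) (inner ℝ (F.G (y + s • v)) v) s := by
  have h1 : HasDerivAt (fun s : ℝ => y + s • v) v s := by
    simpa using ((hasDerivAt_id s).smul_const v).const_add y
  have h3 := (F.hG _ hy).comp_hasDerivAt s h1
  simp only [innerSL_apply_apply] at h3
  exact h3

open Filter Topology in
theorem touch_H {F F' : Sm d} (h : ∀ x, F'.f x ≤ F.f x) {y : Eu d} (hy : y ≠ 0)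
    (he : F'.f y = F.f y) (v : Eu d) : inner ℝ (F'.H y v) v ≤ inner ℝ (F.H y v) v := by
  by_contra! hcon
  have hc : ContinuousAt (fun s : ℝ => y + s • v) 0 := by fun_prop
  have hev : ∀ᶠ s in 𝓝 (0 : ℝ), y + s • v ≠ 0 := by
    apply hc.eventually_ne; simpa using hy
  let κ : ℝ → ℝ := fun s => F'.f (y + s • v) - F.f (y + s • v)
  have h1 : deriv κ =ᶠ[𝓝 0] fun s => inner ℝ (F'.G (y + s • v)) v - inner ℝ (F.G (y + s • v)) v := by
    filter_upwards [hev] with s hs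
    exact ((F'.line_deriv_at hs).sub (F.line_deriv_at hs)).deriv
  have h2 : HasDerivAt (fun s : ℝ => (inner ℝ (F'.G (y + s • v)) v - inner ℝ (F.G (y + s • v)) v : ℝ))
      (inner ℝ (F'.H y v) v - inner ℝ (F.H y v) v) 0 := by
    have a1 := (F'.line_deriv_G hy v).inner ℝ (hasDerivAt_const (0 : ℝ) v)
    have a2 := (F.line_deriv_G hy v).inner ℝ (hasDerivAt_const (0 : ℝ) v)
    simp only [inner_zero_right, zero_add] at a1 a2
    exact a1.sub a2
  have h3 : deriv (deriv κ) 0 = inner ℝ (F'.H y v) v - inner ℝ (F.H y v) v := by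
    rw [h1.deriv_eq]; exact h2.deriv
  have hcont : Continuous κ := by
    have := F.continuous; have := F'.continuous
    fun_prop
  have h4 : IsLocalMin κ 0 := by
    apply isLocalMin_of_deriv_deriv_pos
    · rw [h3]; linarith
    · rw [h1.eq_of_nhds]
      simp [touch_G h hy he]
    · exact hcont.continuousAt
  have h0 : κ 0 = 0 := by simp [κ, he]
  have h5 : κ =ᶠ[𝓝 0] fun _ => 0 := by
    filter_upwards [h4] with s hs
    rw [h0] at hs
    have := h (y + s • v)
    simp only [κ] at hs ⊢
    linarith
  have h6 : deriv (deriv κ) 0 = 0 := by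
    have := h5.deriv
    rw [this.deriv_eq]; simp
  linarith

theorem key_pos (hd : 1 < d) (F : Sm d) (hF : ∀ x, 0 ≤ F.f x) (m : ℕ) (hm : m + 1 < d) :
    0 ≤ ∫ u, F.c (m + 1) u * (F.c (d - 2) u - ((d : ℝ) - 1) * F.f u) ∂(sg d) := by
  have h1 := int_c_f hd F hF (m + 1) hm
  rw [I_succ hd F m (by omega)] at h1
  have c1 := F.c_cont (m + 1)
  have c2 := F.c_cont (d - 2)
  have c3 := F.f_cont_sph
  have c4 := F.c_cont m
  have h2 : ∫ u, F.c (m + 1) u * (F.c (d - 2) u - ((d : ℝ) - 1) * F.f u) ∂(sg d) =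
      ∫ u, F.c (m + 1) u * F.c (d - 2) u ∂(sg d) -
      ((d : ℝ) - 1) * ∫ u, F.c (m + 1) u * F.f u ∂(sg d) := by
    rw [← integral_const_mul, ← integral_sub (sint (by fun_prop)) (sint (by fun_prop))]
    congr 1; funext u; ring
  have h3 : ∫ u, (((d : ℝ) - 1) * ((d : ℝ) - 1 - m)) * F.c m u ∂(sg d) ≤
      ∫ u, (m + 1) * (F.c (m + 1) u * F.c (d - 2) u) ∂(sg d) := by
    refine integral_mono (sint (by fun_prop)) (sint (by fun_prop)) fun u => ?_
    have := cc_newton hd (F.H u) (u : Eu d) (sph_norm u) (F.H_self (sph_ne u))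
      (F.H_symm (sph_ne u)) (F.H_psd (sph_ne u)) m
    dsimp only [c]
    linarith
  rw [integral_const_mul, integral_const_mul] at h3
  rw [h2, h1, sub_nonneg]
  have hcast : ((d - (m + 1) : ℕ) : ℝ) = (d : ℝ) - 1 - m := by
    rw [Nat.cast_sub hm.le]; push_cast; ring
  rw [hcast]
  have hm0 : (0 : ℝ) < m + 1 := by positivity
  rw [show ((d : ℝ) - 1) * (((d : ℝ) - 1 - m) * ((∫ u, F.c m u ∂(sg d)) / (m + 1))) =
    ((d : ℝ) - 1) * ((d : ℝ) - 1 - m) * (∫ u, F.c m u ∂(sg d)) / (m + 1) by ring]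
  rw [div_le_iff₀ hm0]
  linarith

end Sm

theorem trace_shift {d : ℕ} (hd : 1 < d) (A : Eu d →L[ℝ] Eu d) (u : Eu d) (hu : ‖u‖ = 1) (s : ℝ) :
    cc (A + s • (1 - ru u)) (d - 2) = cc A (d - 2) + s * ((d : ℝ) - 1) := by
  rw [cc_trace hd, cc_trace hd]
  have h1 : ∀ i : Fin d, inner ℝ ((A + s • (1 - ru u)) (EuclideanSpace.single i (1 : ℝ)))
      (EuclideanSpace.single i (1 : ℝ)) = inner ℝ (A (EuclideanSpace.single i (1 : ℝ)))
      (EuclideanSpace.single i (1 : ℝ)) + s * (1 - (u i) ^ 2) := by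
    intro i
    have e : inner ℝ u (EuclideanSpace.single i (1 : ℝ)) = u i := by
      rw [EuclideanSpace.inner_single_right]; simp
    simp [ru_apply, inner_add_left, inner_sub_left, inner_smul_left, -EuclideanSpace.inner_single_right, e]
    left; ring
  simp only [h1]
  rw [Finset.sum_add_distrib, ← Finset.mul_sum, Finset.sum_sub_distrib]
  have h2 := EuclideanSpace.real_norm_sq_eq u
  rw [hu] at h2
  rw [← h2]
  simp

/-- the inner integral in the Heintze–Karcher argument -/
theorem hk_inner {d : ℕ} (hd : 1 < d) (A : Eu d →L[ℝ] Eu d) (u : Eu d) (hu : ‖u‖ = 1)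
    (h : A u = 0) (hsym : ∀ x y, inner ℝ (A x) y = inner ℝ x (A y))
    (τ : ℝ) (hτ : 0 ≤ τ) (hpos : ∀ x, τ * (‖x‖ ^ 2 - (inner ℝ u x) ^ 2) ≤ inner ℝ (A x) x) :
    (∀ t ∈ Set.Icc 0 τ, 0 ≤ (ppoly A).eval (-t)) ∧
    ∫ t in (0:ℝ)..τ, (ppoly A).eval (-t) ≤ cc A 0 * cc A (d - 2) / (((d : ℝ) - 1) * d) := by
  have hd1 : (0 : ℝ) < (d : ℝ) - 1 := by
    have : (1 : ℝ) < d := by exact_mod_cast hd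
    linarith
  have hd0 : (0 : ℝ) < d := by linarith
  have hq : ∀ x, 0 ≤ ‖x‖ ^ 2 - (inner ℝ u x) ^ 2 := by
    intro x
    have := abs_real_inner_le_norm u x
    rw [hu, one_mul] at this
    have h2 := sq_abs (inner ℝ u x : ℝ)
    nlinarith [abs_nonneg (inner ℝ u x : ℝ), norm_nonneg x]
  have key : ∀ t ∈ Set.Icc 0 τ, 0 ≤ (ppoly A).eval (-t) ∧
      0 ≤ cc A (d - 2) - t * ((d : ℝ) - 1) ∧
      (((d : ℝ) - 1) * ((d : ℝ) - 1)) * (ppoly A).eval (-t) ≤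
        (ppoly A).derivative.eval (-t) * (cc A (d - 2) - t * ((d : ℝ) - 1)) := by
    intro t ht
    set B := A + (-t) • (1 - ru u) with hB
    have b1 : B u = 0 := by
      simp only [hB, add_apply, smul_apply, sub_apply, one_apply_eq_self, ru_apply, h,
        real_inner_self_eq_norm_sq, hu]
      simp
    have b2 : ∀ x y, inner ℝ (B x) y = inner ℝ x (B y) := by
      intro x y
      simp only [hB, add_apply, smul_apply, sub_apply, one_apply_eq_self, ru_apply,
        inner_add_left, inner_add_right, inner_sub_left, inner_sub_right, inner_smul_left,
        inner_smul_right, hsym, conj_trivial]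
      rw [real_inner_comm x u]; ring
    have b3 : ∀ x, 0 ≤ inner ℝ (B x) x := by
      intro x
      have e : inner ℝ (B x) x = inner ℝ (A x) x - t * (‖x‖ ^ 2 - (inner ℝ u x) ^ 2) := by
        simp only [hB, add_apply, smul_apply, sub_apply, one_apply_eq_self, ru_apply,
          inner_add_left, inner_sub_left, inner_smul_left, conj_trivial,
          real_inner_self_eq_norm_sq]
        ring
      rw [e]
      have := hpos x
      have := mul_le_mul_of_nonneg_right ht.2 (hq x)
      linarith
    have p0 : (ppoly A).eval (-t) = cc B 0 := by
      rw [cc_shift hd A u hu h, ppoly_eval hd]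
    have p1 : (ppoly A).derivative.eval (-t) = cc B 1 := by
      unfold cc
      rw [hB, ppoly_shift A u hu h, ← Polynomial.taylor_apply, Polynomial.taylor_coeff_one]
    have p2 : cc A (d - 2) - t * ((d : ℝ) - 1) = cc B (d - 2) := by
      rw [hB, trace_shift hd A u hu]; ring
    rw [p0, p1, p2]
    refine ⟨cc_nonneg hd B u hu b1 b2 b3 0, cc_nonneg hd B u hu b1 b2 b3 _, ?_⟩
    have := cc_newton hd B u hu b1 b2 b3 0
    simp at this
    linarith
  refine ⟨fun t ht => (key t ht).1, ?_⟩
  let ψ : ℝ → ℝ := fun t => -((ppoly A).eval (-t) * (cc A (d - 2) - t * ((d : ℝ) - 1)))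
  let ψ' : ℝ → ℝ := fun t => (ppoly A).derivative.eval (-t) * (cc A (d - 2) - t * ((d : ℝ) - 1))
    + (ppoly A).eval (-t) * ((d : ℝ) - 1)
  have hψ : ∀ t, HasDerivAt ψ (ψ' t) t := by
    intro t
    have e1 : HasDerivAt (fun t : ℝ => (ppoly A).eval (-t)) ((ppoly A).derivative.eval (-t) * (-1)) t :=
      ((ppoly A).hasDerivAt (-t)).comp t (hasDerivAt_neg t)
    have e2 : HasDerivAt (fun t : ℝ => cc A (d - 2) - t * ((d : ℝ) - 1)) (-(1 * ((d : ℝ) - 1))) t :=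
      ((hasDerivAt_id t).mul_const _).const_sub _
    refine (e1.mul e2).neg.congr_deriv ?_
    simp only [ψ']; ring
  have hψc : Continuous ψ' := by fun_prop
  have hIntg := intervalIntegral.integral_eq_sub_of_hasDerivAt (a := 0) (b := τ)
    (fun t _ => hψ t) (hψc.intervalIntegrable _ _)
  have hmono : ∫ t in (0:ℝ)..τ, (((d : ℝ) - 1) * d) * (ppoly A).eval (-t) ≤ ∫ t in (0:ℝ)..τ, ψ' t := by
    refine intervalIntegral.integral_mono_on hτ (Continuous.intervalIntegrable (by fun_prop) _ _)
      (hψc.intervalIntegrable _ _) fun t ht => ?_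
    have := (key t ht).2.2
    simp only [ψ']
    nlinarith
  rw [intervalIntegral.integral_const_mul, hIntg] at hmono
  have e3 : ψ τ ≤ 0 := by
    obtain ⟨a1, a2, _⟩ := key τ ⟨hτ, le_rfl⟩
    simp only [ψ]
    have := mul_nonneg a1 a2
    linarith
  have e4 : ψ 0 = -(cc A 0 * cc A (d - 2)) := by
    simp only [ψ, neg_zero, ppoly_eval_zero]; ring
  rw [le_div_iff₀ (by positivity)]
  linarith

theorem hk_fiber {d : ℕ} (hd : 1 < d) (A : Eu d →L[ℝ] Eu d) (u : Eu d) (hu : ‖u‖ = 1)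
    (h : A u = 0) (hsym : ∀ x y, inner ℝ (A x) y = inner ℝ x (A y))
    (hp : ∀ x, 0 ≤ inner ℝ (A x) x) :
    ∫⁻ t in {t : ℝ | 0 < t ∧ ∀ x, t * (‖x‖ ^ 2 - (inner ℝ u x) ^ 2) ≤ inner ℝ (A x) x},
      ENNReal.ofReal |(ppoly A).eval (-t)| ≤
      ENNReal.ofReal (cc A 0 * cc A (d - 2) / (((d : ℝ) - 1) * d)) := by
  set E := {t : ℝ | 0 < t ∧ ∀ x, t * (‖x‖ ^ 2 - (inner ℝ u x) ^ 2) ≤ inner ℝ (A x) x} with hE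
  rcases E.eq_empty_or_nonempty with he | hne
  · rw [he]; simp
  have hq : ∀ x, 0 ≤ ‖x‖ ^ 2 - (inner ℝ u x) ^ 2 := by
    intro x
    have := abs_real_inner_le_norm u x
    rw [hu, one_mul] at this
    have h2 := sq_abs (inner ℝ u x : ℝ)
    nlinarith [abs_nonneg (inner ℝ u x : ℝ), norm_nonneg x]
  obtain ⟨v, hv1, hv2⟩ : ∃ v : Eu d, v ≠ 0 ∧ inner ℝ u v = 0 := by
    have h1 : 0 < Module.finrank ℝ (Submodule.span ℝ {u})ᗮ := by
      have := Submodule.finrank_add_finrank_orthogonal (Submodule.span ℝ {u})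
      rw [finrank_span_singleton (by intro h0; rw [h0] at hu; simp at hu),
        finrank_euclideanSpace_fin] at this
      omega
    haveI := Module.nontrivial_of_finrank_pos h1
    obtain ⟨v, hv⟩ := exists_ne (0 : (Submodule.span ℝ {u})ᗮ)
    refine ⟨v, by simpa using hv, ?_⟩
    exact Submodule.inner_right_of_mem_orthogonal (Submodule.mem_span_singleton_self u) v.2
  have hbdd : BddAbove E := by
    refine ⟨inner ℝ (A v) v / ‖v‖ ^ 2, fun t ht => ?_⟩
    have := ht.2 v
    rw [hv2] at this
    have h3 : 0 < ‖v‖ := norm_pos_iff.2 hv1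
    rw [le_div_iff₀ (by positivity)]
    simpa using this
  set τ := sSup E with hτ
  have hτ0 : 0 < τ := by
    obtain ⟨t, ht⟩ := hne
    exact lt_of_lt_of_le ht.1 (le_csSup hbdd ht)
  have hτc : ∀ x, τ * (‖x‖ ^ 2 - (inner ℝ u x) ^ 2) ≤ inner ℝ (A x) x := by
    intro x
    rcases (hq x).eq_or_lt with h0 | h0
    · rw [← h0, mul_zero]; exact hp x
    · rw [← le_div_iff₀ h0]
      refine csSup_le hne fun t ht => ?_
      rw [le_div_iff₀ h0]; exact ht.2 x
  have hsub : E ⊆ Set.Ioc 0 τ := fun t ht => ⟨ht.1, le_csSup hbdd ht⟩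
  obtain ⟨k1, k2⟩ := hk_inner hd A u hu h hsym τ hτ0.le hτc
  refine (lintegral_mono_set hsub).trans ?_
  have e : ∫⁻ t in Set.Ioc 0 τ, ENNReal.ofReal |(ppoly A).eval (-t)| =
      ENNReal.ofReal (∫ t in (0:ℝ)..τ, (ppoly A).eval (-t)) := by
    rw [intervalIntegral.integral_of_le hτ0.le, ofReal_integral_eq_lintegral_ofReal]
    · refine setLIntegral_congr_fun measurableSet_Ioc fun t ht => ?_
      rw [abs_of_nonneg (k1 t ⟨ht.1.le, ht.2⟩)]
    · apply Continuous.integrableOn_Ioc; fun_prop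
    · filter_upwards [ae_restrict_mem measurableSet_Ioc] with t ht
      exact k1 t ⟨ht.1.le, ht.2⟩
  rw [e]
  exact ENNReal.ofReal_le_ofReal k2

namespace Sm
variable {d : ℕ}

/-- Heintze–Karcher domain -/
def hkD (F : Sm d) : Set (Eu d) :=
  {y | y ≠ 0 ∧ ∀ x, ‖y‖ ^ 2 * ‖x‖ ^ 2 - (inner ℝ y x) ^ 2 ≤ ‖y‖ ^ 2 * inner ℝ (F.H y x) x}

theorem measH (F : Sm d) : Measurable (fun x => ({0}ᶜ : Set (Eu d)).indicator F.H x) := by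
  classical
  have := F.cH.measurable_piecewise (continuousOn_const (c := 0))
    (measurableSet_singleton (0 : Eu d)).compl
  have h3 : (fun x => ({0}ᶜ : Set (Eu d)).indicator F.H x) =
      ({0}ᶜ : Set (Eu d)).piecewise F.H (fun _ => 0) :=
    Set.piecewise_eq_indicator.symm
  rw [h3]; exact this

theorem hkD_meas (F : Sm d) : MeasurableSet F.hkD := by
  let T : Set (Eu d × (Eu d →L[ℝ] Eu d)) :=
    {z | ∀ x, ‖z.1‖ ^ 2 * ‖x‖ ^ 2 - (inner ℝ z.1 x) ^ 2 ≤ ‖z.1‖ ^ 2 * inner ℝ (z.2 x) x}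
  have hT : IsClosed T := by
    have : T = ⋂ x, {z : Eu d × (Eu d →L[ℝ] Eu d) | ‖z.1‖ ^ 2 * ‖x‖ ^ 2 - (inner ℝ z.1 x) ^ 2 ≤
        ‖z.1‖ ^ 2 * inner ℝ (z.2 x) x} := by ext; simp [T]
    rw [this]
    exact isClosed_iInter fun x => isClosed_le (by fun_prop) (by fun_prop)
  have h1 : F.hkD = {0}ᶜ ∩ (fun y => (y, ({0}ᶜ : Set (Eu d)).indicator F.H y)) ⁻¹' T := by
    ext y
    by_cases hy : y = 0
    · simp [hkD, hy]
    · simp [hkD, hy, T]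
  rw [h1]
  exact (measurableSet_singleton _).compl.inter
    ((measurable_id.prodMk F.measH) hT.measurableSet)

theorem hkD_ray (F : Sm d) (u : sphere (0 : Eu d) 1) {t : ℝ} (ht : 0 < t) :
    t • (u : Eu d) ∈ F.hkD ↔
      ∀ x, t * (‖x‖ ^ 2 - (inner ℝ (u : Eu d) x) ^ 2) ≤ inner ℝ (F.H u x) x := by
  simp only [hkD, Set.mem_ofPred_eq, F.H_smul (sph_ne u) ht, smul_apply, inner_smul_left,
    norm_smul, sph_norm, conj_trivial, mul_one, Real.norm_of_nonneg ht.le]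
  constructor
  · rintro ⟨_, h⟩ x
    have := h x
    have e : t ^ 2 * (t⁻¹ * inner ℝ (F.H u x) x) = t * inner ℝ (F.H u x) x := by field_simp
    rw [e] at this
    have h2 : t * (t * (‖x‖ ^ 2 - (inner ℝ (u : Eu d) x) ^ 2)) ≤ t * inner ℝ (F.H u x) x := by
      linarith
    exact le_of_mul_le_mul_left h2 ht
  · intro h
    refine ⟨smul_ne_zero ht.ne' (sph_ne u), fun x => ?_⟩
    have e : t ^ 2 * (t⁻¹ * inner ℝ (F.H u x) x) = t * inner ℝ (F.H u x) x := by field_simp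
    rw [e]
    have := mul_le_mul_of_nonneg_left (h x) ht.le
    linarith

theorem nrm_H_inner (u : sphere (0 : Eu d) 1) (x : Eu d) :
    inner ℝ ((nrm : Sm d).H u x) x = ‖x‖ ^ 2 - (inner ℝ (u : Eu d) x) ^ 2 := by
  change inner ℝ ((‖(u : Eu d)‖⁻¹ • (1 - ru (‖(u : Eu d)‖⁻¹ • (u : Eu d)))) x) x = _
  rw [sph_norm]
  simp only [inv_one, one_smul, smul_apply, sub_apply, one_apply_eq_self, ru_apply,
    inner_sub_left, inner_smul_left, conj_trivial, real_inner_self_eq_norm_sq]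
  ring

theorem hk_cover (hd : 1 < d) (F : Sm d) : interior F.K ⊆ (fun y => F.G y - y) '' F.hkD := by
  intro z hz
  haveI : Nonempty (Fin d) := ⟨⟨0, by omega⟩⟩
  have hne : (sphere (0 : Eu d) 1).Nonempty := NormedSpace.sphere_nonempty.2 zero_le_one
  obtain ⟨u, hu, hmin⟩ := (isCompact_sphere (0 : Eu d) 1).exists_isMinOn hne
    (f := fun x => F.f x - inner ℝ z x) (by have := F.continuous; fun_prop)
  set t := F.f u - inner ℝ z u with ht
  have hun : ‖u‖ = 1 := by simpa using hu
  have hu0 : u ≠ 0 := by intro h; rw [h] at hun; simp at hun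
  have htpos : 0 < t := by
    obtain ⟨ε, hε, hb⟩ := Metric.mem_nhds_iff.1 (mem_interior_iff_mem_nhds.1 hz)
    have h1 : z + (ε / 2) • u ∈ F.K := by
      apply hb
      rw [mem_ball, dist_eq_norm, add_sub_cancel_left, norm_smul, hun, Real.norm_of_nonneg (by linarith)]
      linarith
    have h2 := h1 u
    rw [inner_add_left, inner_smul_left, real_inner_self_eq_norm_sq, hun] at h2
    simp at h2
    linarith
  let F' : Sm d := (lin z).add (nrm.scale t htpos.le)
  have hF' : ∀ x, F'.f x = inner ℝ z x + t * ‖x‖ := fun x => rfl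
  have hle : ∀ x, F'.f x ≤ F.f x := by
    intro x
    rw [hF']
    by_cases hx : x = 0
    · simp [hx, F.f_zero]
    have hn : 0 < ‖x‖ := norm_pos_iff.2 hx
    have h1 := hmin (show ‖x‖⁻¹ • x ∈ sphere (0 : Eu d) 1 by simp [norm_smul, hn.ne'])
    simp only [Set.mem_ofPred_eq] at h1
    rw [F.hom _ _ (by positivity), inner_smul_right] at h1
    have h2 := mul_le_mul_of_nonneg_left h1 hn.le
    have h3 : ‖x‖ * (‖x‖⁻¹ * F.f x - ‖x‖⁻¹ * inner ℝ z x) = F.f x - inner ℝ z x := by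
      field_simp
    rw [h3] at h2
    linarith
  have heq : F'.f u = F.f u := by rw [hF', hun]; linarith
  have hG := touch_G hle hu0 heq
  have hG' : F.G u = z + t • u := by
    rw [hG]
    change z + t • (‖u‖⁻¹ • u) = _
    rw [hun]; simp
  refine ⟨t • u, ?_, ?_⟩
  · refine (F.hkD_ray ⟨u, hu⟩ htpos).2 fun x => ?_
    have := touch_H hle hu0 heq x
    have h2 : inner ℝ (F'.H u x) x = t * inner ℝ ((nrm : Sm d).H u x) x := by
      change inner ℝ ((0 + t • (nrm : Sm d).H u) x) x = _
      rw [zero_add, smul_apply, inner_smul_left]; simp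
    rw [h2, nrm_H_inner ⟨u, hu⟩] at this
    exact this
  · simp only
    rw [F.G_smul hu0 htpos, hG']; abel

theorem heintze_karcher (hd : 1 < d) (F : Sm d) :
    F.V ≤ ∫ u, F.c 0 u * F.c (d - 2) u / (((d : ℝ) - 1) * d) ∂(sg d) := by
  have hd1 : (0 : ℝ) < (d : ℝ) - 1 := by
    have : (1 : ℝ) < d := by exact_mod_cast hd
    linarith
  have hd0 : (0 : ℝ) < d := by linarith
  have hnn : ∀ u, 0 ≤ F.c 0 u * F.c (d - 2) u / (((d : ℝ) - 1) * d) := fun u =>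
    div_nonneg (mul_nonneg (F.c_nonneg hd _ u) (F.c_nonneg hd _ u)) (by positivity)
  unfold V
  refine ENNReal.toReal_le_of_le_ofReal (integral_nonneg hnn) ?_
  have h0 : volume F.K ≤ volume (interior F.K) := by
    have h1 : F.K ⊆ interior F.K ∪ frontier F.K := by
      rw [← closure_eq_interior_union_frontier]; exact subset_closure
    refine (measure_mono h1).trans ((measure_union_le _ _).trans ?_)
    rw [F.K_convex.addHaar_frontier volume, add_zero]
  refine h0.trans ((measure_mono (F.hk_cover hd)).trans ?_)
  refine (addHaar_image_le_lintegral_abs_det_fderiv volume F.hkD_meas (f' := fun y => F.H y - 1)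
    (fun x hx => ((F.hH x hx.1).sub (hasFDerivAt_id x)).hasFDerivWithinAt)).trans ?_
  rw [← lintegral_indicator F.hkD_meas, polar_lintegral hd]
  · rw [ofReal_integral_eq_lintegral_ofReal]
    · refine lintegral_mono fun u => ?_
      refine le_trans ?_ (hk_fiber hd (F.H u) (u : Eu d) (sph_norm u) (F.H_self (sph_ne u))
        (F.H_symm (sph_ne u)) (F.H_psd (sph_ne u)))
      set E := {t : ℝ | 0 < t ∧ ∀ x, t * (‖x‖ ^ 2 - (inner ℝ (u : Eu d) x) ^ 2) ≤
        inner ℝ (F.H u x) x} with hE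
      have hEm : MeasurableSet E := by
        have : E = Set.Ioi 0 ∩ ⋂ x, {t : ℝ | t * (‖x‖ ^ 2 - (inner ℝ (u : Eu d) x) ^ 2) ≤
          inner ℝ (F.H u x) x} := by ext; simp [hE]
        rw [this]
        exact measurableSet_Ioi.inter
          (isClosed_iInter fun x => isClosed_le (by fun_prop) (by fun_prop)).measurableSet
      rw [← lintegral_indicator hEm, ← lintegral_indicator measurableSet_Ioi]
      refine lintegral_mono fun t => ?_
      by_cases ht : t ∈ Set.Ioi (0 : ℝ)
      · rw [Set.indicator_of_mem ht]
        have ht : 0 < t := ht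
        by_cases hm : t • (u : Eu d) ∈ F.hkD
        · rw [Set.indicator_of_mem hm, Set.indicator_of_mem (show t ∈ E from
            ⟨ht, (F.hkD_ray u ht).1 hm⟩), ← ENNReal.ofReal_mul (by positivity)]
          apply le_of_eq
          congr 1
          have h1 : F.H (t • (u : Eu d)) - 1 = t⁻¹ • (F.H u + (-t) • 1) := by
            rw [F.H_smul (sph_ne u) ht]
            ext x : 1
            simp only [add_apply, smul_apply, sub_apply, one_apply_eq_self, smul_add, smul_smul]
            rw [mul_neg, inv_mul_cancel₀ ht.ne']
            module
          have h2 : (t⁻¹ • (F.H u + (-t) • (1 : Eu d →L[ℝ] Eu d))).det =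
              (t⁻¹) ^ d * (F.H u + (-t) • 1).det := by
            have := LinearMap.det_smul t⁻¹ ((F.H u + (-t) • (1 : Eu d →L[ℝ] Eu d)) : Eu d →ₗ[ℝ] Eu d)
            rw [finrank_euclideanSpace_fin] at this
            exact this
          rw [h1, h2, det_eq_ppoly _ (u : Eu d) (sph_ne u) (F.H_self (sph_ne u))]
          rw [abs_mul, abs_mul, abs_neg, abs_of_pos ht, abs_of_pos (by positivity)]
          generalize |(ppoly (F.H u)).eval (-t)| = q
          obtain ⟨n, hn⟩ : ∃ n, d = n + 1 := ⟨d - 1, by omega⟩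
          rw [hn]
          simp only [add_tsub_cancel_right, inv_pow]
          field_simp
          ring
        · rw [Set.indicator_of_notMem hm, mul_zero]; exact zero_le
      · rw [Set.indicator_of_notMem ht]; exact zero_le
    · apply sint
      have h1 := F.c_cont 0
      have h2 := F.c_cont (d - 2)
      fun_prop
    · exact Filter.Eventually.of_forall hnn
  · have h2 : F.hkD.indicator (fun x => ENNReal.ofReal |(F.H x - 1).det|) =
      F.hkD.indicator (fun x => ENNReal.ofReal |((({0}ᶜ : Set (Eu d)).indicator F.H x) - 1).det|) := by
      ext x
      by_cases hx : x ∈ F.hkD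
      · simp only [Set.indicator_of_mem hx]
        rw [Set.indicator_of_mem]
        exact hx.1
      · simp only [Set.indicator_of_notMem hx]
    rw [h2]
    refine Measurable.indicator ?_ F.hkD_meas
    have : Continuous fun A : Eu d →L[ℝ] Eu d => (A - 1).det :=
      ContinuousLinearMap.continuous_det.comp (by fun_prop)
    exact (this.measurable.comp F.measH).abs.ennreal_ofReal

theorem key (hd : 1 < d) (F : Sm d) (hF : ∀ x, 0 ≤ F.f x) (i : ℕ) (hi : i < d) :
    0 ≤ ∫ u, F.c i u * (F.c (d - 2) u - ((d : ℝ) - 1) * F.f u) ∂(sg d) := by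
  rcases i with _ | m
  · have hd1 : (0 : ℝ) < (d : ℝ) - 1 := by
      have : (1 : ℝ) < d := by exact_mod_cast hd
      linarith
    have hd0 : (0 : ℝ) < d := by linarith
    have h1 := int_c_f hd F hF 0 hi
    rw [I_zero hd] at h1
    have h3 := heintze_karcher hd F
    rw [integral_div, le_div_iff₀ (by positivity)] at h3
    have c1 := F.c_cont 0
    have c2 := F.c_cont (d - 2)
    have c3 := F.f_cont_sph
    have h2 : ∫ u, F.c 0 u * (F.c (d - 2) u - ((d : ℝ) - 1) * F.f u) ∂(sg d) =
        ∫ u, F.c 0 u * F.c (d - 2) u ∂(sg d) -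
        ((d : ℝ) - 1) * ∫ u, F.c 0 u * F.f u ∂(sg d) := by
      rw [← integral_const_mul, ← integral_sub (sint (by fun_prop)) (sint (by fun_prop))]
      congr 1; funext u; ring
    rw [h2, h1, Nat.sub_zero]
    linarith
  · exact key_pos hd F hF m hi

end Sm

/-- linear isometries -/
abbrev Ga (d : ℕ) := {T : Eu d →L[ℝ] Eu d // ∀ x, ‖T x‖ = ‖x‖}

instance Ga_compact {d : ℕ} : CompactSpace (Ga d) := by
  apply isCompact_iff_compactSpace.1
  apply Metric.isCompact_of_isClosed_isBounded
  · have : {T : Eu d →L[ℝ] Eu d | ∀ x, ‖T x‖ = ‖x‖} = ⋂ x, {T | ‖T x‖ = ‖x‖} := by ext; simp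
    change IsClosed {T : Eu d →L[ℝ] Eu d | ∀ x, ‖T x‖ = ‖x‖}
    rw [this]
    exact isClosed_iInter fun x => isClosed_eq (by fun_prop) (by fun_prop)
  · refine (isBounded_iff_forall_norm_le).2 ⟨1, fun T hT => ?_⟩
    exact T.opNorm_le_bound zero_le_one fun x => by rw [hT x, one_mul]

theorem Ga_ne {d : ℕ} (T : Ga d) {x : Eu d} (hx : x ≠ 0) : T.1 x ≠ 0 := by
  rw [← norm_ne_zero_iff, T.2 x]; exact norm_ne_zero_iff.2 hx

theorem Ga_norm {d : ℕ} (T : Ga d) : ‖T.1‖ ≤ 1 :=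
  T.1.opNorm_le_bound zero_le_one fun x => by rw [T.2 x, one_mul]

theorem gint {d : ℕ} {E : Type*} [NormedAddCommGroup E] (μ : Measure (Ga d)) [IsFiniteMeasure μ]
    {φ : Ga d → E} (h : Continuous φ) : Integrable φ μ :=
  h.integrable_of_hasCompactSupport (HasCompactSupport.of_compactSpace _)

namespace Sm
variable {d : ℕ} (F : Sm d)

theorem H_bdd : ∃ C : ℝ, 0 ≤ C ∧ ∀ x, x ≠ 0 → ‖F.H x‖ ≤ C * ‖x‖⁻¹ := by
  obtain ⟨C, hC⟩ := (isCompact_sphere (0 : Eu d) 1).exists_bound_of_continuousOn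
    (F.cH.mono (fun x hx => sph_ne ⟨x, hx⟩))
  refine ⟨max C 0, le_max_right _ _, fun x hx => ?_⟩
  have hn : 0 < ‖x‖ := norm_pos_iff.2 hx
  have h1 := hC (‖x‖⁻¹ • x) (by simp [norm_smul, hn.ne'])
  rw [F.H_smul hx (by positivity), inv_inv, norm_smul, norm_norm] at h1
  rw [← div_eq_mul_inv, le_div_iff₀ hn, mul_comm]
  exact h1.trans (le_max_left _ _)

theorem G_bdd : ∃ C : ℝ, 0 ≤ C ∧ ∀ x, x ≠ 0 → ‖F.G x‖ ≤ C := by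
  obtain ⟨C, hC⟩ := F.K_compact.isBounded.exists_norm_le
  exact ⟨max C 0, le_max_right _ _, fun x hx => (hC _ (F.G_mem hx)).trans (le_max_left _ _)⟩

/-- rotated gradient -/
noncomputable def gT (x : Eu d) (T : Ga d) : Eu d := ContinuousLinearMap.adjoint T.1 (F.G (T.1 x))

/-- rotated hessian -/
noncomputable def hT (x : Eu d) (T : Ga d) : Eu d →L[ℝ] Eu d :=
  (ContinuousLinearMap.adjoint T.1).comp ((F.H (T.1 x)).comp T.1)

theorem adj_norm (T : Ga d) : ‖ContinuousLinearMap.adjoint T.1‖ ≤ 1 := by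
  rw [LinearIsometryEquiv.norm_map]; exact Ga_norm T

theorem adj_cont : Continuous (fun T : Ga d => ContinuousLinearMap.adjoint T.1) :=
  (ContinuousLinearMap.adjoint (𝕜 := ℝ) (E := Eu d) (F := Eu d)).continuous.comp
    continuous_subtype_val

theorem eval_cont (x : Eu d) : Continuous (fun T : Ga d => T.1 x) :=
  (ContinuousLinearMap.apply ℝ (Eu d) x).continuous.comp continuous_subtype_val

theorem gT_cont {x : Eu d} (hx : x ≠ 0) : Continuous (F.gT x) := by
  unfold gT
  exact adj_cont.clm_apply (F.contG.comp_continuous (eval_cont x) fun T => Ga_ne T hx)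

theorem hT_cont {x : Eu d} (hx : x ≠ 0) : Continuous (F.hT x) := by
  unfold hT
  exact adj_cont.clm_comp ((F.cH.comp_continuous (eval_cont x) fun T => Ga_ne T hx).clm_comp
    continuous_subtype_val)

theorem hT_norm {C : ℝ} (hC : ∀ x, x ≠ 0 → ‖F.H x‖ ≤ C * ‖x‖⁻¹) {x : Eu d} (hx : x ≠ 0) (T : Ga d) :
    ‖F.hT x T‖ ≤ C * ‖x‖⁻¹ := by
  unfold hT
  have h1 := hC _ (Ga_ne T hx)
  rw [T.2 x] at h1
  calc _ ≤ ‖ContinuousLinearMap.adjoint T.1‖ * (‖F.H (T.1 x)‖ * ‖T.1‖) :=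
        (ContinuousLinearMap.opNorm_comp_le _ _).trans
          (mul_le_mul_of_nonneg_left (ContinuousLinearMap.opNorm_comp_le _ _) (norm_nonneg _))
    _ ≤ 1 * (‖F.H (T.1 x)‖ * 1) := by
        gcongr
        · exact adj_norm T
        · exact Ga_norm T
    _ ≤ _ := by simpa using h1

theorem gT_norm {C : ℝ} (hC : ∀ x, x ≠ 0 → ‖F.G x‖ ≤ C) {x : Eu d} (hx : x ≠ 0) (T : Ga d) :
    ‖F.gT x T‖ ≤ C := by
  unfold gT
  refine (ContinuousLinearMap.le_opNorm _ _).trans ?_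
  have := hC _ (Ga_ne T hx)
  have h2 := adj_norm T
  nlinarith [norm_nonneg (F.G (T.1 x)), norm_nonneg (ContinuousLinearMap.adjoint T.1)]

theorem fT_deriv {x : Eu d} (hx : x ≠ 0) (T : Ga d) :
    HasFDerivAt (fun x => F.f (T.1 x)) (innerSL ℝ (F.gT x T)) x := by
  refine ((F.hG _ (Ga_ne T hx)).comp x T.1.hasFDerivAt).congr_fderiv ?_
  ext v : 1
  simp [gT, ContinuousLinearMap.adjoint_inner_left]

theorem gT_deriv {x : Eu d} (hx : x ≠ 0) (T : Ga d) :
    HasFDerivAt (fun x => F.gT x T) (F.hT x T) x :=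
  (ContinuousLinearMap.adjoint T.1).hasFDerivAt.comp x
    ((F.hH _ (Ga_ne T hx)).comp x T.1.hasFDerivAt)

theorem fT_cont (x : Eu d) : Continuous (fun T : Ga d => F.f (T.1 x)) :=
  F.continuous.comp (eval_cont x)

open Filter Topology in
theorem nhd_half {x : Eu d} (hx : x ≠ 0) : {y : Eu d | ‖x‖ / 2 < ‖y‖} ∈ 𝓝 x := by
  refine (isOpen_lt continuous_const continuous_norm).mem_nhds ?_
  have : 0 < ‖x‖ := norm_pos_iff.2 hx
  simp only [Set.mem_ofPred_eq]; linarith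

theorem half_ne {x y : Eu d} (h : ‖x‖ / 2 < ‖y‖) : y ≠ 0 := by
  rw [← norm_pos_iff]; exact lt_of_le_of_lt (by positivity) h

open Filter Topology in
/-- averaging over isometries -/
noncomputable def avg (μ : ProbabilityMeasure (Ga d)) : Sm d where
  f x := ∫ T, F.f (T.1 x) ∂(μ : Measure (Ga d))
  G x := ∫ T, F.gT x T ∂(μ : Measure (Ga d))
  H x := ∫ T, F.hT x T ∂(μ : Measure (Ga d))
  hom t x ht := by
    rw [← integral_const_mul]
    congr 1; funext T
    rw [map_smul, F.hom t _ ht]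
  sub x y := by
    rw [← integral_add (gint _ (F.fT_cont x)) (gint _ (F.fT_cont y))]
    refine integral_mono (gint _ (F.fT_cont _)) ((gint _ (F.fT_cont x)).add (gint _ (F.fT_cont y)))
      fun T => ?_
    dsimp only
    rw [map_add]; exact F.sub _ _
  hG x hx := by
    obtain ⟨C, hC0, hC⟩ := F.G_bdd
    have h := hasFDerivAt_integral_of_dominated_of_fderiv_le (μ := (μ : Measure (Ga d))) (𝕜 := ℝ)
      (F := fun x (T : Ga d) => F.f (T.1 x)) (F' := fun x (T : Ga d) => innerSL ℝ (F.gT x T))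
      (x₀ := x) (bound := fun _ => C) (nhd_half hx)
      (Eventually.of_forall fun y => (F.fT_cont y).aestronglyMeasurable)
      (gint _ (F.fT_cont x)) (((innerSL ℝ).continuous.comp (F.gT_cont hx)).aestronglyMeasurable)
      (Eventually.of_forall fun T y hy => by
        rw [innerSL_apply_norm]; exact F.gT_norm hC (half_ne hy) T)
      (integrable_const _) (Eventually.of_forall fun T y hy => F.fT_deriv (half_ne hy) T)
    refine h.congr_fderiv ?_
    exact ((innerSL ℝ).integral_comp_comm (gint _ (F.gT_cont hx)))
  hH x hx := by
    obtain ⟨C, hC0, hC⟩ := F.H_bdd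
    have hn : 0 < ‖x‖ := norm_pos_iff.2 hx
    exact hasFDerivAt_integral_of_dominated_of_fderiv_le (μ := (μ : Measure (Ga d))) (𝕜 := ℝ)
      (F := F.gT) (F' := F.hT)
      (x₀ := x) (bound := fun _ => C * (‖x‖ / 2)⁻¹) (nhd_half hx)
      (by filter_upwards [nhd_half hx] with y hy
          exact (F.gT_cont (half_ne hy)).aestronglyMeasurable)
      (gint _ (F.gT_cont hx)) (F.hT_cont hx).aestronglyMeasurable
      (Eventually.of_forall fun T y hy => (F.hT_norm hC (half_ne hy) T).trans (by
        have hy : ‖x‖ / 2 < ‖y‖ := hy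
        gcongr))
      (integrable_const _) (Eventually.of_forall fun T y hy => F.gT_deriv (half_ne hy) T)
  cH := by
    obtain ⟨C, hC0, hC⟩ := F.H_bdd
    intro x hx
    have hx : x ≠ 0 := hx
    have hn : 0 < ‖x‖ := norm_pos_iff.2 hx
    refine ContinuousAt.continuousWithinAt ?_
    refine continuousAt_of_dominated (bound := fun _ => C * (‖x‖ / 2)⁻¹) ?_ ?_
      (integrable_const _) ?_
    · filter_upwards [nhd_half hx] with y hy
      exact (F.hT_cont (half_ne hy)).aestronglyMeasurable
    · filter_upwards [nhd_half hx] with y hy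
      refine Eventually.of_forall fun T => (F.hT_norm hC (half_ne hy) T).trans ?_
      have hy : ‖x‖ / 2 < ‖y‖ := hy
      gcongr
    · refine Eventually.of_forall fun T => ?_
      unfold hT
      refine continuousAt_const.clm_comp (ContinuousAt.clm_comp ?_ continuousAt_const)
      have h1 : ContinuousAt F.H (T.1 x) :=
        F.cH.continuousAt (isOpen_compl_singleton.mem_nhds (Ga_ne T hx))
      exact h1.comp (f := fun y => T.1 y) T.1.continuous.continuousAt

theorem avg_f (μ : ProbabilityMeasure (Ga d)) (x : Eu d) :
    (F.avg μ).f x = ∫ T, F.f (T.1 x) ∂(μ : Measure (Ga d)) := rfl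

theorem int_cont (φ : Ga d → ℝ) (hφ : Continuous φ) :
    Continuous (fun μ : ProbabilityMeasure (Ga d) => ∫ T, φ T ∂(μ : Measure (Ga d))) :=
  ProbabilityMeasure.continuous_integral_boundedContinuousFunction
    (BoundedContinuousFunction.mkOfCompact ⟨φ, hφ⟩)

theorem avg_f_cont (x : Eu d) : Continuous (fun μ => (F.avg μ).f x) :=
  int_cont _ (F.fT_cont x)

theorem avg_H_cont {x : Eu d} (hx : x ≠ 0) : Continuous (fun μ => (F.avg μ).H x) := by
  rw [continuous_clm_apply]
  intro v
  suffices h : ∀ i, Continuous (fun μ : ProbabilityMeasure (Ga d) => ((F.avg μ).H x v) i) from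
    (PiLp.continuous_toLp 2 (fun _ : Fin d => ℝ)).comp (continuous_pi h)
  intro i
  have h1 : ∀ μ : ProbabilityMeasure (Ga d), ((F.avg μ).H x v) i =
      ∫ T, (F.hT x T v) i ∂(μ : Measure (Ga d)) := by
    intro μ
    have := ((EuclideanSpace.proj (𝕜 := ℝ) i).comp
      (ContinuousLinearMap.apply ℝ (Eu d) v)).integral_comp_comm
      (gint (μ : Measure (Ga d)) (F.hT_cont hx))
    exact this.symm
  simp only [h1]
  apply int_cont
  have := F.hT_cont hx
  fun_prop

theorem avg_nonneg (hF : ∀ x, 0 ≤ F.f x) (μ : ProbabilityMeasure (Ga d)) (x : Eu d) :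
    0 ≤ (F.avg μ).f x := integral_nonneg fun T => hF _

theorem avg_f_bdd {C : ℝ} (hC : ∀ x, |F.f x| ≤ C * ‖x‖) (μ : ProbabilityMeasure (Ga d)) (x : Eu d) :
    |(F.avg μ).f x| ≤ C * ‖x‖ := by
  rw [avg_f, ← Real.norm_eq_abs]
  have := norm_integral_le_of_norm_le_const (μ := (μ : Measure (Ga d))) (C := C * ‖x‖)
    (f := fun T : Ga d => F.f (T.1 x)) (Filter.Eventually.of_forall fun T => by
      have := hC (T.1 x)
      rwa [T.2 x] at this)
  simpa using this

theorem avg_H_bdd {C : ℝ} (hC : ∀ x, x ≠ 0 → ‖F.H x‖ ≤ C * ‖x‖⁻¹) (μ : ProbabilityMeasure (Ga d))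
    {x : Eu d} (hx : x ≠ 0) : ‖(F.avg μ).H x‖ ≤ C * ‖x‖⁻¹ := by
  have := norm_integral_le_of_norm_le_const (μ := (μ : Measure (Ga d))) (C := C * ‖x‖⁻¹)
    (f := F.hT x) (Filter.Eventually.of_forall fun T => F.hT_norm hC hx T)
  rw [probReal_univ, mul_one] at this
  exact this

/-- the functional part -/
theorem avg_cont_int (i : ℕ) : Continuous (fun μ : ProbabilityMeasure (Ga d) =>
    ∫ u, (F.avg μ).c i u * (F.avg μ).f u ∂(sg d)) := by
  obtain ⟨C, hC0, hC⟩ := F.H_bdd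
  obtain ⟨C', hC0', hC'⟩ := F.K_bdd
  obtain ⟨M, hM⟩ := (isCompact_closedBall (0 : Eu d →L[ℝ] Eu d) C).exists_bound_of_continuousOn
    (cc_continuous i).continuousOn
  refine continuous_of_dominated (bound := fun _ => |M| * C') ?_ ?_ (integrable_const _) ?_
  · intro μ
    have h1 := (F.avg μ).c_cont i
    have h2 := (F.avg μ).f_cont_sph
    exact (h1.mul h2).aestronglyMeasurable
  · intro μ
    refine Filter.Eventually.of_forall fun u => ?_
    rw [norm_mul]
    have h1 := F.avg_f_bdd hC' μ u
    have h2 := F.avg_H_bdd hC μ (sph_ne u)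
    rw [sph_norm] at h1 h2
    have h3 := hM ((F.avg μ).H u) (by simpa using h2)
    refine mul_le_mul (h3.trans (le_abs_self _)) (by simpa using h1) (norm_nonneg _) (abs_nonneg _)
  · refine Filter.Eventually.of_forall fun u => ?_
    exact ((cc_continuous i).comp (F.avg_H_cont (sph_ne u))).mul (F.avg_f_cont u)

end Sm

/-- the open annulus -/
def Un (d : ℕ) : Set (Eu d) := {x | 1 < ‖x‖ ∧ ‖x‖ < 2}

theorem Un_open {d : ℕ} : IsOpen (Un d) :=
  (isOpen_lt continuous_const continuous_norm).inter (isOpen_lt continuous_norm continuous_const)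

/-- measure on the annulus -/
noncomputable def ua (d : ℕ) : Measure (Eu d) := volume.restrict (Un d)

instance ua_finite {d : ℕ} : IsFiniteMeasure (ua d) := by
  unfold ua
  refine isFiniteMeasure_restrict.2 (ne_of_lt ?_)
  refine lt_of_le_of_lt (measure_mono (t := closedBall (0 : Eu d) 2) fun x hx => ?_)
    (isCompact_closedBall _ _).measure_lt_top
  simpa using hx.2.le

theorem ua_ae {d : ℕ} : ∀ᵐ x ∂(ua d), x ∈ Un d := ae_restrict_mem Un_open.measurableSet

theorem ua_int {d : ℕ} {φ : Eu d → ℝ} (h : Continuous φ) : Integrable φ (ua d) := by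
  have h1 : IntegrableOn φ (closedBall (0 : Eu d) 2) :=
    h.continuousOn.integrableOn_compact (isCompact_closedBall _ _)
  exact h1.mono_set fun x hx => by simpa using hx.2.le

theorem ua_mp {d : ℕ} (R : Ga d) : MeasurePreserving (fun x => R.1 x) (ua d) (ua d) := by
  let e : Eu d ≃ₗᵢ[ℝ] Eu d :=
    LinearIsometry.toLinearIsometryEquiv ⟨R.1.toLinearMap, R.2⟩ rfl
  have h1 : MeasurePreserving e volume volume := e.measurePreserving
  have h2 := h1.restrict_preimage (s := Un d) Un_open.measurableSet
  have h3 : e ⁻¹' (Un d) = Un d := by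
    ext x
    have : ‖e x‖ = ‖x‖ := e.norm_map x
    simp only [Set.mem_preimage, Un, Set.mem_ofPred_eq, this]
  rw [h3] at h2
  exact h2

theorem ua_inv {d : ℕ} (R : Ga d) {φ : Eu d → ℝ} (h : Continuous φ) :
    ∫ x, φ (R.1 x) ∂(ua d) = ∫ x, φ x ∂(ua d) := by
  have h1 := ua_mp R
  have h2 := integral_map (μ := ua d) (φ := fun x => R.1 x) h1.measurable.aemeasurable
    (f := φ) h.aestronglyMeasurable
  rw [h1.map_eq] at h2
  exact h2.symm

namespace Sm
variable {d : ℕ}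

/-- rotate -/
noncomputable def rot (F : Sm d) (R : Ga d) : Sm d := F.avg ⟨Measure.dirac R, inferInstance⟩

@[simp] theorem rot_f (F : Sm d) (R : Ga d) (x : Eu d) : (F.rot R).f x = F.f (R.1 x) := by
  change ∫ T, F.f (T.1 x) ∂(Measure.dirac R) = _
  rw [integral_dirac]

/-- right translation -/
def rmul (R : Ga d) (T : Ga d) : Ga d := ⟨T.1.comp R.1, fun x => by
  rw [ContinuousLinearMap.comp_apply, T.2, R.2]⟩

theorem rmul_cont (R : Ga d) : Continuous (rmul R) := by
  refine Continuous.subtype_mk ?_ _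
  exact continuous_subtype_val.clm_comp continuous_const

theorem exists_mix (F : Sm d) (μ : ProbabilityMeasure (Ga d)) (R : Ga d) (ε : ℝ) (hε : 0 < ε) :
    ∃ ν : ProbabilityMeasure (Ga d), ∀ x, (F.avg ν).f x =
      (1 + ε)⁻¹ * ((F.avg μ).f x + ε * (F.avg μ).f (R.1 x)) := by
  have h1 : 0 < 1 + ε := by linarith
  let m : Measure (Ga d) := ENNReal.ofReal (1 + ε)⁻¹ • (μ : Measure (Ga d)) +
    ENNReal.ofReal ((1 + ε)⁻¹ * ε) • (μ : Measure (Ga d)).map (rmul R)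
  have hp : IsProbabilityMeasure ((μ : Measure (Ga d)).map (rmul R)) :=
    Measure.isProbabilityMeasure_map (rmul_cont R).measurable.aemeasurable
  have hm : IsProbabilityMeasure m := by
    constructor
    simp only [m, Measure.add_apply, Measure.smul_apply, measure_univ, smul_eq_mul, mul_one]
    rw [← ENNReal.ofReal_add (by positivity) (by positivity)]
    have : (1 + ε)⁻¹ + (1 + ε)⁻¹ * ε = 1 := by field_simp
    rw [this, ENNReal.ofReal_one]
  refine ⟨⟨m, hm⟩, fun x => ?_⟩
  rw [avg_f]
  change ∫ T, F.f (T.1 x) ∂m = _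
  have hc := F.fT_cont x
  rw [integral_add_measure (gint _ hc |>.smul_measure ENNReal.ofReal_ne_top)
    (gint _ hc |>.smul_measure ENNReal.ofReal_ne_top), integral_smul_measure, integral_smul_measure,
    integral_map (rmul_cont R).measurable.aemeasurable hc.aestronglyMeasurable,
    ENNReal.toReal_ofReal (by positivity), ENNReal.toReal_ofReal (by positivity),
    smul_eq_mul, smul_eq_mul]
  change _ = (1 + ε)⁻¹ * (∫ T, F.f (T.1 x) ∂(μ : Measure (Ga d)) +
    ε * ∫ T, F.f (T.1 (R.1 x)) ∂(μ : Measure (Ga d)))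
  simp only [rmul, ContinuousLinearMap.comp_apply]
  ring

/-- penalized functional -/
noncomputable def Ph (i : ℕ) (δ : ℝ) (F : Sm d) : ℝ := F.I i - δ * ∫ x, F.f x ^ 2 ∂(ua d)

theorem Ph_congr {F F' : Sm d} (i : ℕ) (δ : ℝ) (h : ∀ x, F.f x = F'.f x) : Ph i δ F = Ph i δ F' := by
  unfold Ph; rw [I_congr i h]; simp only [h]

theorem Ph_cont (hd : 1 < d) (F : Sm d) (hF : ∀ x, 0 ≤ F.f x) (i : ℕ) (hi : i < d) (δ : ℝ) :
    Continuous (fun μ => Ph i δ (F.avg μ)) := by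
  unfold Ph
  have h0 : (((d - i : ℕ) : ℝ)) ≠ 0 := by
    have : d - i ≠ 0 := by omega
    exact_mod_cast this
  have h1 : ∀ μ, (F.avg μ).I i = (∫ u, (F.avg μ).c i u * (F.avg μ).f u ∂(sg d)) / (d - i : ℕ) := by
    intro μ
    rw [int_c_f hd _ (F.avg_nonneg hF μ) i hi]; field_simp
  simp only [h1]
  refine ((F.avg_cont_int i).div_const _).sub (continuous_const.mul ?_)
  obtain ⟨C, hC0, hC⟩ := F.K_bdd
  refine continuous_of_dominated (bound := fun _ => (C * 2) ^ 2) ?_ ?_ (integrable_const _) ?_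
  · intro μ
    exact ((F.avg μ).continuous.pow 2).aestronglyMeasurable
  · intro μ
    filter_upwards [ua_ae] with x hx
    rw [norm_pow, Real.norm_eq_abs]
    gcongr
    refine (F.avg_f_bdd hC μ x).trans ?_
    gcongr
    exact hx.2.le
  · exact Filter.Eventually.of_forall fun x => (F.avg_f_cont x).pow 2

open Filter Topology in
theorem variation (hd : 1 < d) (F : Sm d) (hF : ∀ x, 0 ≤ F.f x) (i : ℕ) (hi : i < d) (δ : ℝ)
    (μ : ProbabilityMeasure (Ga d)) (hmax : ∀ ν, Ph i δ (F.avg ν) ≤ Ph i δ (F.avg μ)) (R : Ga d) :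
    ∫ u, (F.avg μ).c i u * ((F.avg μ).f (R.1 u) - (F.avg μ).f u) ∂(sg d) +
      δ * ∫ x, ((F.avg μ).f (R.1 x) - (F.avg μ).f x) ^ 2 ∂(ua d) ≤ 0 := by
  set F0 := F.avg μ with hF0
  have hp := F.avg_nonneg hF μ
  rw [← hF0] at hp
  set g := F0.rot R with hg
  have hgf : ∀ x, g.f x = F0.f (R.1 x) := F0.rot_f R
  have hgp : ∀ x, 0 ≤ g.f x := fun x => by rw [hgf]; exact hp _
  have hcf := F0.continuous
  have hcg := g.continuous
  set a := ∫ x, F0.f x ^ 2 ∂(ua d) with ha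
  set b := ∫ x, F0.f x * g.f x ∂(ua d) with hb
  have hag : ∫ x, g.f x ^ 2 ∂(ua d) = a := by
    simp only [hgf]; exact ua_inv R (φ := fun x => F0.f x ^ 2) (hcf.pow 2)
  have hquad : ∀ s t : ℝ, ∫ x, (s * F0.f x + t * g.f x) ^ 2 ∂(ua d) = s ^ 2 * a + 2 * s * t * b + t ^ 2 * a := by
    intro s t
    have e : ∀ x, (s * F0.f x + t * g.f x) ^ 2 = s ^ 2 * F0.f x ^ 2 + 2 * s * t * (F0.f x * g.f x)
        + t ^ 2 * g.f x ^ 2 := fun x => by ring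
    simp only [e]
    rw [integral_add, integral_add, integral_const_mul, integral_const_mul, integral_const_mul, hag]
    all_goals exact ua_int (by fun_prop)
  have hlim := dI hd F0 g hgp i hi
  set n := d - i with hn
  have hbnd : ∀ᶠ ε : ℝ in 𝓝[>] 0, ((F0.mix g ε).I i - F0.I i) / ε ≤
      ((1 + ε) ^ n - 1) / ε * F0.I i + 2 * δ * (b - a) * (1 + ε) ^ n * ((1 + ε)⁻¹) ^ 2 := by
    filter_upwards [self_mem_nhdsWithin] with ε hε
    have hε : 0 < ε := hε
    have h1 : 0 < 1 + ε := by linarith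
    obtain ⟨ν, hν⟩ := F.exists_mix μ R ε hε
    have h2 := hmax ν
    have h3 : ∀ x, (F.avg ν).f x = ((F0.mix g ε).scale (1 + ε)⁻¹ (inv_pos.2 h1).le).f x := by
      intro x
      rw [hν, ← hF0, ← hgf]
      change _ = (1 + ε)⁻¹ * (F0.f x + |ε| * g.f x)
      rw [abs_of_pos hε]
    unfold Ph at h2
    rw [I_congr i h3, I_scale hd _ _ (inv_pos.2 h1) i hi.le, ← hn] at h2
    have h4 : ∫ x, (F.avg ν).f x ^ 2 ∂(ua d) = ((1 + ε)⁻¹) ^ 2 * (a + 2 * ε * b + ε ^ 2 * a) := by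
      have e : ∀ x, (F.avg ν).f x = (1 + ε)⁻¹ * F0.f x + (1 + ε)⁻¹ * ε * g.f x := fun x => by
        rw [hν, ← hF0, ← hgf]; ring
      simp only [e]
      rw [hquad]; ring
    rw [h4, ← ha] at h2
    have h5 : ((1 + ε)⁻¹) ^ 2 * (a + 2 * ε * b + ε ^ 2 * a) = a + 2 * ε * (b - a) * ((1 + ε)⁻¹) ^ 2 := by
      field_simp; ring
    rw [h5] at h2
    have h6 : (F0.mix g ε).I i ≤ (1 + ε) ^ n * (F0.I i + 2 * δ * ε * (b - a) * ((1 + ε)⁻¹) ^ 2) := by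
      have h7 : (1 + ε)⁻¹ ^ n * (F0.mix g ε).I i ≤ F0.I i + 2 * δ * ε * (b - a) * ((1 + ε)⁻¹) ^ 2 := by
        linarith
      have h8 : (F0.mix g ε).I i = (1 + ε) ^ n * ((1 + ε)⁻¹ ^ n * (F0.mix g ε).I i) := by
        rw [← mul_assoc, ← mul_pow, mul_inv_cancel₀ h1.ne', one_pow, one_mul]
      rw [h8]
      gcongr
    rw [div_le_iff₀ hε]
    refine (sub_le_sub_right h6 _).trans (le_of_eq ?_)
    have h9 : ((1 + ε) ^ n - 1) / ε * F0.I i * ε = ((1 + ε) ^ n - 1) * F0.I i := by field_simp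
    rw [add_mul, h9]
    ring
  have hd1 : Tendsto (fun ε : ℝ => ((1 + ε) ^ n - 1) / ε) (𝓝[>] 0) (𝓝 n) := by
    have h1 : HasDerivAt (fun ε : ℝ => (1 + ε) ^ n) n 0 := by
      have := ((hasDerivAt_id (0 : ℝ)).const_add 1).pow n
      refine HasDerivAt.congr_deriv this ?_
      simp
    have h2 := (hasDerivWithinAt_iff_tendsto_slope' (by simp)).1 (h1.hasDerivWithinAt (s := Set.Ioi 0))
    refine h2.congr fun x => ?_
    rw [slope_def_field]; simp
  have hd2 : Tendsto (fun ε : ℝ => ((1 + ε) ^ n - 1) / ε * F0.I i + 2 * δ * (b - a) * (1 + ε) ^ n * ((1 + ε)⁻¹) ^ 2)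
      (𝓝[>] 0) (𝓝 (n * F0.I i + 2 * δ * (b - a) * 1 * 1)) := by
    refine (hd1.mul_const _).add ?_
    have hc : ContinuousAt (fun ε : ℝ => 2 * δ * (b - a) * (1 + ε) ^ n * ((1 + ε)⁻¹) ^ 2) 0 := by
      have : (1 : ℝ) + 0 ≠ 0 := by norm_num
      fun_prop (disch := assumption)
    have := hc.tendsto.mono_left (nhdsWithin_le_nhds (s := Set.Ioi 0))
    simpa using this
  have hfin := le_of_tendsto_of_tendsto hlim hd2 hbnd
  have h10 := int_c_f hd F0 hp i hi
  have hcs := F0.c_cont i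
  have e1 : ∫ u, F0.c i u * (F0.f (R.1 u) - F0.f u) ∂(sg d) =
      ∫ u, F0.c i u * g.f u ∂(sg d) - ∫ u, F0.c i u * F0.f u ∂(sg d) := by
    rw [← integral_sub]
    · congr 1; funext u; rw [hgf]; ring
    · exact sint (hcs.mul g.f_cont_sph)
    · exact sint (hcs.mul F0.f_cont_sph)
  have e2 : ∫ x, (F0.f (R.1 x) - F0.f x) ^ 2 ∂(ua d) = 2 * a - 2 * b := by
    have := hquad (-1) 1
    have e : ∀ x, (F0.f (R.1 x) - F0.f x) ^ 2 = (-1 * F0.f x + 1 * g.f x) ^ 2 := fun x => by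
      rw [hgf]; ring
    simp only [e]
    rw [this]; ring
  rw [e1, e2, h10, ← hn]
  nlinarith

end Sm

open Filter Topology in
theorem sd {φ φ' φ'' : ℝ → ℝ} (h1 : ∀ θ, HasDerivAt φ (φ' θ) θ) (h2 : ∀ θ, HasDerivAt φ' (φ'' θ) θ) :
    Tendsto (fun θ => (φ θ + φ (-θ) - 2 * φ 0) / θ ^ 2) (𝓝[>] 0) (𝓝 (φ'' 0)) := by
  have hd : ∀ θ, HasDerivAt (fun θ => φ θ + φ (-θ) - 2 * φ 0) (φ' θ - φ' (-θ)) θ := by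
    intro θ
    have h3 := (h1 (-θ)).comp θ (hasDerivAt_neg θ)
    have h4 := ((h1 θ).add h3).sub_const (2 * φ 0)
    refine HasDerivAt.congr_deriv h4 ?_
    ring
  have hg : ∀ θ : ℝ, HasDerivAt (fun θ => θ ^ 2) (2 * θ) θ := by
    intro θ
    refine HasDerivAt.congr_deriv (hasDerivAt_pow 2 θ) ?_
    simp
  have hc0 : Tendsto (fun θ => φ θ + φ (-θ) - 2 * φ 0) (𝓝[>] 0) (𝓝 0) := by
    have := (hd 0).continuousAt.tendsto.mono_left (nhdsWithin_le_nhds (s := Set.Ioi 0))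
    have e : φ 0 + φ (-0) - 2 * φ 0 = 0 := by rw [neg_zero]; ring
    rw [e] at this
    exact this
  refine HasDerivAt.lhopital_zero_nhdsGT (Eventually.of_forall hd) (Eventually.of_forall hg) ?_
    hc0 ?_ ?_
  · filter_upwards [self_mem_nhdsWithin] with θ hθ
    have : 0 < θ := hθ
    positivity
  · have := (hg 0).continuousAt.tendsto.mono_left (nhdsWithin_le_nhds (s := Set.Ioi 0))
    simpa using this
  · have h3 : HasDerivAt (fun θ => φ' θ - φ' (-θ)) (2 * φ'' 0) 0 := by
      have h3 := (h2 (-0)).comp 0 (hasDerivAt_neg (0 : ℝ))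
      refine HasDerivAt.congr_deriv ((h2 0).sub h3) ?_
      simp; ring
    have h4 := (hasDerivWithinAt_iff_tendsto_slope' (by simp)).1 (h3.hasDerivWithinAt (s := Set.Ioi 0))
    have h5 := h4.div_const 2
    rw [mul_div_cancel_left₀ _ two_ne_zero] at h5
    refine h5.congr fun x => ?_
    rw [slope_def_field]; simp
    rw [div_div, mul_comm]

theorem sd_bd {φ φ' φ'' : ℝ → ℝ} (h1 : ∀ θ, HasDerivAt φ (φ' θ) θ) (h2 : ∀ θ, HasDerivAt φ' (φ'' θ) θ)
    {M : ℝ} (hM : ∀ θ, |φ'' θ| ≤ M) {θ : ℝ} (hθ : 0 < θ) :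
    |(φ θ + φ (-θ) - 2 * φ 0) / θ ^ 2| ≤ 2 * M := by
  have hd : ∀ θ, HasDerivAt (fun θ => φ θ + φ (-θ) - 2 * φ 0) (φ' θ - φ' (-θ)) θ := by
    intro θ
    have h3 := (h1 (-θ)).comp θ (hasDerivAt_neg θ)
    have h4 := ((h1 θ).add h3).sub_const (2 * φ 0)
    refine HasDerivAt.congr_deriv h4 ?_
    ring
  have hM0 : 0 ≤ M := (abs_nonneg _).trans (hM 0)
  have h3 : ∀ s t, |φ' s - φ' t| ≤ M * |s - t| := fun s t =>
    convex_univ.norm_image_sub_le_of_norm_hasDerivWithin_le (fun x _ => (h2 x).hasDerivWithinAt)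
      (fun x _ => hM x) (Set.mem_univ t) (Set.mem_univ s)
  have h4 := (convex_Icc 0 θ).norm_image_sub_le_of_norm_hasDerivWithin_le (C := 2 * M * θ)
    (fun x _ => (hd x).hasDerivWithinAt) (fun x hx => by
      refine (h3 _ _).trans ?_
      rw [sub_neg_eq_add, abs_of_nonneg (by linarith [hx.1])]
      nlinarith [hx.1, hx.2]) (Set.left_mem_Icc.2 hθ.le) (Set.right_mem_Icc.2 hθ.le)
  rw [abs_div, abs_of_pos (pow_pos hθ 2), div_le_iff₀ (pow_pos hθ 2)]
  have e : φ 0 + φ (-0) - 2 * φ 0 = 0 := by rw [neg_zero]; ring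
  rw [e, sub_zero, sub_zero, Real.norm_eq_abs, Real.norm_eq_abs, abs_of_pos hθ] at h4
  linarith [h4]

section rotation
variable {d : ℕ}

/-- plane projection -/
noncomputable def pA (a b : Fin d) : Eu d →L[ℝ] Eu d :=
  (EuclideanSpace.proj (𝕜 := ℝ) a).smulRight (EuclideanSpace.single a (1 : ℝ)) +
  (EuclideanSpace.proj (𝕜 := ℝ) b).smulRight (EuclideanSpace.single b (1 : ℝ))

/-- plane rotation generator -/
noncomputable def pJ (a b : Fin d) : Eu d →L[ℝ] Eu d :=
  (EuclideanSpace.proj (𝕜 := ℝ) a).smulRight (EuclideanSpace.single b (1 : ℝ)) -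
  (EuclideanSpace.proj (𝕜 := ℝ) b).smulRight (EuclideanSpace.single a (1 : ℝ))

theorem pA_apply (a b : Fin d) (x : Eu d) : pA a b x = x a • EuclideanSpace.single a (1 : ℝ) +
    x b • EuclideanSpace.single b (1 : ℝ) := rfl

theorem pJ_apply (a b : Fin d) (x : Eu d) : pJ a b x = x a • EuclideanSpace.single b (1 : ℝ) -
    x b • EuclideanSpace.single a (1 : ℝ) := rfl

theorem pnorm {a b : Fin d} (hab : a ≠ b) (x : Eu d) (s t w : ℝ) :
    ‖w • x + s • pA a b x + t • pJ a b x‖ ^ 2 = w ^ 2 * ‖x‖ ^ 2 + (2 * w * s + s ^ 2 + t ^ 2) * (x a ^ 2 + x b ^ 2) := by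
  rw [← real_inner_self_eq_norm_sq, ← real_inner_self_eq_norm_sq, pA_apply, pJ_apply]
  simp only [inner_add_left, inner_add_right, inner_smul_left, inner_smul_right, inner_sub_left,
    inner_sub_right, EuclideanSpace.inner_single_left, EuclideanSpace.inner_single_right,
    PiLp.single_apply, if_pos, if_neg hab, if_neg hab.symm, smul_add, smul_sub]
  simp
  ring

theorem pq_le {a b : Fin d} (hab : a ≠ b) (x : Eu d) : x a ^ 2 + x b ^ 2 ≤ ‖x‖ ^ 2 := by
  have h := pnorm hab x (-1) 0 1
  nlinarith [sq_nonneg ‖(1 : ℝ) • x + (-1 : ℝ) • pA a b x + (0 : ℝ) • pJ a b x‖]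

/-- rotation -/
noncomputable def pR (a b : Fin d) (hab : a ≠ b) (θ : ℝ) : Ga d :=
  ⟨(1 : ℝ) • ContinuousLinearMap.id ℝ (Eu d) + (Real.cos θ - 1) • pA a b + Real.sin θ • pJ a b, fun x => by
    have h := pnorm hab x (Real.cos θ - 1) (Real.sin θ) 1
    have h2 := Real.sin_sq_add_cos_sq θ
    rw [← sq_eq_sq₀ (norm_nonneg _) (norm_nonneg _)]
    refine Eq.trans h ?_
    linear_combination (x a ^ 2 + x b ^ 2) * h2⟩

theorem pR_apply (a b : Fin d) (hab : a ≠ b) (θ : ℝ) (x : Eu d) :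
    (pR a b hab θ).1 x = (1 : ℝ) • x + (Real.cos θ - 1) • pA a b x + Real.sin θ • pJ a b x := rfl

theorem pR_zero (a b : Fin d) (hab : a ≠ b) (x : Eu d) : (pR a b hab 0).1 x = x := by
  rw [pR_apply]; simp

theorem pR_deriv (a b : Fin d) (hab : a ≠ b) (θ : ℝ) (x : Eu d) :
    HasDerivAt (fun θ => (pR a b hab θ).1 x) ((-Real.sin θ) • pA a b x + Real.cos θ • pJ a b x) θ := by
  have h1 := ((Real.hasDerivAt_cos θ).sub_const 1).smul_const (pA a b x)
  have h2 := (Real.hasDerivAt_sin θ).smul_const (pJ a b x)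
  exact (h1.const_add ((1 : ℝ) • x)).add h2

theorem pR_deriv2 (a b : Fin d) (θ : ℝ) (x : Eu d) :
    HasDerivAt (fun θ => (-Real.sin θ) • pA a b x + Real.cos θ • pJ a b x)
      ((-Real.cos θ) • pA a b x + (-Real.sin θ) • pJ a b x) θ := by
  have h1 := ((Real.hasDerivAt_sin θ).neg).smul_const (pA a b x)
  have h2 := (Real.hasDerivAt_cos θ).smul_const (pJ a b x)
  exact h1.add h2

theorem pR_nb {a b : Fin d} (hab : a ≠ b) {s t : ℝ} (h : s ^ 2 + t ^ 2 = 1) (x : Eu d) :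
    ‖s • pA a b x + t • pJ a b x‖ ≤ ‖x‖ := by
  have h1 := pnorm hab x s t 0
  have h2 := pq_le hab x
  rw [zero_smul, zero_add] at h1
  rw [← sq_le_sq₀ (norm_nonneg _) (norm_nonneg _), h1]
  have : 2 * 0 * s + s ^ 2 + t ^ 2 = 1 := by linarith
  rw [this]; linarith

namespace Sm
variable (F : Sm d)

theorem ph1 {a b : Fin d} (hab : a ≠ b) {x : Eu d} (hx : x ≠ 0) (θ : ℝ) :
    HasDerivAt (fun θ => F.f ((pR a b hab θ).1 x))
      (inner ℝ (F.G ((pR a b hab θ).1 x)) ((-Real.sin θ) • pA a b x + Real.cos θ • pJ a b x)) θ := by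
  have := (F.hG _ (Ga_ne (pR a b hab θ) hx)).comp_hasDerivAt θ (pR_deriv a b hab θ x)
  exact this

theorem ph2 {a b : Fin d} (hab : a ≠ b) {x : Eu d} (hx : x ≠ 0) (θ : ℝ) :
    HasDerivAt (fun θ => inner ℝ (F.G ((pR a b hab θ).1 x)) ((-Real.sin θ) • pA a b x + Real.cos θ • pJ a b x))
      (inner ℝ (F.G ((pR a b hab θ).1 x)) ((-Real.cos θ) • pA a b x + (-Real.sin θ) • pJ a b x) +
       inner ℝ (F.H ((pR a b hab θ).1 x) ((-Real.sin θ) • pA a b x + Real.cos θ • pJ a b x))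
        ((-Real.sin θ) • pA a b x + Real.cos θ • pJ a b x)) θ := by
  have h1 := (F.hH _ (Ga_ne (pR a b hab θ) hx)).comp_hasDerivAt θ (pR_deriv a b hab θ x)
  exact h1.inner ℝ (pR_deriv2 a b θ x)

theorem ph_bd {CG CH : ℝ} (hG : ∀ x, x ≠ 0 → ‖F.G x‖ ≤ CG) (hH : ∀ x, x ≠ 0 → ‖F.H x‖ ≤ CH * ‖x‖⁻¹)
    {a b : Fin d} (hab : a ≠ b) {x : Eu d} (hx : ‖x‖ = 1) (θ : ℝ) :
    |inner ℝ (F.G ((pR a b hab θ).1 x)) ((-Real.cos θ) • pA a b x + (-Real.sin θ) • pJ a b x) +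
       inner ℝ (F.H ((pR a b hab θ).1 x) ((-Real.sin θ) • pA a b x + Real.cos θ • pJ a b x))
        ((-Real.sin θ) • pA a b x + Real.cos θ • pJ a b x)| ≤ CG + CH := by
  have hx0 : x ≠ 0 := by rw [← norm_pos_iff, hx]; norm_num
  have hsc := Real.sin_sq_add_cos_sq θ
  set v := (-Real.sin θ) • pA a b x + Real.cos θ • pJ a b x
  set w := (-Real.cos θ) • pA a b x + (-Real.sin θ) • pJ a b x
  set y := (pR a b hab θ).1 x with hy
  have hy0 : y ≠ 0 := Ga_ne _ hx0
  have hyn : ‖y‖ = 1 := by rw [hy, (pR a b hab θ).2, hx]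
  have hv : ‖v‖ ≤ 1 := by rw [← hx]; exact pR_nb hab (by linarith [neg_sq (Real.sin θ)]) x
  have hw : ‖w‖ ≤ 1 := by
    rw [← hx]; exact pR_nb hab (by linarith [neg_sq (Real.sin θ), neg_sq (Real.cos θ)]) x
  have h1 := hG y hy0
  have h2 := hH y hy0
  rw [hyn, inv_one, mul_one] at h2
  refine (abs_add_le _ _).trans (add_le_add ?_ ?_)
  · refine (abs_real_inner_le_norm _ _).trans ?_
    nlinarith [norm_nonneg w, norm_nonneg (F.G y)]
  · refine (abs_real_inner_le_norm _ _).trans ?_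
    have h3 := (F.H y).le_opNorm v
    have h4 : ‖F.H y v‖ ≤ CH := by nlinarith [norm_nonneg v, norm_nonneg (F.H y)]
    nlinarith [norm_nonneg v, norm_nonneg (F.H y v)]

open Filter Topology in
theorem second {i : ℕ} {δ : ℝ} (hδ : 0 ≤ δ)
    (hv : ∀ R : Ga d, ∫ u, F.c i u * (F.f (R.1 u) - F.f u) ∂(sg d) +
      δ * ∫ x, (F.f (R.1 x) - F.f x) ^ 2 ∂(ua d) ≤ 0) {a b : Fin d} (hab : a ≠ b) :
    ∫ u : sphere (0 : Eu d) 1, F.c i u * (inner ℝ (F.H u (pJ a b u)) (pJ a b u) - inner ℝ (F.G u) (pA a b u)) ∂(sg d) +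
      δ * ∫ x, (inner ℝ (F.G x) (pJ a b x)) ^ 2 ∂(ua d) ≤ 0 := by
  obtain ⟨CG, hCG0, hCG⟩ := F.G_bdd
  obtain ⟨CH, hCH0, hCH⟩ := F.H_bdd
  have hcR : ∀ θ, Continuous (fun x => F.f ((pR a b hab θ).1 x)) := fun θ =>
    F.continuous.comp (pR a b hab θ).1.continuous
  have hcRs : ∀ θ, Continuous (fun u : sphere (0 : Eu d) 1 => F.f ((pR a b hab θ).1 u)) := fun θ =>
    (hcR θ).comp continuous_subtype_val
  have hcf := F.f_cont_sph
  have hcc := F.c_cont i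
  have hfc := F.continuous
  have hA : Tendsto (fun θ : ℝ => ∫ u : sphere (0 : Eu d) 1, F.c i u *
      ((F.f ((pR a b hab θ).1 u) + F.f ((pR a b hab (-θ)).1 u) - 2 * F.f u) / θ ^ 2) ∂(sg d)) (𝓝[>] 0)
      (𝓝 (∫ u : sphere (0 : Eu d) 1, F.c i u * (inner ℝ (F.H u (pJ a b u)) (pJ a b u) - inner ℝ (F.G u) (pA a b u)) ∂(sg d))) := by
    refine tendsto_integral_filter_of_dominated_convergence (fun u => |F.c i u| * (2 * (CG + CH))) ?_ ?_ ?_ ?_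
    · refine Eventually.of_forall fun θ => ?_
      have h1 := hcRs θ
      have h2 := hcRs (-θ)
      exact (hcc.mul (((h1.add h2).sub (continuous_const.mul hcf)).div_const _)).aestronglyMeasurable
    · filter_upwards [self_mem_nhdsWithin] with θ hθ
      refine Eventually.of_forall fun u => ?_
      rw [norm_mul, Real.norm_eq_abs]
      refine mul_le_mul_of_nonneg_left ?_ (abs_nonneg _)
      have := sd_bd (F.ph1 hab (sph_ne u)) (F.ph2 hab (sph_ne u))
        (F.ph_bd hCG hCH hab (sph_norm u)) (show 0 < θ from hθ)
      rw [pR_zero] at this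
      exact this
    · exact sint (hcc.abs.mul continuous_const)
    · refine Eventually.of_forall fun u => Tendsto.const_mul _ ?_
      have := sd (F.ph1 hab (sph_ne u)) (F.ph2 hab (sph_ne u))
      simp only [pR_zero, Real.sin_zero, Real.cos_zero, neg_zero, zero_smul, one_smul, zero_add, add_zero] at this
      convert this using 2
      rw [neg_smul, one_smul, inner_neg_right]; ring
  have hB : Tendsto (fun θ : ℝ => ∫ x, ((F.f ((pR a b hab θ).1 x) - F.f x) / θ) ^ 2 ∂(ua d)) (𝓝[>] 0)
      (𝓝 (∫ x, (inner ℝ (F.G x) (pJ a b x)) ^ 2 ∂(ua d))) := by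
    refine tendsto_integral_filter_of_dominated_convergence (fun _ => (CG * 2) ^ 2) ?_ ?_ (integrable_const _) ?_
    · refine Eventually.of_forall fun θ => ?_
      exact ((((hcR θ).sub hfc).div_const _).pow 2).aestronglyMeasurable
    · filter_upwards [self_mem_nhdsWithin] with θ hθ
      have hθ : 0 < θ := hθ
      filter_upwards [ua_ae] with x hx
      have hx0 : x ≠ 0 := by rw [← norm_pos_iff]; linarith [hx.1]
      rw [norm_pow]
      gcongr
      have := convex_univ.norm_image_sub_le_of_norm_hasDerivWithin_le
        (fun θ _ => (F.ph1 hab hx0 θ).hasDerivWithinAt) (C := CG * 2) (fun θ _ => by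
          refine (abs_real_inner_le_norm _ _).trans ?_
          have h1 := hCG _ (Ga_ne (pR a b hab θ) hx0)
          have h2 := pR_nb hab (s := -Real.sin θ) (t := Real.cos θ) (by linarith [neg_sq (Real.sin θ), Real.sin_sq_add_cos_sq θ]) x
          have h3 := hx.2.le
          exact mul_le_mul h1 (h2.trans h3) (norm_nonneg _) hCG0) (Set.mem_univ 0) (Set.mem_univ θ)
      rw [pR_zero, sub_zero] at this
      rw [norm_div, div_le_iff₀ (norm_pos_iff.2 hθ.ne')]
      exact this
    · filter_upwards [ua_ae] with x hx
      have hx0 : x ≠ 0 := by rw [← norm_pos_iff]; linarith [hx.1]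
      refine Tendsto.pow ?_ 2
      have h1 := (hasDerivWithinAt_iff_tendsto_slope' (by simp)).1
        ((F.ph1 hab hx0 0).hasDerivWithinAt (s := Set.Ioi 0))
      simp only [pR_zero, Real.sin_zero, Real.cos_zero, neg_zero, zero_smul, one_smul, zero_add] at h1
      refine h1.congr fun θ => ?_
      rw [slope_def_field, pR_zero, sub_zero]
  refine le_of_tendsto (hA.add (hB.const_mul δ)) ?_
  filter_upwards [self_mem_nhdsWithin] with θ hθ
  have hθ : 0 < θ := hθ
  have h1 := hv (pR a b hab θ)
  have h2 := hv (pR a b hab (-θ))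
  have h3 : 0 ≤ δ * ∫ x, (F.f ((pR a b hab (-θ)).1 x) - F.f x) ^ 2 ∂(ua d) :=
    mul_nonneg hδ (integral_nonneg fun x => sq_nonneg _)
  have e1 : ∫ u : sphere (0 : Eu d) 1, F.c i u *
      ((F.f ((pR a b hab θ).1 u) + F.f ((pR a b hab (-θ)).1 u) - 2 * F.f u) / θ ^ 2) ∂(sg d) =
      (∫ u, F.c i u * (F.f ((pR a b hab θ).1 u) - F.f u) ∂(sg d) +
      ∫ u, F.c i u * (F.f ((pR a b hab (-θ)).1 u) - F.f u) ∂(sg d)) / θ ^ 2 := by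
    have hi : ∀ θ, Integrable (fun u : sphere (0 : Eu d) 1 => F.c i u * (F.f ((pR a b hab θ).1 u) - F.f u)) (sg d) :=
      fun θ => sint (hcc.mul ((hcRs θ).sub hcf))
    rw [← integral_add (hi θ) (hi (-θ)), ← integral_div]
    congr 1; funext u; ring
  have e2 : ∫ x, ((F.f ((pR a b hab θ).1 x) - F.f x) / θ) ^ 2 ∂(ua d) =
      (∫ x, (F.f ((pR a b hab θ).1 x) - F.f x) ^ 2 ∂(ua d)) / θ ^ 2 := by
    rw [← integral_div]
    congr 1; funext x; rw [div_pow]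
  rw [e1, e2, ← mul_div_assoc, ← add_div]
  exact div_nonpos_of_nonpos_of_nonneg (by linarith) (by positivity)

end Sm
end rotation

namespace Sm
variable {d : ℕ} (F : Sm d)

theorem G_cont_sph : Continuous (fun u : sphere (0 : Eu d) 1 => F.G u) :=
  F.contG.comp_continuous continuous_subtype_val fun u => sph_ne u

theorem sumE (hd : 1 < d) {u : Eu d} (hu : ‖u‖ = 1) :
    ∑ a, ∑ b, (if a = b then 0 else (inner ℝ (F.H u (pJ a b u)) (pJ a b u) - inner ℝ (F.G u) (pA a b u))) =
      2 * (cc (F.H u) (d - 2) - ((d : ℝ) - 1) * F.f u) := by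
  have hu0 : u ≠ 0 := by rw [← norm_pos_iff, hu]; norm_num
  set e : Fin d → Eu d := fun a => EuclideanSpace.single a (1 : ℝ) with he
  set h : Fin d → Fin d → ℝ := fun a b => inner ℝ (F.H u (e a)) (e b) with hh
  have h1 : ∀ a b, (if a = b then 0 else (inner ℝ (F.H u (pJ a b u)) (pJ a b u) - inner ℝ (F.G u) (pA a b u))) =
      (u a ^ 2 * h b b - u b * (u a * h a b) - u a * (u b * h b a) + u b ^ 2 * h a a) -
      (u a * F.G u a + u b * F.G u b - if a = b then 2 * (u a * F.G u a) else 0) := by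
    intro a b
    by_cases hab : a = b
    · subst hab; simp; ring
    · rw [if_neg hab, if_neg hab, pJ_apply, pA_apply]
      simp only [map_sub, map_smul, inner_add_right, inner_sub_left, inner_sub_right, inner_smul_left,
        inner_smul_right, EuclideanSpace.inner_single_right, hh, he]
      simp
      ring
  have hexp : u = ∑ a, u a • e a := by
    have := (EuclideanSpace.basisFun (Fin d) ℝ).sum_repr u
    simpa using this.symm
  have h2 : ∀ b, ∑ a, u a * h a b = 0 := by
    intro b
    have h3 := F.H_self hu0
    have h4 : F.H u u = ∑ a, u a • F.H u (e a) := by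
      conv_lhs => rw [hexp]
      rw [map_sum]
      refine Finset.sum_congr rfl fun a _ => ?_
      rw [map_smul, ← hexp]
    rw [h3] at h4
    have h5 := congrArg (fun z => inner ℝ z (e b)) h4
    simp only [inner_zero_left, sum_inner, inner_smul_left] at h5
    exact h5.symm
  have h3 : ∑ a, u a ^ 2 = 1 := by
    have := EuclideanSpace.norm_sq_eq u
    rw [hu] at this
    simpa using this.symm
  have h4 : ∑ a, u a * F.G u a = F.f u := by
    rw [← F.inner_G_self hu0]
    simp [PiLp.inner_apply]
  have h5 : ∑ a, h a a = cc (F.H u) (d - 2) := (cc_trace hd _).symm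
  simp only [h1]
  simp only [Finset.sum_sub_distrib, Finset.sum_add_distrib]
  have s1 : ∑ a, ∑ b, u a ^ 2 * h b b = cc (F.H u) (d - 2) := by
    simp only [← Finset.mul_sum, h5, ← Finset.sum_mul, h3, one_mul]
  have s2 : ∑ a, ∑ b, u b * (u a * h a b) = 0 := by
    rw [Finset.sum_comm]
    simp only [← Finset.mul_sum, h2, mul_zero, Finset.sum_const_zero]
  have s3 : ∑ a, ∑ b, u a * (u b * h b a) = 0 := by
    simp only [← Finset.mul_sum, h2, mul_zero, Finset.sum_const_zero]
  have s4 : ∑ a, ∑ b, u b ^ 2 * h a a = cc (F.H u) (d - 2) := by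
    rw [Finset.sum_comm]
    simp only [← Finset.mul_sum, h5, ← Finset.sum_mul, h3, one_mul]
  have s5 : ∑ a : Fin d, ∑ _b : Fin d, u a * F.G u a = d * F.f u := by
    simp only [Finset.sum_const, Finset.card_univ, Fintype.card_fin, nsmul_eq_mul, ← Finset.mul_sum, h4]
  have s6 : ∑ _a : Fin d, ∑ b : Fin d, u b * F.G u b = d * F.f u := by
    simp only [Finset.sum_const, Finset.card_univ, Fintype.card_fin, nsmul_eq_mul, h4]
  have s7 : ∑ a : Fin d, ∑ b : Fin d, (if a = b then 2 * (u a * F.G u a) else 0) = 2 * F.f u := by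
    simp only [Finset.sum_ite_eq, Finset.mem_univ, if_true, ← Finset.mul_sum, h4]
  rw [s1, s2, s3, s4, s5, s6, s7]
  ring

theorem rad0 (hd : 1 < d) (hF : ∀ x, 0 ≤ F.f x) {i : ℕ} (hi : i < d) {δ : ℝ} (hδ : 0 < δ)
    (hv : ∀ R : Ga d, ∫ u, F.c i u * (F.f (R.1 u) - F.f u) ∂(sg d) +
      δ * ∫ x, (F.f (R.1 x) - F.f x) ^ 2 ∂(ua d) ≤ 0) (a b : Fin d) :
    ∫ x, (inner ℝ (F.G x) (pJ a b x)) ^ 2 ∂(ua d) = 0 := by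
  set E : Fin d → Fin d → sphere (0 : Eu d) 1 → ℝ := fun a b u =>
    F.c i u * (if a = b then 0 else (inner ℝ (F.H u (pJ a b u)) (pJ a b u) - inner ℝ (F.G u) (pA a b u))) with hE
  set L : Fin d → Fin d → ℝ := fun a b => ∫ x, (inner ℝ (F.G x) (pJ a b x)) ^ 2 ∂(ua d) with hL
  have hL0 : ∀ a b, 0 ≤ L a b := fun a b => integral_nonneg fun x => sq_nonneg _
  have h1 : ∀ a b, ∫ u, E a b u ∂(sg d) + δ * L a b ≤ 0 := by
    intro a b
    by_cases hab : a = b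
    · subst hab
      simp [hE, hL, pJ_apply]
    · have := F.second hδ.le hv hab
      simp only [hE, if_neg hab]
      exact this
  have hcE : ∀ a b, Continuous (E a b) := by
    intro a b
    refine (F.c_cont i).mul ?_
    by_cases hab : a = b
    · simp only [if_pos hab]; exact continuous_const
    · simp only [if_neg hab]
      have h1 : Continuous (fun u : sphere (0 : Eu d) 1 => pJ a b (u : Eu d)) :=
        (pJ a b).continuous.comp continuous_subtype_val
      have h2 : Continuous (fun u : sphere (0 : Eu d) 1 => pA a b (u : Eu d)) :=
        (pA a b).continuous.comp continuous_subtype_val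
      exact ((F.H_cont_sph.clm_apply h1).inner h1).sub (F.G_cont_sph.inner h2)
  have h2 : ∑ a, ∑ b, ∫ u, E a b u ∂(sg d) =
      2 * ∫ u, F.c i u * (F.c (d - 2) u - ((d : ℝ) - 1) * F.f u) ∂(sg d) := by
    rw [← integral_const_mul]
    have e : ∀ u : sphere (0 : Eu d) 1, 2 * (F.c i u * (F.c (d - 2) u - ((d : ℝ) - 1) * F.f u)) =
        ∑ a, ∑ b, E a b u := by
      intro u
      have := F.sumE hd (sph_norm u)
      simp only [hE, ← Finset.mul_sum]
      rw [this]
      change _ = F.c i u * (2 * (F.c (d - 2) u - _))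
      ring
    simp only [e]
    rw [integral_finsetSum _ fun a _ => integrable_finset_sum _ fun b _ => sint (hcE a b)]
    refine Finset.sum_congr rfl fun a _ => ?_
    rw [integral_finsetSum _ fun b _ => sint (hcE a b)]
  have h3 := F.key hd hF i hi
  have h4 : ∑ a, ∑ b, δ * L a b ≤ 0 := by
    have : ∑ a, ∑ b, (∫ u, E a b u ∂(sg d) + δ * L a b) ≤ 0 :=
      Finset.sum_nonpos fun a _ => Finset.sum_nonpos fun b _ => h1 a b
    simp only [Finset.sum_add_distrib] at this
    linarith
  have h5 : δ * L a b ≤ ∑ a, ∑ b, δ * L a b := by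
    refine le_trans ?_ (Finset.single_le_sum (f := fun a => ∑ b, δ * L a b)
      (fun a _ => Finset.sum_nonneg fun b _ => mul_nonneg hδ.le (hL0 a b)) (Finset.mem_univ a))
    exact Finset.single_le_sum (f := fun b => δ * L a b)
      (fun b _ => mul_nonneg hδ.le (hL0 a b)) (Finset.mem_univ b)
  have h6 : L a b ≤ 0 := by
    by_contra h
    have : 0 < δ * L a b := mul_pos hδ (not_le.1 h)
    linarith
  exact le_antisymm h6 (hL0 a b)

theorem rad1 {a b : Fin d} (h : ∫ x, (inner ℝ (F.G x) (pJ a b x)) ^ 2 ∂(ua d) = 0) {x : Eu d} (hx : x ≠ 0) :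
    x a * F.G x b = x b * F.G x a := by
  obtain ⟨CG, hCG0, hCG⟩ := F.G_bdd
  have hcont : ContinuousOn (fun x => (inner ℝ (F.G x) (pJ a b x)) ^ 2) (Un d) := by
    have h1 : ContinuousOn F.G (Un d) := F.contG.mono fun x hx => by
      have : x ≠ 0 := by rw [← norm_pos_iff]; linarith [hx.1]
      exact this
    exact (h1.inner (pJ a b).continuous.continuousOn).pow 2
  have hIntg : Integrable (fun x => (inner ℝ (F.G x) (pJ a b x)) ^ 2) (ua d) := by
    refine Integrable.mono' (integrable_const ((CG * (‖pJ a b‖ * 2)) ^ 2))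
      (hcont.aestronglyMeasurable Un_open.measurableSet) ?_
    filter_upwards [ua_ae] with x hx
    have hx0 : x ≠ 0 := by rw [← norm_pos_iff]; linarith [hx.1]
    rw [norm_pow, Real.norm_eq_abs]
    gcongr
    refine (abs_real_inner_le_norm _ _).trans ?_
    refine mul_le_mul (hCG x hx0) ?_ (norm_nonneg _) hCG0
    exact ((pJ a b).le_opNorm x).trans (mul_le_mul_of_nonneg_left hx.2.le (norm_nonneg _))
  have h2 := (integral_eq_zero_iff_of_nonneg (fun x => sq_nonneg _) hIntg).1 h
  have h3 := Measure.eqOn_open_of_ae_eq h2 Un_open hcont continuousOn_const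
  have hn : 0 < ‖x‖ := norm_pos_iff.2 hx
  have hm : (3 / 2 * ‖x‖⁻¹) • x ∈ Un d := by
    have : ‖(3 / 2 * ‖x‖⁻¹) • x‖ = 3 / 2 := by
      rw [norm_smul, Real.norm_of_nonneg (by positivity), mul_assoc, inv_mul_cancel₀ hn.ne', mul_one]
    simp only [Un, Set.mem_ofPred_eq, this]; norm_num
  have h4 := h3 hm
  simp only [Pi.zero_apply, ne_eq, OfNat.ofNat_ne_zero, not_false_eq_true, pow_eq_zero_iff] at h4
  rw [F.G_smul hx (by positivity), map_smul, inner_smul_right] at h4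
  have h5 : inner ℝ (F.G x) (pJ a b x) = 0 := by
    rcases mul_eq_zero.1 h4 with h | h
    · have : 3 / 2 * ‖x‖⁻¹ ≠ 0 := by positivity
      exact absurd h this
    · exact h
  rw [pJ_apply, inner_sub_right, inner_smul_right, inner_smul_right,
    EuclideanSpace.inner_single_right, EuclideanSpace.inner_single_right] at h5
  simp at h5
  linarith

theorem rad2 (hd : 1 < d) (h : ∀ (x : Eu d), x ≠ 0 → ∀ a b, x a * F.G x b = x b * F.G x a) :
    ∃ κ : ℝ, ∀ x, F.f x = κ * ‖x‖ := by
  have hG : ∀ x : Eu d, x ≠ 0 → ‖x‖ ^ 2 • F.G x = F.f x • x := by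
    intro x hx
    ext b
    have h4 : ∑ a, x a * F.G x a = F.f x := by
      rw [← F.inner_G_self hx]
      simp [PiLp.inner_apply]
    have h3 := EuclideanSpace.norm_sq_eq x
    simp only [PiLp.smul_apply, smul_eq_mul]
    rw [h3, ← h4, Finset.sum_mul, Finset.sum_mul]
    refine Finset.sum_congr rfl fun a _ => ?_
    have := h x hx a b
    rw [Real.norm_eq_abs, sq_abs]
    linear_combination x a * this
  have hder : ∀ x ∈ ({0}ᶜ : Set (Eu d)), HasFDerivAt (fun x => F.f x / ‖x‖) (0 : Eu d →L[ℝ] ℝ) x := by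
    intro x hx
    have hx : x ≠ 0 := hx
    have hn : ‖x‖ ≠ 0 := norm_ne_zero_iff.2 hx
    have h1 := (F.hG x hx).mul ((hasDerivAt_inv hn).comp_hasFDerivAt x (nrm_deriv x hx))
    simp only [div_eq_mul_inv]
    refine HasFDerivAt.congr_fderiv h1 ?_
    ext v : 1
    have h2 := congrArg (fun z => inner ℝ z v) (hG x hx)
    simp only [inner_smul_left] at h2
    simp only [smul_apply, add_apply, innerSL_apply_apply, smul_eq_mul, inner_smul_left,
      zero_apply]
    simp at h2 ⊢
    field_simp
    linarith
  have hcon : IsPreconnected ({0}ᶜ : Set (Eu d)) := by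
    refine (isConnected_compl_singleton_of_one_lt_rank ?_ 0).isPreconnected
    rw [← Module.finrank_eq_rank, finrank_euclideanSpace_fin]
    exact_mod_cast hd
  have hne : (EuclideanSpace.single (⟨0, by omega⟩ : Fin d) (1 : ℝ)) ≠ 0 := by simp
  refine ⟨F.f (EuclideanSpace.single ⟨0, by omega⟩ 1) / ‖(EuclideanSpace.single (⟨0, by omega⟩ : Fin d) (1 : ℝ))‖, fun x => ?_⟩
  by_cases hx : x = 0
  · subst hx; simp [F.f_zero]
  · have := isOpen_compl_singleton.is_const_of_fderiv_eq_zero (𝕜 := ℝ) hcon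
      (fun x hx => (hder x hx).differentiableAt.differentiableWithinAt)
      (fun x hx => (hder x hx).fderiv) (show x ∈ ({0}ᶜ : Set (Eu d)) from hx)
      (show (EuclideanSpace.single (⟨0, by omega⟩ : Fin d) (1 : ℝ)) ∈ ({0}ᶜ : Set (Eu d)) from hne)
    rw [← this, div_mul_cancel₀ _ (norm_ne_zero_iff.2 hx)]

end Sm

/-- total mass of the norm -/
noncomputable def mm (d : ℕ) : ℝ := ∫ x, ‖x‖ ∂(ua d)

theorem mm_pos {d : ℕ} (hd : 1 < d) : 0 < mm d := by
  have hU : (Un d).Nonempty := ⟨(3 / 2 : ℝ) • EuclideanSpace.single ⟨0, by omega⟩ 1, by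
    simp only [Un, Set.mem_ofPred_eq, norm_smul]; norm_num⟩
  have h0 : 0 < volume (Un d) := Un_open.measure_pos volume hU
  unfold mm
  rw [integral_pos_iff_support_of_nonneg (fun x => norm_nonneg x) (ua_int continuous_norm)]
  have h1 : Un d ⊆ Function.support (fun x : Eu d => ‖x‖) := fun x hx => by
    have : ‖x‖ ≠ 0 := by linarith [hx.1]
    exact this
  refine lt_of_lt_of_le h0 ?_
  rw [ua, Measure.restrict_apply' Un_open.measurableSet]
  exact measure_mono fun x hx => ⟨h1 hx, hx⟩

/-- mean width type functional -/
noncomputable def mw {d : ℕ} (f : Eu d → ℝ) : ℝ := (∫ x, f x ∂(ua d)) / mm d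

namespace Sm
variable {d : ℕ} (F : Sm d)

theorem mw_nonneg (hF : ∀ x, 0 ≤ F.f x) : 0 ≤ mw F.f :=
  div_nonneg (integral_nonneg hF) (integral_nonneg fun x => norm_nonneg _)

theorem mw_avg (μ : ProbabilityMeasure (Ga d)) : mw (F.avg μ).f = mw F.f := by
  unfold mw
  congr 1
  simp only [avg_f]
  have hjc : Continuous (fun p : Eu d × Ga d => F.f (p.2.1 p.1)) := by
    refine F.continuous.comp ?_
    exact (continuous_subtype_val.comp continuous_snd).clm_apply continuous_fst
  obtain ⟨C, hC0, hC⟩ := F.K_bdd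
  rw [integral_integral_swap]
  · have : ∀ T : Ga d, ∫ x, F.f (T.1 x) ∂(ua d) = ∫ x, F.f x ∂(ua d) := fun T => ua_inv T F.continuous
    simp [this]
  · refine Integrable.mono' (integrable_const (C * 2)) hjc.aestronglyMeasurable ?_
    have : ∀ᵐ p ∂((ua d).prod (μ : Measure (Ga d))), p.1 ∈ Un d :=
      Measure.quasiMeasurePreserving_fst.ae ua_ae
    filter_upwards [this] with p hp
    simp only [Function.uncurry]
    refine (hC _).trans ?_
    rw [p.2.2]
    exact mul_le_mul_of_nonneg_left hp.2.le hC0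

theorem rot_one_f (x : Eu d) : (F.avg ⟨Measure.dirac ⟨ContinuousLinearMap.id ℝ (Eu d), fun _ => rfl⟩, inferInstance⟩).f x = F.f x :=
  F.rot_f _ x

theorem upper (hd : 1 < d) (hF : ∀ x, 0 ≤ F.f x) (i : ℕ) (hi : i < d) :
    F.I i ≤ (bl d (mw F.f) (F.mw_nonneg hF)).I i := by
  have h1 : ∀ δ : ℝ, 0 < δ → F.I i - δ * ∫ x, F.f x ^ 2 ∂(ua d) ≤ (bl d (mw F.f) (F.mw_nonneg hF)).I i := by
    intro δ hδ
    haveI : Nonempty (ProbabilityMeasure (Ga d)) :=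
      ⟨⟨Measure.dirac ⟨ContinuousLinearMap.id ℝ (Eu d), fun _ => rfl⟩, inferInstance⟩⟩
    obtain ⟨μ, -, hμ⟩ := isCompact_univ.exists_isMaxOn Set.univ_nonempty
      (Ph_cont hd F hF i hi δ).continuousOn
    have hmax : ∀ ν, Ph i δ (F.avg ν) ≤ Ph i δ (F.avg μ) := fun ν => hμ (Set.mem_univ ν)
    have hv := variation hd F hF i hi δ μ hmax
    obtain ⟨κ, hκ⟩ := (F.avg μ).rad2 hd fun x hx a b =>
      (F.avg μ).rad1 ((F.avg μ).rad0 hd (F.avg_nonneg hF μ) hi hδ hv a b) hx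
    have hκ' : κ = mw F.f := by
      rw [← F.mw_avg μ]
      unfold mw
      simp only [hκ]
      rw [integral_const_mul, ← mm, mul_div_cancel_right₀ _ (mm_pos hd).ne']
    have h2 := hmax ⟨Measure.dirac ⟨ContinuousLinearMap.id ℝ (Eu d), fun _ => rfl⟩, inferInstance⟩
    rw [Ph_congr i δ F.rot_one_f] at h2
    have h3 : (F.avg μ).I i = (bl d (mw F.f) (F.mw_nonneg hF)).I i :=
      I_congr i fun x => by rw [hκ, hκ', bl_f]
    have h4 : 0 ≤ δ * ∫ x, (F.avg μ).f x ^ 2 ∂(ua d) :=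
      mul_nonneg hδ.le (integral_nonneg fun x => sq_nonneg _)
    unfold Ph at h2
    rw [h3] at h2
    linarith
  refine le_of_forall_pos_le_add fun ε hε => ?_
  set a := ∫ x, F.f x ^ 2 ∂(ua d) with ha
  have ha0 : 0 ≤ a := integral_nonneg fun x => sq_nonneg _
  have h2 := h1 (ε / (a + 1)) (by positivity)
  have h3 : ε / (a + 1) * a ≤ ε := by
    rw [div_mul_eq_mul_div, div_le_iff₀ (by positivity)]
    nlinarith
  linarith

end Sm

theorem mp_deriv (P : ℕ) (hP : 2 ≤ P) (t : ℝ) :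
    HasDerivAt (fun t : ℝ => max t 0 ^ P) (P * max t 0 ^ (P - 1)) t := by
  have hne : ∀ t : ℝ, t ≠ 0 → HasDerivAt (fun t : ℝ => max t 0 ^ P) (P * max t 0 ^ (P - 1)) t := by
    intro t ht
    rcases lt_or_gt_of_ne ht with h | h
    · rw [max_eq_right h.le, zero_pow (by omega), mul_zero]
      refine (hasDerivAt_const t (0 : ℝ)).congr_of_eventuallyEq ?_
      filter_upwards [Iio_mem_nhds h] with s hs
      have hs : s < 0 := hs
      rw [max_eq_right hs.le, zero_pow (by omega)]
    · rw [max_eq_left h.le]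
      refine (hasDerivAt_pow P t).congr_of_eventuallyEq ?_
      filter_upwards [Ioi_mem_nhds h] with s hs
      have hs : 0 < s := hs
      rw [max_eq_left hs.le]
  by_cases ht : t = 0
  · subst ht
    refine hasDerivAt_of_hasDerivAt_of_ne (g := fun t : ℝ => (P : ℝ) * max t 0 ^ (P - 1)) (fun y hy => hne y hy) ?_ ?_
    · exact (Continuous.pow (continuous_id.max continuous_const) P).continuousAt
    · exact (continuous_const.mul (Continuous.pow (continuous_id.max continuous_const) (P - 1))).continuousAt
  · exact hne t ht

theorem mp_cd (k : ℕ) : ∀ P : ℕ, k + 1 ≤ P → ContDiff ℝ k (fun t : ℝ => max t 0 ^ P) := by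
  induction k with
  | zero =>
    intro P _
    exact contDiff_zero.2 ((continuous_id.max continuous_const).pow P)
  | succ k ih =>
    intro P hP
    have hd : deriv (fun t : ℝ => max t 0 ^ P) = fun t => (P : ℝ) * max t 0 ^ (P - 1) := by
      funext t; exact (mp_deriv P (by omega) t).deriv
    rw [show ((k + 1 : ℕ) : WithTop ℕ∞) = (k : WithTop ℕ∞) + 1 by push_cast; rfl, contDiff_succ_iff_deriv]
    refine ⟨fun t => (mp_deriv P (by omega) t).differentiableAt, ?_, ?_⟩
    · intro h
      exact absurd h (by simp)
    · rw [hd]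
      exact contDiff_const.mul (ih (P - 1) (by omega))

namespace Sm
variable {d : ℕ}

/-- constructor from smoothness -/
noncomputable def ofCD (f : Eu d → ℝ) (hom : ∀ (t : ℝ) (x : Eu d), 0 ≤ t → f (t • x) = t * f x)
    (sub : ∀ x y, f (x + y) ≤ f x + f y) (h : ContDiffOn ℝ 2 f {0}ᶜ) : Sm d :=
  have hG1 : ContDiffOn ℝ 1 (gradient f) {0}ᶜ := by
    have h1 : ContDiffOn ℝ 1 (fderiv ℝ f) {0}ᶜ :=
      h.fderiv_of_isOpen isOpen_compl_singleton (by norm_num)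
    exact (InnerProductSpace.toDual ℝ (Eu d)).symm.toContinuousLinearEquiv.contDiff.comp_contDiffOn h1
  { f := f
    G := gradient f
    H := fderiv ℝ (gradient f)
    hom := hom
    sub := sub
    hG := fun x hx => by
      have h1 : DifferentiableAt ℝ f x :=
        (h.contDiffAt (isOpen_compl_singleton.mem_nhds hx)).differentiableAt (by norm_num)
      exact h1.hasGradientAt.hasFDerivAt
    hH := fun x hx => by
      have h1 : DifferentiableAt ℝ (gradient f) x :=
        (hG1.contDiffAt (isOpen_compl_singleton.mem_nhds hx)).differentiableAt (by norm_num)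
      exact h1.hasFDerivAt
    cH := hG1.continuousOn_fderiv_of_isOpen isOpen_compl_singleton le_rfl }

/-- components -/
noncomputable def wf (ε : ℝ) : Option (Eu d) → Eu d → ℝ
  | none, x => ε * ‖x‖
  | some v, x => max (inner ℝ v x) 0

theorem wf_nonneg {ε : ℝ} (hε : 0 ≤ ε) (j : Option (Eu d)) (x : Eu d) : 0 ≤ wf ε j x := by
  rcases j with _ | v
  · exact mul_nonneg hε (norm_nonneg _)
  · exact le_max_right _ _

theorem wf_hom {ε : ℝ} (j : Option (Eu d)) (t : ℝ) (x : Eu d) (ht : 0 ≤ t) :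
    wf ε j (t • x) = t * wf ε j x := by
  rcases j with _ | v
  · simp only [wf, norm_smul, Real.norm_of_nonneg ht]; ring
  · simp only [wf, inner_smul_right]
    rw [mul_max_of_nonneg _ _ ht, mul_zero]

theorem wf_sub {ε : ℝ} (hε : 0 ≤ ε) (j : Option (Eu d)) (x y : Eu d) :
    wf ε j (x + y) ≤ wf ε j x + wf ε j y := by
  rcases j with _ | v
  · simp only [wf, ← mul_add]
    exact mul_le_mul_of_nonneg_left (norm_add_le _ _) hε
  · simp only [wf, inner_add_right]
    refine max_le (add_le_add (le_max_left _ _) (le_max_left _ _)) (add_nonneg (le_max_right _ _) (le_max_right _ _))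

theorem wf_cd {ε : ℝ} (j : Option (Eu d)) (P : ℕ) (hP : 3 ≤ P) :
    ContDiffOn ℝ 2 (fun x => wf ε j x ^ P) {0}ᶜ := by
  rcases j with _ | v
  · intro x hx
    have h1 : ContDiffAt ℝ 2 (fun x : Eu d => ‖x‖) x := contDiffAt_norm ℝ hx
    exact ((contDiffAt_const.mul h1).pow P).contDiffWithinAt
  · have h1 : ContDiff ℝ 2 (fun x : Eu d => inner ℝ v x) := contDiff_const.inner ℝ contDiff_id
    exact ((mp_cd 2 P hP).comp h1).contDiffOn

/-- sums of powers -/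
noncomputable def Sw (ε : ℝ) (V : Finset (Eu d)) (P : ℕ) (x : Eu d) : ℝ :=
  ∑ j ∈ Finset.insertNone V, wf ε j x ^ (P : ℝ)

theorem Sw_nonneg {ε : ℝ} (hε : 0 ≤ ε) (V : Finset (Eu d)) (P : ℕ) (x : Eu d) : 0 ≤ Sw ε V P x :=
  Finset.sum_nonneg fun j _ => Real.rpow_nonneg (wf_nonneg hε j x) _

theorem wf_le_Sw {ε : ℝ} (hε : 0 ≤ ε) {V : Finset (Eu d)} {P : ℕ} (hP : 3 ≤ P) (x : Eu d) {j : Option (Eu d)}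
    (hj : j ∈ Finset.insertNone V) : wf ε j x ≤ Sw ε V P x ^ (1 / (P : ℝ)) := by
  have hp0 : (P : ℝ) ≠ 0 := by positivity
  have h1 : wf ε j x ^ (P : ℝ) ≤ Sw ε V P x :=
    Finset.single_le_sum (f := fun j => wf ε j x ^ (P : ℝ)) (fun j _ => Real.rpow_nonneg (wf_nonneg hε j x) _) hj
  have h2 := Real.rpow_le_rpow (Real.rpow_nonneg (wf_nonneg hε j x) _) h1 (show 0 ≤ 1 / (P : ℝ) by positivity)
  rw [← Real.rpow_mul (wf_nonneg hε j x), mul_one_div_cancel hp0, Real.rpow_one] at h2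
  exact h2

/-- smooth approximation of a polytope -/
noncomputable def ap (ε : ℝ) (hε : 0 < ε) (V : Finset (Eu d)) (P : ℕ) (hP : 3 ≤ P) : Sm d :=
  ofCD (fun x => Sw ε V P x ^ (1 / (P : ℝ)))
    (fun t x ht => by
      have hp0 : (P : ℝ) ≠ 0 := by positivity
      have : Sw ε V P (t • x) = t ^ (P : ℝ) * Sw ε V P x := by
        unfold Sw
        rw [Finset.mul_sum]
        refine Finset.sum_congr rfl fun j _ => ?_
        rw [wf_hom j t x ht, Real.mul_rpow ht (wf_nonneg hε.le j x)]
      rw [this, Real.mul_rpow (Real.rpow_nonneg ht _) (Sw_nonneg hε.le V P x), ← Real.rpow_mul ht,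
        mul_one_div_cancel hp0, Real.rpow_one])
    (fun x y => by
      have h1 : Sw ε V P (x + y) ≤ ∑ j ∈ Finset.insertNone V, (wf ε j x + wf ε j y) ^ (P : ℝ) :=
        Finset.sum_le_sum fun j _ => Real.rpow_le_rpow (wf_nonneg hε.le j _) (wf_sub hε.le j x y) (by positivity)
      have hp1 : (1 : ℝ) ≤ P := by exact_mod_cast (by omega : 1 ≤ P)
      refine (Real.rpow_le_rpow (Sw_nonneg hε.le _ _ _) h1 (by positivity)).trans ?_
      exact Real.Lp_add_le_of_nonneg _ hp1 (fun j _ => wf_nonneg hε.le j x) (fun j _ => wf_nonneg hε.le j y))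
    (by
      have h1 : ContDiffOn ℝ 2 (Sw ε V P) {0}ᶜ := by
        unfold Sw
        simp only [Real.rpow_natCast]
        exact ContDiffOn.sum fun j _ => wf_cd j P hP
      refine h1.rpow_const_of_ne fun x hx => ?_
      have hx : x ≠ 0 := hx
      have h2 := wf_le_Sw hε.le hP x (V := V) (j := none) (by simp)
      have h3 : 0 < wf ε none x := mul_pos hε (norm_pos_iff.2 hx)
      intro h0
      rw [h0, Real.zero_rpow (by positivity)] at h2
      linarith)

theorem ap_f (ε : ℝ) (hε : 0 < ε) (V : Finset (Eu d)) (P : ℕ) (hP : 3 ≤ P) (x : Eu d) :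
    (ap ε hε V P hP).f x = Sw ε V P x ^ (1 / (P : ℝ)) := rfl

theorem ap_upper (ε : ℝ) (hε : 0 < ε) (V : Finset (Eu d)) (P : ℕ) (hP : 3 ≤ P) {ζ : ℝ} (hζ : 0 < ζ)
    (hc : ((Finset.insertNone V).card : ℝ) ≤ (1 + ζ) ^ P) (x : Eu d) :
    ∃ j ∈ Finset.insertNone V, (ap ε hε V P hP).f x ≤ (1 + ζ) * wf ε j x := by
  have hp0 : (P : ℝ) ≠ 0 := by positivity
  obtain ⟨j, hj, hmax⟩ := Finset.exists_max_image (Finset.insertNone V) (fun j => wf ε j x) ⟨none, by simp⟩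
  refine ⟨j, hj, ?_⟩
  have hw := wf_nonneg hε.le j x
  have h1 : Sw ε V P x ≤ ((1 + ζ) * wf ε j x) ^ (P : ℝ) := by
    have h2 : Sw ε V P x ≤ (Finset.insertNone V).card • (wf ε j x ^ (P : ℝ)) :=
      Finset.sum_le_card_nsmul _ _ _ fun k hk =>
        Real.rpow_le_rpow (wf_nonneg hε.le k x) (hmax k hk) (by positivity)
    rw [nsmul_eq_mul] at h2
    rw [Real.mul_rpow (by positivity) hw, Real.rpow_natCast (1 + ζ)]
    exact h2.trans (mul_le_mul_of_nonneg_right hc (Real.rpow_nonneg hw _))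
  rw [ap_f]
  have h3 := Real.rpow_le_rpow (Sw_nonneg hε.le V P x) h1 (show 0 ≤ 1 / (P : ℝ) by positivity)
  rwa [← Real.rpow_mul (by positivity), mul_one_div_cancel hp0, Real.rpow_one] at h3

theorem approx {K : Set (Eu d)} (hK : IsCompact K) (h0 : (0 : Eu d) ∈ K) {η : ℝ} (hη : 0 < η) :
    ∃ F : Sm d, (∀ x, ∀ p ∈ K, inner ℝ p x ≤ F.f x) ∧ (∀ x, ∃ p ∈ K, F.f x ≤ inner ℝ p x + η * ‖x‖) := by
  set ε := η / 3 with hεd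
  have hε : 0 < ε := by positivity
  obtain ⟨t, htK, htf, htc⟩ := hK.finite_cover_balls hε
  set V := htf.toFinset with hV
  obtain ⟨C0, hC0⟩ := hK.isBounded.exists_norm_le
  set C := max C0 0 with hC
  have hCn : 0 ≤ C := le_max_right _ _
  have hCK : ∀ p ∈ K, ‖p‖ ≤ C := fun p hp => (hC0 p hp).trans (le_max_left _ _)
  set ζ := min 1 (ε / (C + 1)) with hζd
  have hζ : 0 < ζ := lt_min one_pos (by positivity)
  have hζ1 : ζ ≤ 1 := min_le_left _ _
  have hζC : ζ * C ≤ ε := by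
    have h1 : ζ ≤ ε / (C + 1) := min_le_right _ _
    calc ζ * C ≤ ε / (C + 1) * C := by gcongr
      _ ≤ ε := by rw [div_mul_eq_mul_div, div_le_iff₀ (by positivity)]; nlinarith
  obtain ⟨P0, hP0⟩ := pow_unbounded_of_one_lt ((Finset.insertNone V).card : ℝ) (show 1 < 1 + ζ by linarith)
  have hP : 3 ≤ P0 + 3 := by omega
  have hc : ((Finset.insertNone V).card : ℝ) ≤ (1 + ζ) ^ (P0 + 3) :=
    hP0.le.trans (pow_le_pow_right₀ (by linarith) (by omega))
  refine ⟨(ap ε hε V (P0 + 3) hP).par ε hε.le, fun x p hp => ?_, fun x => ?_⟩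
  · rw [par_f]
    obtain ⟨v, hv, hpv⟩ := Set.mem_iUnion₂.1 (htc hp)
    have h1 : wf ε (some v) x ≤ (ap ε hε V (P0 + 3) hP).f x := by
      rw [ap_f]; exact wf_le_Sw hε.le hP x (by simp [hV, hv])
    have h2 : inner ℝ v x ≤ wf ε (some v) x := le_max_left _ _
    have h3 : inner ℝ p x = inner ℝ v x + inner ℝ (p - v) x := by rw [inner_sub_left]; ring
    have h4 : inner ℝ (p - v) x ≤ ε * ‖x‖ := by
      refine (real_inner_le_norm _ _).trans ?_
      gcongr
      rw [mem_ball, dist_eq_norm] at hpv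
      exact hpv.le
    linarith
  · rw [par_f]
    have hx := norm_nonneg x
    have hεx : 0 ≤ ε * ‖x‖ := by positivity
    have hη3 : η = 3 * ε := by rw [hεd]; ring
    obtain ⟨j, hj, h⟩ := ap_upper ε hε V (P0 + 3) hP hζ hc x
    rcases j with _ | v
    · refine ⟨0, h0, ?_⟩
      rw [inner_zero_left, hη3]
      simp only [wf] at h
      nlinarith
    · simp only [wf] at h
      have hv : v ∈ K := htK (by simpa [hV] using hj)
      rcases le_total (inner ℝ v x) 0 with h1 | h1
      · refine ⟨0, h0, ?_⟩
        rw [max_eq_right h1, mul_zero] at h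
        rw [inner_zero_left, hη3]
        nlinarith
      · refine ⟨v, hv, ?_⟩
        rw [max_eq_left h1] at h
        have h2 : inner ℝ v x ≤ C * ‖x‖ := (real_inner_le_norm _ _).trans (by gcongr; exact hCK v hv)
        have h3 : ζ * inner ℝ v x ≤ ε * ‖x‖ := by
          calc ζ * inner ℝ v x ≤ ζ * (C * ‖x‖) := by gcongr
            _ = ζ * C * ‖x‖ := by ring
            _ ≤ _ := by gcongr
        rw [hη3]; linarith

theorem approx_sub {K : Set (Eu d)} {F : Sm d} (h : ∀ x, ∀ p ∈ K, inner ℝ p x ≤ F.f x) : K ⊆ F.K :=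
  fun p hp x => h x p hp

theorem approx_sup {K : Set (Eu d)} (hK : IsCompact K) (hc : Convex ℝ K) (hne : K.Nonempty) {η : ℝ} (hη : 0 ≤ η) {F : Sm d}
    (h : ∀ x, ∃ p ∈ K, F.f x ≤ inner ℝ p x + η * ‖x‖) : F.K ⊆ K + closedBall 0 η := by
  intro z hz
  obtain ⟨p, hp, hmin⟩ := exists_norm_eq_iInf_of_complete_convex hne hK.isClosed.isComplete hc z
  rw [norm_eq_iInf_iff_real_inner_le_zero hc hp] at hmin
  refine Set.mem_add.2 ⟨p, hp, z - p, ?_, by abel⟩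
  obtain ⟨p', hp', h1⟩ := h (z - p)
  have h2 := hmin p' hp'
  have h3 := hz (z - p)
  rw [mem_closedBall_zero_iff]
  have h4 : ‖z - p‖ ^ 2 ≤ η * ‖z - p‖ := by
    rw [← real_inner_self_eq_norm_sq, inner_sub_left]
    rw [real_inner_comm, inner_sub_left] at h2
    linarith
  by_contra h5
  nlinarith [norm_nonneg (z - p)]

end Sm

theorem iV_trans {d : ℕ} (k : ℕ) {A B : Set (Eu d)} (a : Eu d) (h : ∀ x, x ∈ B ↔ x + a ∈ A) :
    intrinsicVolume d k B = intrinsicVolume d k A := by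
  have h1 : ∀ ρ : ℝ, volume (B + closedBall (0 : Eu d) ρ) = volume (A + closedBall (0 : Eu d) ρ) := by
    intro ρ
    have : B + closedBall (0 : Eu d) ρ = (fun x => x + a) ⁻¹' (A + closedBall (0 : Eu d) ρ) := by
      ext x
      simp only [Set.mem_preimage, Set.mem_add]
      constructor
      · rintro ⟨y, hy, z, hz, rfl⟩
        exact ⟨y + a, (h y).1 hy, z, hz, by abel⟩
      · rintro ⟨y, hy, z, hz, hyz⟩
        refine ⟨y - a, (h _).2 (by simpa using hy), z, hz, ?_⟩
        have : x = y + z - a := by rw [hyz]; abel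
        rw [this]; abel
    rw [this, measure_preimage_add_right]
  unfold intrinsicVolume
  simp only [h1]

namespace Sm
variable {d : ℕ}

open Filter Topology in
theorem lim (hd : 1 < d) (k : ℕ) {K : Set (Eu d)} (hK : IsCompact K) (hc : Convex ℝ K) (h0 : (0 : Eu d) ∈ K) :
    ∃ F : ℕ → Sm d, (∀ n x, ∀ p ∈ K, inner ℝ p x ≤ (F n).f x) ∧
      (∀ n x, ∃ p ∈ K, (F n).f x ≤ inner ℝ p x + (1 / ((n : ℝ) + 1)) * ‖x‖) ∧
      Tendsto (fun n => (F n).I (d - k) / ballVolume (d - k)) atTop (𝓝 (intrinsicVolume d k K)) := by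
  choose F hF1 hF2 using fun n : ℕ => approx hK h0 (show 0 < 1 / ((n : ℝ) + 1) by positivity)
  refine ⟨F, hF1, hF2, ?_⟩
  have hη : Tendsto (fun n : ℕ => 1 / ((n : ℝ) + 1)) atTop (𝓝 0) := tendsto_one_div_add_atTop_nhds_zero_nat
  have hv : ∀ j : ℕ, Tendsto (fun n => (volume ((F n).K + closedBall (0 : Eu d) (j : ℝ))).toReal) atTop
      (𝓝 (volume (K + closedBall (0 : Eu d) (j : ℝ))).toReal) := by
    intro j
    have hKj : IsCompact (K + closedBall (0 : Eu d) (j : ℝ)) := hK.add (isCompact_closedBall _ _)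
    have h1 : Tendsto (fun r => volume (cthickening r (K + closedBall (0 : Eu d) (j : ℝ)))) (𝓝 0)
        (𝓝 (volume (K + closedBall (0 : Eu d) (j : ℝ)))) :=
      tendsto_measure_cthickening_of_isCompact hKj
    have h2 := h1.comp hη
    refine (ENNReal.tendsto_toReal hKj.measure_lt_top.ne).comp ?_
    refine tendsto_of_tendsto_of_tendsto_of_le_of_le tendsto_const_nhds h2 (fun n => ?_) (fun n => ?_)
    · exact measure_mono (Set.add_subset_add_right (approx_sub (hF1 n)))
    · refine measure_mono ?_
      have hn : 0 ≤ 1 / ((n : ℝ) + 1) := by positivity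
      rw [← hKj.add_closedBall_zero hn, add_assoc, add_comm (closedBall (0 : Eu d) (j : ℝ)), ← add_assoc]
      exact Set.add_subset_add_right (approx_sup hK hc ⟨0, h0⟩ hn (hF2 n))
  have e1 : ∀ A : Set (Eu d), intrinsicVolume d k A =
      cfn d (d - k) (fun j => (volume (A + closedBall (0 : Eu d) (j : ℝ))).toReal) / ballVolume (d - k) := fun A => rfl
  have e2 : ∀ n, (F n).I (d - k) / ballVolume (d - k) = intrinsicVolume d k (F n).K := fun n =>
    (I_eq_intrinsic hd (F n) k).symm
  simp only [e2, e1]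
  refine Tendsto.div_const ?_ _
  simp only [cfn_eq]
  exact tendsto_finset_sum _ fun j _ => (hv j).mul_const _

theorem ballVolume_nonneg (m : ℕ) : 0 ≤ ballVolume m := ENNReal.toReal_nonneg

theorem iV_nonneg (hd : 1 < d) (k : ℕ) {K : Set (Eu d)} (hK : IsCompact K) (hc : Convex ℝ K)
    (h0 : (0 : Eu d) ∈ K) : 0 ≤ intrinsicVolume d k K := by
  obtain ⟨F, -, -, h⟩ := lim hd k hK hc h0
  exact ge_of_tendsto' h fun n => div_nonneg (I_nonneg hd _ _ (Nat.sub_le _ _)) (ballVolume_nonneg _)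

theorem iV_lower (hd : 1 < d) (k : ℕ) {K : Set (Eu d)} (hK : IsCompact K) (hc : Convex ℝ K)
    {ρ : ℝ} (hρ : 0 ≤ ρ) (h0 : closedBall (0 : Eu d) ρ ⊆ K) :
    (bl d ρ hρ).I (d - k) / ballVolume (d - k) ≤ intrinsicVolume d k K := by
  obtain ⟨F, hF, -, h⟩ := lim hd k hK hc (h0 (by simpa using hρ))
  refine ge_of_tendsto' h fun n => ?_
  refine div_le_div_of_nonneg_right (I_lower hd _ ρ hρ (fun x => ?_) _ (Nat.sub_le _ _)) (ballVolume_nonneg _)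
  by_cases hx : x = 0
  · subst hx; simp [f_zero]
  have hn : ‖x‖ ≠ 0 := norm_ne_zero_iff.2 hx
  have := hF n x ((ρ * ‖x‖⁻¹) • x) (h0 (by
    rw [mem_closedBall_zero_iff, norm_smul, Real.norm_of_nonneg (by positivity), mul_assoc, inv_mul_cancel₀ hn, mul_one]))
  rw [inner_smul_left, real_inner_self_eq_norm_sq] at this
  refine le_trans (le_of_eq ?_) this
  simp
  field_simp

theorem I_bl (hd : 1 < d) {ρ : ℝ} (hρ : 0 < ρ) (i : ℕ) (hi : i ≤ d) :
    (bl d ρ hρ.le).I i = ρ ^ (d - i) * (bl d 1 zero_le_one).I i := by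
  rw [← I_scale hd _ ρ hρ i hi]
  refine I_congr i fun x => ?_
  change ρ * ‖x‖ = ρ * (1 * ‖x‖)
  rw [one_mul]

open Filter Topology in
theorem iV_upper (hd : 1 < d) (k : ℕ) (hk : 1 ≤ k) (hkd : k ≤ d) {K : Set (Eu d)} (hK : IsCompact K) (hc : Convex ℝ K)
    (h0 : (0 : Eu d) ∈ K) {ρ : ℝ} (hρ : 0 ≤ ρ)
    (hm : ∀ n : ℕ, ∀ F : Sm d, (∀ x, ∀ p ∈ K, inner ℝ p x ≤ F.f x) →
      (∀ x, ∃ p ∈ K, F.f x ≤ inner ℝ p x + (1 / ((n : ℝ) + 1)) * ‖x‖) → mw F.f ≤ ρ + 2 * (1 / ((n : ℝ) + 1))) :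
    intrinsicVolume d k K ≤ ρ ^ k * (bl d 1 zero_le_one).I (d - k) / ballVolume (d - k) := by
  obtain ⟨F, hF1, hF2, h⟩ := lim hd k hK hc h0
  have hη : Tendsto (fun n : ℕ => 1 / ((n : ℝ) + 1)) atTop (𝓝 0) := tendsto_one_div_add_atTop_nhds_zero_nat
  have h1 : Tendsto (fun n : ℕ => (ρ + 2 * (1 / ((n : ℝ) + 1))) ^ k * (bl d 1 zero_le_one).I (d - k) / ballVolume (d - k)) atTop
      (𝓝 ((ρ + 2 * 0) ^ k * (bl d 1 zero_le_one).I (d - k) / ballVolume (d - k))) :=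
    (((tendsto_const_nhds.add (hη.const_mul 2)).pow k).mul_const _).div_const _
  rw [mul_zero, add_zero] at h1
  refine le_of_tendsto_of_tendsto' h h1 fun n => ?_
  refine div_le_div_of_nonneg_right ?_ (ballVolume_nonneg _)
  have hp : ∀ x, 0 ≤ (F n).f x := fun x => by simpa using hF1 n x 0 h0
  have hpos : 0 < ρ + 2 * (1 / ((n : ℝ) + 1)) := by positivity
  have h2 := (F n).upper hd hp (d - k) (by omega)
  have h3 := hm n (F n) (hF1 n) (hF2 n)
  have h4 := I_lower hd (bl d _ hpos.le) (mw (F n).f) ((F n).mw_nonneg hp)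
    (fun x => by rw [bl_f]; exact mul_le_mul_of_nonneg_right h3 (norm_nonneg _)) (d - k) (Nat.sub_le _ _)
  rw [I_bl hd hpos _ (Nat.sub_le _ _), Nat.sub_sub_self hkd] at h4
  exact h2.trans h4

end Sm

theorem mw_le {d : ℕ} (hd : 1 < d) {f g : Eu d → ℝ} (hf : Continuous f) (hg : Continuous g) (h : ∀ x, f x ≤ g x) :
    mw f ≤ mw g :=
  div_le_div_of_nonneg_right (integral_mono (ua_int hf) (ua_int hg) h) (mm_pos hd).le

theorem mw_add {d : ℕ} {f g : Eu d → ℝ} (hf : Continuous f) (hg : Continuous g) :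
    mw (fun x => f x + g x) = mw f + mw g := by
  unfold mw
  rw [integral_add (ua_int hf) (ua_int hg), add_div]

theorem mw_norm {d : ℕ} (hd : 1 < d) (c : ℝ) : mw (fun x : Eu d => c * ‖x‖) = c := by
  unfold mw
  rw [integral_const_mul, ← mm, mul_div_cancel_right₀ _ (mm_pos hd).ne']

theorem mw_neg {d : ℕ} {f : Eu d → ℝ} (hf : Continuous f) : mw (fun x => f (-x)) = mw f := by
  unfold mw
  congr 1
  exact ua_inv ⟨-ContinuousLinearMap.id ℝ (Eu d), fun x => by simp⟩ hf

theorem mw_lin {d : ℕ} (a : Eu d) : mw (fun x => inner ℝ a x) = 0 := by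
  have h := mw_neg (f := fun x : Eu d => inner ℝ a x) (by fun_prop)
  have h2 : mw (fun x : Eu d => inner ℝ a (-x)) = - mw (fun x => inner ℝ a x) := by
    unfold mw
    simp only [inner_neg_right]
    rw [integral_neg, neg_div]
  linarith

theorem jung_small {E ι : Type*} [NormedAddCommGroup E] [InnerProductSpace ℝ E] [Fintype ι] [Nonempty ι]
    (q : ι → E) (lam : ℝ) (h : ∀ i j, ‖q i - q j‖ ≤ lam) :
    ∃ c, ∀ j, ‖q j - c‖ ^ 2 ≤ lam ^ 2 / 2 * (1 - 1 / (Fintype.card ι : ℝ)) := by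
  classical
  have hcont : Continuous (fun w : ι → ℝ => ∑ i, w i * ‖q i‖ ^ 2 - ‖∑ i, w i • q i‖ ^ 2) := by fun_prop
  obtain ⟨i0⟩ := ‹Nonempty ι›
  obtain ⟨w, hw, hmax⟩ := (isCompact_stdSimplex ℝ ι).exists_isMaxOn ⟨_, single_mem_stdSimplex ℝ i0⟩ hcont.continuousOn
  set c := ∑ i, w i • q i with hc
  set A := ∑ i, w i * ‖q i‖ ^ 2 with hA
  refine ⟨c, fun j => ?_⟩
  have h1 : ‖q j - c‖ ^ 2 ≤ A - ‖c‖ ^ 2 := by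
    have h2 : ∀ t : ℝ, 0 < t → t ≤ 1 → ‖q j - c‖ ^ 2 - (A - ‖c‖ ^ 2) ≤ t * ‖q j - c‖ ^ 2 := by
      intro t ht0 ht1
      have hm := hmax (convex_stdSimplex ℝ ι hw (single_mem_stdSimplex ℝ j) (by linarith : 0 ≤ 1 - t) ht0.le (by ring))
      have e1 : ∑ i, ((1 - t) • w + t • (Pi.single j 1 : ι → ℝ)) i * ‖q i‖ ^ 2 = (1 - t) * A + t * ‖q j‖ ^ 2 := by
        simp only [Pi.add_apply, Pi.smul_apply, smul_eq_mul, add_mul, Finset.sum_add_distrib, hA, Finset.mul_sum, mul_assoc]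
        congr 1
        simp [Pi.single_apply]
      have e2 : ∑ i, ((1 - t) • w + t • (Pi.single j 1 : ι → ℝ)) i • q i = c + t • (q j - c) := by
        have : ∑ i, ((1 - t) • w + t • (Pi.single j 1 : ι → ℝ)) i • q i = (1 - t) • c + t • q j := by
          simp only [Pi.add_apply, Pi.smul_apply, smul_eq_mul, add_smul, Finset.sum_add_distrib, hc, Finset.smul_sum, mul_smul]
          congr 1
          simp [Pi.single_apply]
        rw [this]
        module
      simp only [Set.mem_ofPred_eq] at hm
      rw [e1, e2, norm_add_sq_real, norm_smul, inner_smul_right, inner_sub_right, real_inner_self_eq_norm_sq, mul_pow,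
        Real.norm_of_nonneg ht0.le] at hm
      have e3 : ‖q j - c‖ ^ 2 = ‖q j‖ ^ 2 - 2 * inner ℝ c (q j) + ‖c‖ ^ 2 := by
        rw [norm_sub_sq_real, real_inner_comm]
      have h5 : t * (‖q j - c‖ ^ 2 - (A - ‖c‖ ^ 2)) ≤ t * (t * ‖q j - c‖ ^ 2) := by
        have e4 : t * ‖q j - c‖ ^ 2 = t * (‖q j‖ ^ 2 - 2 * inner ℝ c (q j) + ‖c‖ ^ 2) := by rw [e3]
        change _ ≤ A - ‖c‖ ^ 2 at hm
        linarith
      exact le_of_mul_le_mul_left h5 ht0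
    by_contra hcon
    push Not at hcon
    set D := ‖q j - c‖ ^ 2
    set φ := A - ‖c‖ ^ 2
    have hD : 0 ≤ D := by positivity
    have h3 := h2 (min 1 ((D - φ) / (2 * (D + 1)))) (lt_min one_pos (div_pos (by linarith) (by linarith))) (min_le_left _ _)
    have h4 : min 1 ((D - φ) / (2 * (D + 1))) * D ≤ (D - φ) / (2 * (D + 1)) * D := mul_le_mul_of_nonneg_right (min_le_right _ _) hD
    have h5 : (D - φ) / (2 * (D + 1)) * D ≤ (D - φ) / 2 := by
      rw [div_mul_eq_mul_div, div_le_div_iff₀ (by linarith) (by norm_num)]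
      nlinarith
    linarith
  refine h1.trans ?_
  have hs : ∑ i, w i = 1 := hw.2
  have h2 : ∑ i, ∑ j, w i * w j * ‖q i - q j‖ ^ 2 = 2 * (A - ‖c‖ ^ 2) := by
    have e : ∀ i j, w i * w j * ‖q i - q j‖ ^ 2 =
        w j * (w i * ‖q i‖ ^ 2) + w i * (w j * ‖q j‖ ^ 2) - 2 * inner ℝ (w i • q i) (w j • q j) := by
      intro i j
      rw [norm_sub_sq_real, inner_smul_left, inner_smul_right]
      simp only [conj_trivial]
      ring
    simp only [e, Finset.sum_sub_distrib, Finset.sum_add_distrib, ← Finset.mul_sum, ← Finset.sum_mul, ← inner_sum, ← sum_inner, hs, ← hc, ← hA]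
    rw [real_inner_self_eq_norm_sq]
    ring
  have h3 : ∑ i, ∑ j, w i * w j * ‖q i - q j‖ ^ 2 ≤ ∑ i, ∑ j, w i * w j * (lam ^ 2 - if i = j then lam ^ 2 else 0) := by
    refine Finset.sum_le_sum fun i _ => Finset.sum_le_sum fun j _ => mul_le_mul_of_nonneg_left ?_ (mul_nonneg (hw.1 i) (hw.1 j))
    split_ifs with hij
    · subst hij; simp
    · rw [sub_zero]; exact pow_le_pow_left₀ (norm_nonneg _) (h i j) 2
  have h4 : ∑ i, ∑ j, w i * w j * (lam ^ 2 - if i = j then lam ^ 2 else 0) = lam ^ 2 * (1 - ∑ i, w i ^ 2) := by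
    have : ∀ i, ∑ j, w i * w j * (lam ^ 2 - if i = j then lam ^ 2 else 0) = lam ^ 2 * w i - lam ^ 2 * w i ^ 2 := by
      intro i
      simp only [mul_sub, Finset.sum_sub_distrib, mul_ite, mul_zero, Finset.sum_ite_eq, Finset.mem_univ, if_true]
      rw [← Finset.sum_mul, ← Finset.mul_sum, hs]; ring
    simp only [this, Finset.sum_sub_distrib, ← Finset.mul_sum, hs]
    ring
  have h5 : 1 / (Fintype.card ι : ℝ) ≤ ∑ i, w i ^ 2 := by
    have := sq_sum_le_card_mul_sum_sq (s := Finset.univ) (f := w)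
    rw [hs, Finset.card_univ, one_pow] at this
    rw [div_le_iff₀ (by exact_mod_cast Fintype.card_pos_iff.2 ⟨i0⟩)]
    linarith
  have h6 : lam ^ 2 * (1 - ∑ i, w i ^ 2) ≤ lam ^ 2 * (1 - 1 / (Fintype.card ι : ℝ)) :=
    mul_le_mul_of_nonneg_left (by linarith) (sq_nonneg _)
  linarith

theorem jung {d N : ℕ} (hd : 1 < d) (q : Fin N → Eu d) (lam : ℝ) (hl : 0 < lam) (h : ∀ i j, dist (q i) (q j) ≤ lam) :
    ∃ c, ∀ i, dist (q i) c ≤ lam / 2 * Real.sqrt (2 * d / (d + 1)) := by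
  set R := lam / 2 * Real.sqrt (2 * d / (d + 1)) with hR
  have hR0 : 0 ≤ R := by positivity
  have hR2 : R ^ 2 = lam ^ 2 / 2 * (1 - 1 / ((d : ℝ) + 1)) := by
    rw [hR, mul_pow, Real.sq_sqrt (by positivity)]
    field_simp
    ring
  have key : (⋂ i ∈ (Finset.univ : Finset (Fin N)), closedBall (q i) R).Nonempty := by
    refine Convex.helly_theorem' (𝕜 := ℝ) (fun i _ => convex_closedBall _ _) fun I _ hI => ?_
    rw [finrank_euclideanSpace_fin] at hI
    rcases I.eq_empty_or_nonempty with rfl | hne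
    · simp
    haveI : Nonempty I := hne.to_subtype
    obtain ⟨c, hc⟩ := jung_small (fun i : I => q i) lam (fun i j => by rw [← dist_eq_norm]; exact h _ _)
    refine ⟨c, ?_⟩
    simp only [Set.mem_iInter]
    intro i hi
    rw [mem_closedBall, dist_comm, dist_eq_norm]
    refine le_of_sq_le_sq ?_ hR0
    refine (hc ⟨i, hi⟩).trans ?_
    rw [hR2, Fintype.card_coe]
    refine mul_le_mul_of_nonneg_left ?_ (by positivity)
    have : (1 : ℝ) / ((d : ℝ) + 1) ≤ 1 / (I.card : ℝ) :=
      one_div_le_one_div_of_le (by exact_mod_cast hne.card_pos) (by exact_mod_cast hI)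
    linarith
  obtain ⟨c, hc⟩ := key
  refine ⟨c, fun i => ?_⟩
  have := Set.mem_iInter₂.1 hc i (Finset.mem_univ _)
  rwa [mem_closedBall, dist_comm] at this

theorem Sm.bl_one_K (d : ℕ) : (Sm.bl d 1 zero_le_one).K = closedBall (0 : Eu d) 1 := by
  ext p
  simp only [Sm.K, Set.mem_ofPred_eq, Sm.bl_f, mem_closedBall_zero_iff, one_mul]
  constructor
  · intro h
    have := h p
    rw [real_inner_self_eq_norm_sq] at this
    by_contra hc
    push Not at hc
    nlinarith
  · intro h x
    exact (real_inner_le_norm p x).trans (mul_le_of_le_one_left (norm_nonneg _) h)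

theorem pack {d : ℕ} (hd : 1 < d) {N : ℕ} (hN : (1 + Real.sqrt (2 * d / (d + 1))) ^ d ≤ (N : ℝ))
    (p : Fin N → Eu d) (lam : ℝ) (hl : 0 < lam) (hp : ∀ i j, i ≠ j → lam ≤ dist (p i) (p j))
    (g : Sm d) (hg : ∀ i x, inner ℝ (p i) x ≤ g.f x) (hg0 : ∀ x, 0 ≤ g.f x) :
    lam / 2 * Real.sqrt (2 * d / (d + 1)) ≤ mw g.f := by
  have hl2 : 0 ≤ lam / 2 := by positivity
  haveI : Nontrivial (Eu d) := by
    haveI : Nonempty (Fin d) := ⟨⟨0, by omega⟩⟩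
    infer_instance
  set G := g.par (lam / 2) hl2 with hG
  have hG0 : ∀ x, 0 ≤ G.f x := fun x => by rw [hG, Sm.par_f]; have := hg0 x; positivity
  have hm : mw G.f = mw g.f + lam / 2 := by
    have : G.f = fun x => g.f x + (lam / 2) * ‖x‖ := rfl
    rw [this, mw_add g.continuous (by fun_prop), mw_norm hd]
  have hm0 : 0 ≤ mw g.f := g.mw_nonneg hg0
  have hmp : 0 < mw G.f := by rw [hm]; positivity
  have hu := G.upper hd hG0 0 (by omega)
  rw [Sm.I_bl hd hmp 0 (Nat.zero_le _), Sm.I_zero hd, Sm.I_zero hd, Nat.sub_zero] at hu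
  have hsub : (⋃ i, ball (p i) (lam / 2)) ⊆ G.K := by
    intro z hz
    obtain ⟨i, hi⟩ := Set.mem_iUnion.1 hz
    intro x
    rw [hG, Sm.par_f]
    have e : inner ℝ z x = inner ℝ (p i) x + inner ℝ (z - p i) x := by rw [inner_sub_left]; ring
    rw [e]
    refine add_le_add (hg i x) ((real_inner_le_norm _ _).trans (mul_le_mul_of_nonneg_right ?_ (norm_nonneg _)))
    rw [← dist_eq_norm]; exact (mem_ball.1 hi).le
  have hdis : Pairwise (Function.onFun Disjoint fun i => ball (p i) (lam / 2)) := by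
    intro i j hij
    refine ball_disjoint_ball ?_
    have := hp i j hij
    linarith
  have hv : volume.real (⋃ i, ball (p i) (lam / 2)) = N * ((lam / 2) ^ d * (Sm.bl d 1 zero_le_one).V) := by
    rw [measureReal_iUnion_fintype hdis (fun i => measurableSet_ball) (fun i => measure_ball_lt_top.ne)]
    have : ∀ i, volume.real (ball (p i) (lam / 2)) = (lam / 2) ^ d * (Sm.bl d 1 zero_le_one).V := by
      intro i
      rw [measureReal_def, Measure.addHaar_ball_of_pos _ _ (by positivity), finrank_euclideanSpace_fin, ENNReal.toReal_mul,
        ENNReal.toReal_ofReal (by positivity), Sm.V, Sm.bl_one_K, Measure.addHaar_closedBall_eq_addHaar_ball]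
    simp [this]
  have hle : volume.real (⋃ i, ball (p i) (lam / 2)) ≤ G.V := ENNReal.toReal_mono G.K_fin (measure_mono hsub)
  have hV : 0 < (Sm.bl d 1 zero_le_one).V := by
    rw [Sm.V, Sm.bl_one_K]
    exact ENNReal.toReal_pos (measure_closedBall_pos _ _ one_pos).ne' measure_closedBall_lt_top.ne
  rw [hv, ← mul_assoc] at hle
  have h1 := le_of_mul_le_mul_right (hle.trans hu) hV
  have h2 : ((1 + Real.sqrt (2 * d / (d + 1))) * (lam / 2)) ^ d ≤ mw G.f ^ d := by
    rw [mul_pow]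
    exact (mul_le_mul_of_nonneg_right hN (by positivity)).trans h1
  have h3 := le_of_pow_le_pow_left₀ (by omega) hmp.le h2
  rw [hm] at h3
  linarith

theorem mem_rDual_range {d N : ℕ} {r : ℝ} {p : Fin N → Eu d} {x : Eu d} :
    x ∈ rDual r (Set.range p) ↔ ∀ i, dist x (p i) ≤ r := by
  simp [rDual]

theorem convex_rDual {d : ℕ} (r : ℝ) (A : Set (Eu d)) : Convex ℝ (rDual r A) :=
  convex_iInter₂ fun _ _ => convex_closedBall _ _

theorem isCompact_rDual {d N : ℕ} (r : ℝ) (p : Fin N → Eu d) (i0 : Fin N) : IsCompact (rDual r (Set.range p)) := by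
  refine (isCompact_closedBall (p i0) r).of_isClosed_subset (isClosed_biInter fun _ _ => isClosed_closedBall) ?_
  intro x hx
  exact mem_rDual_range.1 hx i0

theorem rDual_trans {d N : ℕ} (r : ℝ) (p : Fin N → Eu d) (a x : Eu d) :
    x ∈ rDual r (Set.range fun i => p i - a) ↔ x + a ∈ rDual r (Set.range p) := by
  rw [mem_rDual_range, mem_rDual_range]
  refine forall_congr' fun i => ?_
  rw [dist_eq_norm, dist_eq_norm, show x - (p i - a) = x + a - p i by abel]

theorem iV_empty (d k : ℕ) : intrinsicVolume d k (∅ : Set (Eu d)) = 0 := by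
  unfold intrinsicVolume
  have : (fun j : ℕ => (volume ((∅ : Set (Eu d)) + closedBall (0 : Eu d) (j : ℝ))).toReal) = 0 := by
    funext j; simp
  rw [this, map_zero, Polynomial.coeff_zero, zero_div]

theorem mw_dual {d : ℕ} (hd : 1 < d) {N : ℕ} (hN : (1 + Real.sqrt (2 * d / (d + 1))) ^ d ≤ (N : ℝ)) (r : ℝ)
    (p : Fin N → Eu d) (i0 : Fin N) (lam : ℝ) (hl : 0 < lam) (hp : ∀ i j, i ≠ j → lam ≤ dist (p i) (p j))
    {η : ℝ} (hη : 0 < η) (F : Sm d)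
    (hF : ∀ x, ∃ a ∈ rDual r (Set.range p), F.f x ≤ inner ℝ a x + η * ‖x‖) :
    mw F.f ≤ r - lam / 2 * Real.sqrt (2 * d / (d + 1)) + 2 * η := by
  obtain ⟨g, hg1, hg2⟩ := Sm.approx (K := Set.range fun i => p i - p i0) (Set.finite_range _).isCompact
    ⟨i0, sub_self _⟩ hη
  have h1 := pack hd hN (fun i => p i - p i0) lam hl (fun i j hij => by simpa [dist_eq_norm] using hp i j hij) g
    (fun i x => hg1 x _ ⟨i, rfl⟩) (fun x => by simpa using hg1 x _ ⟨i0, rfl⟩)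
  have hgc : Continuous fun x => g.f (-x) := g.continuous.comp continuous_neg
  have h2 : mw (fun x => F.f x + g.f (-x)) ≤ mw (fun x => (r + 2 * η) * ‖x‖ + inner ℝ (p i0) x) := by
    refine mw_le hd (F.continuous.add hgc) (by fun_prop) fun x => ?_
    obtain ⟨a, ha, h3⟩ := hF x
    obtain ⟨_, ⟨j, rfl⟩, h4⟩ := hg2 (-x)
    have h5 := mem_rDual_range.1 ha j
    rw [dist_eq_norm] at h5
    have h6 : inner ℝ (a - p j) x ≤ r * ‖x‖ :=
      (real_inner_le_norm _ _).trans (mul_le_mul_of_nonneg_right h5 (norm_nonneg _))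
    rw [inner_sub_left] at h6
    simp only [inner_neg_right, inner_sub_left, norm_neg] at h4
    linarith
  rw [mw_add F.continuous hgc, mw_neg g.continuous, mw_add (by fun_prop) (by fun_prop), mw_norm hd, mw_lin] at h2
  linarith

theorem stmt_11 {d : ℕ} (hd : 1 < d) (k : ℕ) (hk : 1 ≤ k) (hkd : k ≤ d)
    (r : ℝ) (hr : 0 < r) (N : ℕ)
    (hN : (1 + Real.sqrt (2 * d / (d + 1))) ^ d ≤ (N : ℝ))
    (p q : Fin N → EuclideanSpace ℝ (Fin d))
    (lam : ℝ) (hlam : 0 < lam)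
    (hcontr : ∀ i j, i ≠ j → dist (q i) (q j) ≤ lam ∧ lam ≤ dist (p i) (p j)) :
    intrinsicVolume d k (rDual r (Set.range p))
      ≤ intrinsicVolume d k (rDual r (Set.range q)) := by
  have hN0 : 0 < N := by
    have : (0 : ℝ) < N := lt_of_lt_of_le (by positivity) hN
    exact_mod_cast this
  let i0 : Fin N := ⟨0, hN0⟩
  have hLn : 0 ≤ intrinsicVolume d k (rDual r (Set.range q)) := by
    rcases (rDual r (Set.range q)).eq_empty_or_nonempty with h | ⟨b, hb⟩
    · rw [h]; exact (iV_empty d k).ge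
    · rw [← iV_trans k b (rDual_trans r q b)]
      exact Sm.iV_nonneg hd k (isCompact_rDual r _ i0) (convex_rDual r _)
        ((rDual_trans r q b 0).2 (by rwa [zero_add]))
  rcases (rDual r (Set.range p)).eq_empty_or_nonempty with h | ⟨a, ha⟩
  · rw [h]; exact (iV_empty d k).le.trans hLn
  have h0 : (0 : Eu d) ∈ rDual r (Set.range fun i => p i - a) := (rDual_trans r p a 0).2 (by rwa [zero_add])
  rw [← iV_trans k a (rDual_trans r p a)]
  have hp : ∀ i j, i ≠ j → lam ≤ dist (p i - a) (p j - a) := fun i j hij => by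
    simpa [dist_eq_norm] using (hcontr i j hij).2
  set R := lam / 2 * Real.sqrt (2 * d / (d + 1)) with hR
  have hcomp := isCompact_rDual r (fun i => p i - a) i0
  have hρ : 0 ≤ r - R := by
    refine le_of_forall_pos_le_add fun ε hε => ?_
    obtain ⟨F, hF1, hF2⟩ := Sm.approx hcomp h0 (half_pos hε)
    have h1 := mw_dual hd hN r _ i0 lam hlam hp (half_pos hε) F hF2
    have h2 := F.mw_nonneg fun x => by simpa using hF1 x 0 h0
    linarith
  have hup := Sm.iV_upper hd k hk hkd hcomp (convex_rDual r _) h0 hρ fun n F _ hF2 =>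
    mw_dual hd hN r _ i0 lam hlam hp (by positivity) F hF2
  refine hup.trans ?_
  rcases hρ.eq_or_lt with h | hpos
  · rw [← h, zero_pow (by omega), zero_mul, zero_div]; exact hLn
  obtain ⟨c, hc⟩ := jung hd q lam hlam (fun i j => by
    by_cases hij : i = j
    · subst hij; simpa using hlam.le
    · exact (hcontr i j hij).1)
  rw [← iV_trans k c (rDual_trans r q c)]
  have hlo := Sm.iV_lower hd k (isCompact_rDual r _ i0) (convex_rDual r (Set.range fun i => q i - c)) hρ (by
    intro x hx
    rw [mem_rDual_range]
    intro i
    rw [mem_closedBall_zero_iff] at hx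
    have h1 := hc i
    rw [dist_eq_norm] at h1 ⊢
    exact (norm_sub_le _ _).trans (by linarith))
  rw [Sm.I_bl hd hpos _ (Nat.sub_le _ _), Nat.sub_sub_self hkd] at hlo
  exact hlo
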